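/- There is an absolute constant C > 0 such that the following holds. For d ≥ 2, let P(x) = x^d + A_{d-1}x^{d-1} + … + A_1 x + 1 ∈ ℤ[x] be a random polynomial whose coefficients A_1, …, A_{d-1} are independent random variables each taking the values 0 and 1 with probability 1/2. Assume that RH holds for ζ_K for every number field of the form K = ℚ(a), where a is a complex root of some nonzero polynomial all of whose coefficients lie in {0,1}. Then |ℙ(P is irreducible in ℤ[x]) − (1 − √(2/(π d)))| ≤ C/d. -/

import Mathlib

open Polynomial NumberField IntermediateField

def isDedekindZeta (K : Type*) [Field K] (f : ℂ → ℂ) : Prop :=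
  (∀ s : ℂ, s ≠ 1 → DifferentiableAt ℂ f s) ∧
  ∀ s : ℂ, 1 < s.re → f s = ∑' I : Ideal (𝓞 K), (Nat.card ((𝓞 K) ⧸ I) : ℂ) ^ (-s)

def RHFor (K : Type*) [Field K] : Prop :=
  ∀ f : ℂ → ℂ, isDedekindZeta K f → ∀ s : ℂ, f s = 0 → 0 < s.re → s.re < 1 → s.re = 1/2

noncomputable def zeroOnePoly (d : ℕ) (v : Fin (d - 1) → Bool) : Polynomial ℤ :=
  X ^ d + 1 + ∑ i : Fin (d - 1), C (if v i then 1 else 0) * X ^ ((i : ℕ) + 1)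

noncomputable def irrProb (d : ℕ) : ℝ :=
  (Nat.card {v : Fin (d - 1) → Bool // Irreducible (zeroOnePoly d v)} : ℝ) / 2 ^ (d - 1)

section Poisson

open MeasureTheory

variable {ι : Type*} [Fintype ι]

/-- The inclusion of the integer lattice `ℤ^ι` in `ℝ^ι`. -/
def intVec (m : ι → ℤ) : ι → ℝ := fun i => (m i : ℝ)

/-- The half-open unit cube with lower corner `intVec m`. -/
def unitCube (m : ι → ℤ) : Set (ι → ℝ) :=
  {x | ∀ i, x i ∈ Set.Ioc (m i : ℝ) (m i + 1)}

lemma unitCube_eq_pi {ι : Type*} (m : ι → ℤ) :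
    unitCube m = Set.pi Set.univ fun i => Set.Ioc (m i : ℝ) (m i + 1) := by
  ext x; simp [unitCube]

lemma measurableSet_unitCube (m : ι → ℤ) : MeasurableSet (unitCube m) := by
  rw [unitCube_eq_pi]
  exact MeasurableSet.univ_pi fun i => measurableSet_Ioc

lemma mem_unitCube_iff {ι : Type*} {m : ι → ℤ} {x : ι → ℝ} :
    x ∈ unitCube m ↔ ∀ i, ⌈x i⌉ = m i + 1 := by
  simp only [unitCube, Set.mem_ofPred_eq, Set.mem_Ioc, Int.ceil_eq_iff]
  simp

lemma pairwise_disjoint_unitCube {ι : Type*} :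
    Pairwise (Function.onFun Disjoint (unitCube : (ι → ℤ) → Set (ι → ℝ))) := by
  intro a b hab
  rw [Function.onFun, Set.disjoint_left]
  intro x ha hb
  rw [mem_unitCube_iff] at ha hb
  exact hab (funext fun i => by have := ha i; have := hb i; omega)

lemma iUnion_unitCube {ι : Type*} : (⋃ m : ι → ℤ, unitCube m) = Set.univ := by
  refine Set.eq_univ_of_forall fun x => Set.mem_iUnion.2 ⟨fun i => ⌈x i⌉ - 1, ?_⟩
  rw [mem_unitCube_iff]
  intro i; ring

lemma setIntegral_unitCube {E : Type*} [NormedAddCommGroup E] [NormedSpace ℝ E]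
    (g : (ι → ℝ) → E) (m : ι → ℤ) :
    ∫ x in unitCube m, g x = ∫ x in unitCube (0 : ι → ℤ), g (x + intVec m) := by
  have h := (measurePreserving_add_right
    (volume : Measure (ι → ℝ)) (intVec m)).setIntegral_preimage_emb
    (measurableEmbedding_addRight (intVec m)) g (unitCube m)
  rw [← h]
  congr 2
  ext x
  simp [unitCube, intVec, add_comm (x _)]

lemma hasSum_setIntegral_unitCube {E : Type*} [NormedAddCommGroup E] [NormedSpace ℝ E]
    {g : (ι → ℝ) → E} (hg : Integrable g) :
    HasSum (fun m : ι → ℤ => ∫ x in unitCube (0 : ι → ℤ), g (x + intVec m)) (∫ x, g x) := by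
  have h := hasSum_integral_iUnion (μ := volume) (f := g) (s := (unitCube : (ι → ℤ) → _))
    measurableSet_unitCube pairwise_disjoint_unitCube hg.integrableOn
  rw [iUnion_unitCube, Measure.restrict_univ] at h
  exact (funext fun m => setIntegral_unitCube g m) ▸ h

/-- The quotient map from `ℝ^ι` to the unit torus. -/
def torusMk : C(ι → ℝ, UnitAddTorus ι) :=
  ⟨fun x i => (x i : UnitAddCircle), by
    refine continuous_pi fun i => ?_
    exact (AddCircle.continuous_mk' 1).comp (continuous_apply i)⟩

lemma isQuotientMap_torusMk {ι : Type*} :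
    Topology.IsQuotientMap (torusMk : C(ι → ℝ, UnitAddTorus ι)) := by
  have h : IsOpenQuotientMap (fun (x : ι → ℝ) (i : ι) => (x i : UnitAddCircle)) :=
    IsOpenQuotientMap.piMap fun _ => QuotientAddGroup.isOpenQuotientMap_mk
  exact h.isQuotientMap

lemma torusMk_eq_iff {ι : Type*} {x y : ι → ℝ} (h : torusMk x = torusMk y) :
    ∃ m : ι → ℤ, y = x + intVec m := by
  have h' : ∀ i, ∃ n : ℤ, y i = x i + n := by
    intro i
    have := congrFun h i
    have h0 : ((y i - x i : ℝ) : UnitAddCircle) = 0 := by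
      rw [AddCircle.coe_sub, sub_eq_zero]; exact this.symm
    obtain ⟨n, hn⟩ := (AddCircle.coe_eq_zero_iff 1).1 h0
    exact ⟨n, by simp at hn; linarith⟩
  choose m hm using h'
  exact ⟨m, funext hm⟩

lemma torusMk_add {ι : Type*} (x : ι → ℝ) (m : ι → ℤ) : torusMk (x + intVec m) = torusMk x := by
  funext i
  show ((x i + (m i : ℝ) : ℝ) : UnitAddCircle) = x i
  rw [AddCircle.coe_add]
  simp

/-- The exponential function `x ↦ exp (2 π i n · x)` on `ℝ^ι`. -/
noncomputable def expVec (n : ι → ℤ) : C(ι → ℝ, ℂ) := (UnitAddTorus.mFourier n).comp torusMk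

lemma norm_expVec (n : ι → ℤ) (x : ι → ℝ) : ‖expVec n x‖ = 1 := by
  simp [expVec, UnitAddTorus.mFourier, Circle.norm_coe]

lemma expVec_add (n : ι → ℤ) (x : ι → ℝ) (m : ι → ℤ) : expVec n (x + intVec m) = expVec n x := by
  simp [expVec, torusMk_add]

lemma expVec_apply (n : ι → ℤ) (x : ι → ℝ) :
    expVec n x = Complex.exp (2 * Real.pi * Complex.I * ((∑ i, n i * x i : ℝ) : ℂ)) := by
  simp only [expVec, UnitAddTorus.mFourier, torusMk, ContinuousMap.comp_apply, ContinuousMap.coe_mk,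
    fourier_coe_apply]
  rw [← Complex.exp_sum]
  congr 1
  push_cast
  rw [Finset.mul_sum]
  refine Finset.sum_congr rfl fun i _ => ?_
  ring

/-- Poisson summation on `ℤ^ι`. -/
theorem poisson_pi {f : (ι → ℝ) → ℂ} (hf : Integrable f)
    (hcont : Continuous fun x => ∑' m : ι → ℤ, f (x + intVec m))
    (hF : Summable fun n : ι → ℤ => ∫ x, expVec (-n) x * f x) :
    ∑' m : ι → ℤ, f (intVec m) = ∑' n : ι → ℤ, ∫ x, expVec (-n) x * f x := by
  have hper : ∀ x y : ι → ℝ, torusMk x = torusMk y →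
      (⟨_, hcont⟩ : C(ι → ℝ, ℂ)) x = (⟨_, hcont⟩ : C(ι → ℝ, ℂ)) y := by
    intro x y h
    obtain ⟨m, rfl⟩ := torusMk_eq_iff h
    show ∑' k : ι → ℤ, f (x + intVec k) = ∑' k : ι → ℤ, f (x + intVec m + intVec k)
    rw [← (Equiv.addLeft m).tsum_eq]
    refine tsum_congr fun k => ?_
    congr 1
    funext i
    simp [intVec]
    ring
  let F : C(UnitAddTorus ι, ℂ) := isQuotientMap_torusMk.lift ⟨_, hcont⟩ hper
  have hFq : ∀ x, F (torusMk x) = ∑' m : ι → ℤ, f (x + intVec m) := fun x =>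
    congrFun (congrArg DFunLike.coe (isQuotientMap_torusMk.lift_comp ⟨_, hcont⟩ hper)) x
  have hcoef : ∀ n, UnitAddTorus.mFourierCoeff F n = ∫ x, expVec (-n) x * f x := by
    intro n
    have hinteg : Integrable fun x => expVec (-n) x * f x :=
      hf.bdd_mul (c := 1) (ContinuousMap.continuous _).aestronglyMeasurable
        (Filter.Eventually.of_forall fun x => (norm_expVec _ _).le)
    have hcube : {x : ι → ℝ | ∀ i, x i ∈ Set.Ioc ((0 : ι → ℝ) i) ((0 : ι → ℝ) i + 1)} =
        unitCube (0 : ι → ℤ) := by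
      simp [unitCube]
    rw [UnitAddTorus.mFourierCoeff_eq_integral F n 0, hcube]
    have h1 := hasSum_integral_of_summable_integral_norm
      (μ := volume.restrict (unitCube (0 : ι → ℤ)))
      (F := fun (m : ι → ℤ) x => expVec (-n) (x + intVec m) * f (x + intVec m))
      (fun m => ((measurePreserving_add_right volume (intVec m)).integrable_comp_of_integrable
        hinteg).integrableOn) (hasSum_setIntegral_unitCube hinteg.norm).summable
    rw [(hasSum_setIntegral_unitCube hinteg).unique h1]
    refine integral_congr_ae (Filter.Eventually.of_forall fun x => ?_)
    simp only [expVec_add]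
    rw [tsum_mul_left, ← hFq]
    rfl
  have h2 := UnitAddTorus.hasSum_mFourier_series_apply_of_summable (f := F)
    (by simpa only [← hcoef] using hF) (torusMk 0)
  have h3 := h2.tsum_eq
  rw [hFq] at h3
  simp only [zero_add] at h3
  rw [← h3]
  refine tsum_congr fun n => ?_
  rw [hcoef]
  have : UnitAddTorus.mFourier n (torusMk (0 : ι → ℝ)) = 1 := by
    have := expVec_apply n (0 : ι → ℝ)
    simpa [expVec] using this
  rw [this, smul_eq_mul, mul_one]

lemma summable_pi_prod {g : ℤ → ℝ} (hg : Summable g) (h0 : ∀ n, 0 ≤ g n) :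
    Summable fun m : ι → ℤ => ∏ i, g (m i) := by
  classical
  refine summable_of_sum_le (c := ∏ _i : ι, ∑' n, g n)
    (fun m => Finset.prod_nonneg fun i _ => h0 _) fun s => ?_
  let t : ι → Finset ℤ := fun i => s.image fun m => m i
  calc ∑ m ∈ s, ∏ i, g (m i) ≤ ∑ m ∈ Fintype.piFinset t, ∏ i, g (m i) := by
        refine Finset.sum_le_sum_of_subset_of_nonneg (fun m hm => ?_)
          fun m _ _ => Finset.prod_nonneg fun i _ => h0 _
        exact Fintype.mem_piFinset.2 fun i => Finset.mem_image_of_mem _ hm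
    _ = ∏ i, ∑ n ∈ t i, g n := (Finset.prod_univ_sum t fun _ n => g n).symm
    _ ≤ ∏ _i : ι, ∑' n, g n := Finset.prod_le_prod (fun i _ => Finset.sum_nonneg fun n _ => h0 n)
        fun i _ => hg.sum_le_tsum _ fun n _ => h0 n

lemma summable_exp_neg_mul_int_sq {c : ℝ} (hc : 0 < c) :
    Summable fun n : ℤ => Real.exp (-c * (n : ℝ) ^ 2) := by
  have hpi : (Real.pi : ℂ) ≠ 0 := by exact_mod_cast Real.pi_ne_zero
  have h := ((summable_jacobiTheta₂_term_iff 0 (Complex.I * (c / Real.pi : ℝ))).2 (by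
    simp only [Complex.mul_im, Complex.I_re, Complex.I_im, Complex.ofReal_re]
    have := Real.pi_pos
    simp
    positivity)).norm
  refine h.congr fun n => ?_
  have h1 : jacobiTheta₂_term n 0 (Complex.I * (c / Real.pi : ℝ)) =
      ((Real.exp (-c * (n : ℝ) ^ 2) : ℝ) : ℂ) := by
    rw [jacobiTheta₂_term]
    push_cast
    congr 1
    field_simp
    linear_combination (n : ℂ) ^ 2 * c * Complex.I_sq
  rw [h1, Complex.norm_real, Real.norm_eq_abs, abs_of_pos (Real.exp_pos _)]

open Matrix

/-- The value at `x` of the quadratic form with Gram matrix `Bᵀ B`. -/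
def sqForm (B : Matrix ι ι ℝ) (x : ι → ℝ) : ℝ := ∑ i, (B *ᵥ x) i ^ 2

lemma continuous_sqForm (B : Matrix ι ι ℝ) : Continuous (sqForm B) := by
  unfold sqForm Matrix.mulVec dotProduct
  fun_prop

lemma exists_le_sqForm [DecidableEq ι] {B : Matrix ι ι ℝ} (hB : B.det ≠ 0) :
    ∃ c > 0, ∀ x, c * ∑ i, x i ^ 2 ≤ sqForm B x := by
  set C : ℝ := ∑ i, ∑ j, (B⁻¹ i j) ^ 2 with hC
  have hC0 : 0 ≤ C := Finset.sum_nonneg fun i _ => Finset.sum_nonneg fun j _ => sq_nonneg _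
  refine ⟨1 / (C + 1), by positivity, fun x => ?_⟩
  have h0 : 0 ≤ sqForm B x := Finset.sum_nonneg fun i _ => sq_nonneg _
  have hx : B⁻¹ *ᵥ (B *ᵥ x) = x := by
    rw [Matrix.mulVec_mulVec, Matrix.nonsing_inv_mul _ (isUnit_iff_ne_zero.2 hB), Matrix.one_mulVec]
  have h1 : ∑ i, x i ^ 2 ≤ C * sqForm B x := by
    rw [hC, Finset.sum_mul]
    refine Finset.sum_le_sum fun i _ => ?_
    conv_lhs => rw [← hx]
    exact Finset.sum_mul_sq_le_sq_mul_sq _ _ _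
  rw [one_div, inv_mul_le_iff₀ (by positivity)]
  nlinarith

lemma exists_summable_bound_sqForm [DecidableEq ι] {B : Matrix ι ι ℝ} (hB : B.det ≠ 0) (R : ℝ) :
    ∃ u : (ι → ℤ) → ℝ, Summable u ∧ ∀ x : ι → ℝ, (∀ i, |x i| ≤ R) → ∀ m,
      Real.exp (-Real.pi * sqForm B (x + intVec m)) ≤ u m := by
  obtain ⟨c, hc, h⟩ := exists_le_sqForm hB
  have hp := Real.pi_pos
  refine ⟨fun m => ∏ i, (Real.exp (Real.pi * c * R ^ 2) *
    Real.exp (-(Real.pi * c / 2) * (m i : ℝ) ^ 2)),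
    summable_pi_prod (g := fun n : ℤ => Real.exp (Real.pi * c * R ^ 2) *
      Real.exp (-(Real.pi * c / 2) * (n : ℝ) ^ 2))
      ((summable_exp_neg_mul_int_sq (by positivity)).mul_left _) (fun n => by positivity), ?_⟩
  intro x hx m
  simp_rw [← Real.exp_add]
  rw [← Real.exp_sum]
  refine Real.exp_le_exp.2 ?_
  have h1 := h (x + intVec m)
  have h2 : ∀ i, (m i : ℝ) ^ 2 / 2 - R ^ 2 ≤ (x + intVec m) i ^ 2 := by
    intro i
    have h3 : (x i) ^ 2 ≤ R ^ 2 := sq_le_sq' (abs_le.1 (hx i)).1 (abs_le.1 (hx i)).2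
    simp only [Pi.add_apply, intVec]
    nlinarith [sq_nonneg (2 * x i + (m i : ℝ))]
  have h4 : ∑ i, ((m i : ℝ) ^ 2 / 2 - R ^ 2) ≤ ∑ i, (x + intVec m) i ^ 2 :=
    Finset.sum_le_sum fun i _ => h2 i
  have h5 : ∑ i, (Real.pi * c * R ^ 2 + -(Real.pi * c / 2) * (m i : ℝ) ^ 2) =
      -(Real.pi * c) * ∑ i, ((m i : ℝ) ^ 2 / 2 - R ^ 2) := by
    rw [Finset.mul_sum]
    exact Finset.sum_congr rfl fun i _ => by ring
  rw [h5]
  have h6 := mul_le_mul_of_nonneg_left h4 (mul_pos hp hc).le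
  have h7 := mul_le_mul_of_nonneg_left h1 hp.le
  nlinarith

lemma summable_exp_sqForm [DecidableEq ι] {B : Matrix ι ι ℝ} (hB : B.det ≠ 0) (x : ι → ℝ) :
    Summable fun m : ι → ℤ => Real.exp (-Real.pi * sqForm B (x + intVec m)) := by
  obtain ⟨u, hu, h⟩ := exists_summable_bound_sqForm hB (∑ i, |x i|)
  exact Summable.of_nonneg_of_le (fun m => (Real.exp_pos _).le)
    (h x fun i => Finset.single_le_sum (f := fun i => |x i|) (fun i _ => abs_nonneg _)
      (Finset.mem_univ i)) hu

lemma integral_expVec_mul_gaussian [DecidableEq ι] {B : Matrix ι ι ℝ} (hB : B.det ≠ 0)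
    (n : ι → ℤ) :
    (Integrable fun x => (Real.exp (-Real.pi * sqForm B x) : ℂ)) ∧
    ∫ x, expVec (-n) x * (Real.exp (-Real.pi * sqForm B x) : ℂ) =
      ((|B.det|⁻¹ * Real.exp (-Real.pi * sqForm (B⁻¹)ᵀ (intVec n)) : ℝ) : ℂ) := by
  have hp : (Real.pi : ℂ) ≠ 0 := by exact_mod_cast Real.pi_ne_zero
  set w : ι → ℝ := (B⁻¹)ᵀ *ᵥ intVec n with hw
  have hdet : LinearMap.det (Matrix.toLin' B) ≠ 0 := by rwa [LinearMap.det_toLin']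
  have key : ∀ x : ι → ℝ, ∑ i, (-n) i * x i = - ∑ i, w i * (Matrix.toLin' B x) i := by
    intro x
    have h1 : ∑ i, w i * (Matrix.toLin' B x) i = w ⬝ᵥ (B *ᵥ x) := rfl
    rw [h1, hw, Matrix.mulVec_transpose, ← Matrix.dotProduct_mulVec, Matrix.mulVec_mulVec,
      Matrix.nonsing_inv_mul _ (isUnit_iff_ne_zero.2 hB), Matrix.one_mulVec]
    simp [dotProduct, intVec]
  let g : (ι → ℝ) → ℂ := fun y => Complex.exp (-∑ i, (Real.pi : ℂ) * (y i : ℂ) ^ 2 +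
    ∑ i, (-2 * Real.pi * Complex.I * w i) * y i)
  let g0 : (ι → ℝ) → ℂ := fun y => Complex.exp (-∑ i, (Real.pi : ℂ) * (y i : ℂ) ^ 2 +
    ∑ i, (0 : ℂ) * y i)
  have hg0 : Integrable g0 := GaussianFourier.integrable_cexp_neg_sum_mul_add
    (fun i => by simpa using Real.pi_pos) _
  have hg0' : ∀ x, g0 (Matrix.toLin' B x) = (Real.exp (-Real.pi * sqForm B x) : ℂ) := by
    intro x
    simp only [g0, sqForm, zero_mul, Finset.sum_const_zero, add_zero]
    push_cast
    rw [Finset.mul_sum, ← Finset.sum_neg_distrib]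
    congr 1
    exact Finset.sum_congr rfl fun i _ => by simp
  have hg : ∀ x, g (Matrix.toLin' B x) = expVec (-n) x *
    (Real.exp (-Real.pi * sqForm B x) : ℂ) := by
    intro x
    rw [← hg0', expVec_apply]
    simp only [g, g0, zero_mul, Finset.sum_const_zero, add_zero]
    rw [Complex.exp_add, mul_comm]
    congr 2
    have := key x
    rw [show ((∑ i, ((-n) i : ℤ) * x i : ℝ)) = - ∑ i, w i * (Matrix.toLin' B x) i from this]
    push_cast
    rw [mul_neg, Finset.mul_sum, ← Finset.sum_neg_distrib]
    exact Finset.sum_congr rfl fun i _ => by ring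
  have hme : MeasurableEmbedding (Matrix.toLin' B) :=
    (LinearMap.equivOfDetNeZero _ hdet).toContinuousLinearEquiv.toHomeomorph.measurableEmbedding
  have hmap := Real.map_linearMap_volume_pi_eq_smul_volume_pi hdet
  rw [LinearMap.det_toLin'] at hmap
  have hpos : 0 < |B.det|⁻¹ := by positivity
  constructor
  · simp_rw [← hg0']
    have : Integrable g0 (Measure.map (Matrix.toLin' B) volume) := by
      rw [hmap]
      exact hg0.smul_measure ENNReal.ofReal_ne_top
    exact (hme.integrable_map_iff).1 this
  · simp_rw [← hg]
    rw [← hme.integral_map, hmap, integral_smul_measure]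
    have h1 := GaussianFourier.integral_cexp_neg_sum_mul_add (ι := ι) (b := fun _ => (Real.pi : ℂ))
      (fun i => by simpa using Real.pi_pos) (fun i => -2 * Real.pi * Complex.I * w i)
    have h2 : ∫ y, g y = (Real.exp (-Real.pi * sqForm (B⁻¹)ᵀ (intVec n)) : ℂ) := by
      simp only [g]
      rw [h1]
      simp only [div_self hp, Complex.one_cpow, one_mul]
      rw [← Complex.exp_sum]
      simp only [sqForm]
      push_cast
      rw [Finset.mul_sum]
      congr 1
      refine Finset.sum_congr rfl fun i _ => ?_
      rw [← hw]
      field_simp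
      rw [Complex.I_sq]; ring
    rw [h2, abs_inv, ENNReal.toReal_ofReal hpos.le]
    simp

/-- The theta inversion formula for the quadratic form with Gram matrix `Bᵀ B`. -/
theorem tsum_exp_sqForm [DecidableEq ι] {B : Matrix ι ι ℝ} (hB : B.det ≠ 0) :
    ∑' m : ι → ℤ, Real.exp (-Real.pi * sqForm B (intVec m)) =
      |B.det|⁻¹ * ∑' m : ι → ℤ, Real.exp (-Real.pi * sqForm (B⁻¹)ᵀ (intVec m)) := by
  have hB' : ((B⁻¹)ᵀ).det ≠ 0 := by
    rw [Matrix.det_transpose, Matrix.det_nonsing_inv, Ring.inverse_eq_inv]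
    exact inv_ne_zero hB
  have hsum' := summable_exp_sqForm hB' 0
  simp only [zero_add] at hsum'
  have hcont : Continuous fun x : ι → ℝ => ∑' m : ι → ℤ,
      (Real.exp (-Real.pi * sqForm B (x + intVec m)) : ℂ) := by
    rw [continuous_iff_continuousAt]
    intro x
    obtain ⟨u, hu, h⟩ := exists_summable_bound_sqForm hB (‖x‖ + 1)
    have h1 : ContinuousOn (fun x : ι → ℝ => ∑' m : ι → ℤ,
        (Real.exp (-Real.pi * sqForm B (x + intVec m)) : ℂ)) (Metric.ball x 1) := by
      refine continuousOn_tsum (u := u) (fun m => ?_) hu fun m y hy => ?_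
      · have := continuous_sqForm B
        exact (Complex.continuous_ofReal.comp (Real.continuous_exp.comp
          (continuous_const.mul (this.comp (continuous_id.add continuous_const))))).continuousOn
      · rw [Complex.norm_real, Real.norm_eq_abs, abs_of_pos (Real.exp_pos _)]
        refine h y (fun i => ?_) m
        have h2 : |y i| ≤ ‖y‖ := norm_le_pi_norm y i
        have h3 : ‖y - x‖ < 1 := by rwa [← dist_eq_norm]
        have h4 := norm_sub_norm_le y x
        linarith
    exact h1.continuousAt (Metric.ball_mem_nhds x one_pos)
  have hF : ∀ n : ι → ℤ, _ := fun n => (integral_expVec_mul_gaussian hB n).2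
  have h := poisson_pi (f := fun x => (Real.exp (-Real.pi * sqForm B x) : ℂ))
    (integral_expVec_mul_gaussian hB 0).1 hcont (by
      simp_rw [hF]
      exact_mod_cast hsum'.mul_left _)
  simp_rw [hF] at h
  rw [← tsum_mul_left]
  exact_mod_cast h

end Poisson

section Theta

open Matrix

variable {ι : Type*} [Fintype ι] [DecidableEq ι]

lemma exists_sqForm_of_posSemidef {A : Matrix ι ι ℝ} (hA : A.PosSemidef) :
    ∃ B : Matrix ι ι ℝ, A = Bᵀ * B ∧ ∀ x, sqForm B x = x ⬝ᵥ A *ᵥ x := by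
  obtain ⟨B, hB⟩ : ∃ B : Matrix ι ι ℝ, A = Bᵀ * B := by
    open MatrixOrder in
    obtain ⟨B, hB⟩ := CStarAlgebra.nonneg_iff_eq_star_mul_self.1 hA.nonneg
    exact ⟨B, by rw [hB, Matrix.star_eq_conjTranspose,
      Matrix.conjTranspose_eq_transpose_of_trivial]⟩
  refine ⟨B, hB, fun x => ?_⟩
  rw [hB, ← Matrix.mulVec_mulVec, Matrix.dotProduct_mulVec, Matrix.vecMul_transpose]
  simp [sqForm, dotProduct, sq]

/-- The theta inversion formula for a positive definite Gram matrix. -/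
theorem tsum_exp_quadForm {A : Matrix ι ι ℝ} (hA : A.PosSemidef) (hdet : A.det ≠ 0) :
    (Summable fun m : ι → ℤ => Real.exp (-Real.pi * (intVec m ⬝ᵥ A *ᵥ intVec m))) ∧
    ∑' m : ι → ℤ, Real.exp (-Real.pi * (intVec m ⬝ᵥ A *ᵥ intVec m)) =
      (Real.sqrt A.det)⁻¹ *
        ∑' m : ι → ℤ, Real.exp (-Real.pi * (intVec m ⬝ᵥ A⁻¹ *ᵥ intVec m)) := by
  obtain ⟨B, hB, hq⟩ := exists_sqForm_of_posSemidef hA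
  have hd : A.det = B.det ^ 2 := by rw [hB, Matrix.det_mul, Matrix.det_transpose, sq]
  have hB0 : B.det ≠ 0 := by
    rintro h; rw [hd, h] at hdet; simp at hdet
  have hinv : ∀ x, sqForm (B⁻¹)ᵀ x = x ⬝ᵥ A⁻¹ *ᵥ x := by
    intro x
    have h1 : A⁻¹ = B⁻¹ * (B⁻¹)ᵀ := by
      rw [hB, Matrix.mul_inv_rev, Matrix.transpose_nonsing_inv]
    rw [h1, ← Matrix.mulVec_mulVec, Matrix.dotProduct_mulVec, ← Matrix.mulVec_transpose]
    simp [sqForm, dotProduct, sq]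
  have h1 := tsum_exp_sqForm hB0
  have h2 := summable_exp_sqForm hB0 0
  simp only [zero_add] at h2
  simp_rw [hinv, hq] at h1
  simp_rw [hq] at h2
  rw [hd, Real.sqrt_sq_eq_abs]
  exact ⟨h2, h1⟩

variable {K : Type*} [Field K] [NumberField K]

/-- The quadratic form `x ↦ ∑ t_w |σ x|²` over all complex embeddings `σ`, `w` the place of `σ`. -/
noncomputable def placeForm (t : InfinitePlace K → ℝ) (x : K) : ℝ :=
  ∑ w : InfinitePlace K, w.mult * (t w * w x ^ 2)

lemma sum_algHom_eq_sum_place (g : InfinitePlace K → ℝ) :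
    ∑ σ : K →ₐ[ℚ] ℂ, g (InfinitePlace.mk σ.toRingHom) = ∑ w : InfinitePlace K, w.mult * g w := by
  classical
  have h : ∑ σ : K →ₐ[ℚ] ℂ, g (InfinitePlace.mk σ.toRingHom) =
      ∑ σ : K →+* ℂ, g (InfinitePlace.mk σ) :=
    (Equiv.sum_comp (RingHom.equivRatAlgHom K ℂ).symm fun σ : K →+* ℂ => g (InfinitePlace.mk σ))
  rw [h, ← Finset.univ.sum_fiberwise fun φ => InfinitePlace.mk φ]
  refine Finset.sum_congr rfl fun w _ => ?_
  rw [Finset.sum_congr rfl fun φ hφ => by rw [(Finset.mem_filter.1 hφ).2], Finset.sum_const,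
    InfinitePlace.card_filter_mk_eq, nsmul_eq_mul]

lemma prod_algHom_eq_prod_place (g : InfinitePlace K → ℝ) :
    ∏ σ : K →ₐ[ℚ] ℂ, g (InfinitePlace.mk σ.toRingHom) = ∏ w : InfinitePlace K, g w ^ w.mult := by
  classical
  have h : ∏ σ : K →ₐ[ℚ] ℂ, g (InfinitePlace.mk σ.toRingHom) =
      ∏ σ : K →+* ℂ, g (InfinitePlace.mk σ) :=
    (Equiv.prod_comp (RingHom.equivRatAlgHom K ℂ).symm fun σ : K →+* ℂ => g (InfinitePlace.mk σ))
  rw [h, ← Finset.univ.prod_fiberwise fun φ => InfinitePlace.mk φ]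
  refine Finset.prod_congr rfl fun w _ => ?_
  rw [Finset.prod_congr rfl fun φ hφ => by rw [(Finset.mem_filter.1 hφ).2], Finset.prod_const,
    InfinitePlace.card_filter_mk_eq]

/-- The Gram matrix of `placeForm t` with respect to `b`. -/
noncomputable def gramMatrix (t : InfinitePlace K → ℝ) (b : ι → K) : Matrix ι ι ℝ :=
  Matrix.of fun i j => ∑ σ : K →ₐ[ℚ] ℂ,
    t (InfinitePlace.mk σ.toRingHom) * (σ (b i) * starRingEnd ℂ (σ (b j))).re

lemma gramMatrix_map_ofReal (t : InfinitePlace K → ℝ) (b : ι → K) (e : ι ≃ (K →ₐ[ℚ] ℂ)) :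
    (gramMatrix t b).map ((↑) : ℝ → ℂ) =
      Algebra.embeddingsMatrixReindex ℚ ℂ b e *
        Matrix.diagonal (fun i => (t (InfinitePlace.mk (e i).toRingHom) : ℂ)) *
        (Algebra.embeddingsMatrixReindex ℚ ℂ b e)ᴴ := by
  ext i j
  set S : ℂ := ∑ σ : K →ₐ[ℚ] ℂ,
    (t (InfinitePlace.mk σ.toRingHom) : ℂ) * (σ (b i) * starRingEnd ℂ (σ (b j))) with hS
  have h1 : (Algebra.embeddingsMatrixReindex ℚ ℂ b e *
        Matrix.diagonal (fun i => (t (InfinitePlace.mk (e i).toRingHom) : ℂ)) *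
        (Algebra.embeddingsMatrixReindex ℚ ℂ b e)ᴴ) i j = S := by
    rw [Matrix.mul_apply, hS, ← Equiv.sum_comp e]
    refine Finset.sum_congr rfl fun k _ => ?_
    rw [Matrix.mul_diagonal]
    simp [Algebra.embeddingsMatrixReindex, Algebra.embeddingsMatrix]
    ring
  have h2 : starRingEnd ℂ S = S := by
    let c : (K →ₐ[ℚ] ℂ) ≃ (K →ₐ[ℚ] ℂ) := (RingHom.equivRatAlgHom K ℂ).symm.trans
      ((Equiv.ofBijective (ComplexEmbedding.conjugate (K := K)) 
        (star_involutive (R := K →+* ℂ)).bijective).trans (RingHom.equivRatAlgHom K ℂ))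
    rw [hS, map_sum]
    rw [← Equiv.sum_comp c]
    refine Finset.sum_congr rfl fun σ _ => ?_
    have hc : ∀ x, c σ x = starRingEnd ℂ (σ x) := fun x => rfl
    have hm : InfinitePlace.mk (c σ).toRingHom = InfinitePlace.mk σ.toRingHom := 
      InfinitePlace.mk_conjugate_eq σ.toRingHom
    rw [hm, hc, hc]
    simp
  rw [h1, ← Complex.conj_eq_iff_re.1 h2]
  simp [gramMatrix, hS]

lemma dotProduct_gramMatrix {ι : Type*} [Fintype ι] (t : InfinitePlace K → ℝ) (b : ι → K)
    (x : ι → ℝ) :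
    x ⬝ᵥ gramMatrix t b *ᵥ x = ∑ σ : K →ₐ[ℚ] ℂ,
      t (InfinitePlace.mk σ.toRingHom) * ‖∑ i, (x i : ℂ) * σ (b i)‖ ^ 2 := by
  have h : ∀ σ : K →ₐ[ℚ] ℂ, ‖∑ i, (x i : ℂ) * σ (b i)‖ ^ 2 =
      ∑ i, ∑ j, x i * ((σ (b i) * starRingEnd ℂ (σ (b j))).re * x j) := by
    intro σ
    rw [← Complex.ofReal_re (‖_‖ ^ 2), Complex.ofReal_pow, ← Complex.mul_conj', map_sum,
      Finset.sum_mul_sum, Complex.re_sum]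
    refine Finset.sum_congr rfl fun i _ => ?_
    rw [Complex.re_sum]
    refine Finset.sum_congr rfl fun j _ => ?_
    simp
    ring
  simp_rw [h, dotProduct, Matrix.mulVec, dotProduct, gramMatrix, Matrix.of_apply, Finset.mul_sum,
    Finset.sum_mul, Finset.mul_sum]
  rw [Finset.sum_congr rfl fun i _ => Finset.sum_comm, Finset.sum_comm]
  refine Finset.sum_congr rfl fun σ _ => Finset.sum_congr rfl fun i _ =>
    Finset.sum_congr rfl fun j _ => by ring

lemma dotProduct_gramMatrix_intVec (t : InfinitePlace K → ℝ) (b : ι → K) (m : ι → ℤ) :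
    intVec m ⬝ᵥ gramMatrix t b *ᵥ intVec m = placeForm t (∑ i, m i • b i) := by
  rw [dotProduct_gramMatrix, placeForm, ← sum_algHom_eq_sum_place]
  refine Finset.sum_congr rfl fun σ _ => ?_
  congr 2
  rw [InfinitePlace.apply]
  congr 1
  simp [intVec]

lemma posSemidef_gramMatrix {t : InfinitePlace K → ℝ} (ht : ∀ w, 0 < t w) (b : ι → K) :
    (gramMatrix t b).PosSemidef := by
  refine Matrix.PosSemidef.of_dotProduct_mulVec_nonneg ?_ fun x => ?_
  · ext i j
    simp only [gramMatrix, Matrix.conjTranspose_apply, Matrix.of_apply, star_trivial]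
    refine Finset.sum_congr rfl fun σ _ => ?_
    simp
    left; ring
  · rw [star_trivial, dotProduct_gramMatrix]
    exact Finset.sum_nonneg fun σ _ => mul_nonneg (ht _).le (sq_nonneg _)

lemma exists_equiv_algHom {ι : Type*} [Fintype ι] (b : Module.Basis ι ℚ K) :
    Nonempty (ι ≃ (K →ₐ[ℚ] ℂ)) := by
  refine ⟨Fintype.equivOfCardEq ?_⟩
  rw [← Module.finrank_eq_card_basis b, AlgHom.card]

variable (b : Module.Basis ι ℚ K) {t : InfinitePlace K → ℝ}

lemma det_gramMatrix : (gramMatrix t b).det =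
    |(Algebra.discr ℚ b : ℝ)| * ∏ w : InfinitePlace K, t w ^ w.mult := by
  obtain ⟨e⟩ := exists_equiv_algHom b
  have h1 : ((gramMatrix t b).det : ℂ) = ((gramMatrix t b).map ((↑) : ℝ → ℂ)).det :=
    RingHom.map_det Complex.ofRealHom _
  rw [gramMatrix_map_ofReal t b e, Matrix.det_mul, Matrix.det_mul, Matrix.det_diagonal,
    Matrix.det_conjTranspose] at h1
  have h2 := Algebra.discr_eq_det_embeddingsMatrixReindex_pow_two ℚ ℂ b e
  set D := (Algebra.embeddingsMatrixReindex ℚ ℂ (⇑b) e).det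
  have h3 : ((|(Algebra.discr ℚ b : ℝ)| : ℝ) : ℂ) = D * star D := by
    have h4 : |(Algebra.discr ℚ b : ℝ)| = ‖D‖ ^ 2 := by
      rw [← norm_pow, ← h2]
      simp
    rw [h4]
    push_cast
    exact (Complex.mul_conj' D).symm
  have h5 : (∏ i, (t (InfinitePlace.mk (e i).toRingHom) : ℂ)) =
      ((∏ w : InfinitePlace K, t w ^ w.mult : ℝ) : ℂ) := by
    rw [← prod_algHom_eq_prod_place, ← Equiv.prod_comp e]
    push_cast
    rfl
  rw [h5, mul_right_comm, ← h3] at h1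
  exact_mod_cast h1

lemma gramMatrix_inv (ht : ∀ w, 0 < t w) :
    (gramMatrix t b)⁻¹ = gramMatrix (fun w => (t w)⁻¹) b.traceDual := by
  obtain ⟨e⟩ := exists_equiv_algHom b
  refine Matrix.inv_eq_left_inv ?_
  have hinj : Function.Injective fun A : Matrix ι ι ℝ => A.map ((↑) : ℝ → ℂ) :=
    Matrix.map_injective Complex.ofReal_injective
  apply hinj
  show (_ * _ : Matrix ι ι ℝ).map (Complex.ofRealHom) = (1 : Matrix ι ι ℝ).map Complex.ofRealHom
  rw [Matrix.map_mul]
  have h1 := gramMatrix_map_ofReal t b e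
  have h2 := gramMatrix_map_ofReal (fun w => (t w)⁻¹) b.traceDual e
  have h0 : (Algebra.embeddingsMatrixReindex ℚ ℂ b e) *
      (Algebra.embeddingsMatrixReindex ℚ ℂ b.traceDual e)ᵀ = 1 := by
    ext i j
    rw [Matrix.mul_apply]
    have h3 := trace_eq_sum_embeddings (K := ℚ) (L := K) (E := ℂ) (x := b i * b.traceDual j)
    rw [Module.Basis.trace_mul_traceDual] at h3
    rw [← Equiv.sum_comp e] at h3
    simp only [map_mul] at h3
    simp only [Algebra.embeddingsMatrixReindex, Algebra.embeddingsMatrix, Matrix.transpose_apply,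
      Matrix.reindex_apply, Matrix.submatrix_apply, Matrix.of_apply]
    refine Eq.trans h3.symm ?_
    rw [Matrix.one_apply]
    split_ifs <;> simp
  set M := Algebra.embeddingsMatrixReindex ℚ ℂ b e
  set N := Algebra.embeddingsMatrixReindex ℚ ℂ b.traceDual e
  have h4 : (gramMatrix t b).map ((↑) : ℝ → ℂ) = (Mᴴ)ᵀ *
      Matrix.diagonal (fun i => (t (InfinitePlace.mk (e i).toRingHom) : ℂ)) * Mᵀ := by
    have h5 : (gramMatrix t b)ᵀ = gramMatrix t b := (posSemidef_gramMatrix ht b).1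
    rw [← h5, Matrix.transpose_map, h1, Matrix.transpose_mul, Matrix.transpose_mul,
      Matrix.diagonal_transpose, Matrix.mul_assoc]
  have h6 : Nᴴ * (Mᴴ)ᵀ = 1 := by
    have h7 : Nᵀ * M = 1 := mul_eq_one_comm.1 h0
    ext i j
    have h8 := congrArg (starRingEnd ℂ) (congrFun (congrFun h7 i) j)
    rw [Matrix.mul_apply, map_sum] at h8
    rw [Matrix.mul_apply]
    simp only [map_mul] at h8
    refine Eq.trans h8 ?_
    rw [Matrix.one_apply]
    split_ifs <;> simp
  have h9 : N * Mᵀ = 1 := by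
    have h8 := congrArg Matrix.transpose h0
    simpa [Matrix.transpose_mul] using h8
  have h10 : Matrix.diagonal (fun i => (((t (InfinitePlace.mk (e i).toRingHom))⁻¹ : ℝ) : ℂ)) *
      Matrix.diagonal (fun i => (t (InfinitePlace.mk (e i).toRingHom) : ℂ)) = 1 := by
    rw [Matrix.diagonal_mul_diagonal, ← Matrix.diagonal_one]
    congr 1
    funext i
    have := (ht (InfinitePlace.mk (e i).toRingHom)).ne'
    rw [← Complex.ofReal_mul, inv_mul_cancel₀ this, Complex.ofReal_one]
  change (gramMatrix (fun w => (t w)⁻¹) b.traceDual).map ((↑) : ℝ → ℂ) *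
    (gramMatrix t b).map ((↑) : ℝ → ℂ) = _
  rw [h2, h4]
  set T := Matrix.diagonal (fun i => (t (InfinitePlace.mk (e i).toRingHom) : ℂ))
  set T' := Matrix.diagonal (fun i => (((t (InfinitePlace.mk (e i).toRingHom))⁻¹ : ℝ) : ℂ))
  calc N * T' * Nᴴ * ((Mᴴ)ᵀ * T * Mᵀ) = N * (T' * (Nᴴ * (Mᴴ)ᵀ) * T) * Mᵀ := by
        simp only [Matrix.mul_assoc]
    _ = 1 := by rw [h6, Matrix.mul_one, h10, Matrix.mul_one, h9]
    _ = _ := by simp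

/-- The theta inversion formula for the lattice spanned by a basis of a number field. -/
theorem tsum_exp_placeForm (ht : ∀ w, 0 < t w) :
    (Summable fun m : ι → ℤ => Real.exp (-Real.pi * placeForm t (∑ i, m i • b i))) ∧
    ∑' m : ι → ℤ, Real.exp (-Real.pi * placeForm t (∑ i, m i • b i)) =
      (Real.sqrt (|(Algebra.discr ℚ b : ℝ)| * ∏ w : InfinitePlace K, t w ^ w.mult))⁻¹ *
        ∑' m : ι → ℤ, Real.exp (-Real.pi *
          placeForm (fun w => (t w)⁻¹) (∑ i, m i • b.traceDual i)) := by
  have hd : (gramMatrix t b).det ≠ 0 := by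
    rw [det_gramMatrix]
    refine mul_ne_zero ?_ (Finset.prod_ne_zero_iff.2 fun w _ => pow_ne_zero _ (ht w).ne')
    have := Algebra.discr_not_zero_of_basis ℚ b
    exact abs_ne_zero.2 (by exact_mod_cast this)
  have h := tsum_exp_quadForm (posSemidef_gramMatrix ht b) hd
  rw [gramMatrix_inv b ht, det_gramMatrix] at h
  simpa only [dotProduct_gramMatrix_intVec] using h

end Theta

section IdealTheta

open nonZeroDivisors

variable {K : Type*} [Field K] [NumberField K]

/-- The theta series of a fractional ideal. -/
noncomputable def idealTheta (I : (FractionalIdeal (𝓞 K)⁰ K)ˣ) (t : InfinitePlace K → ℝ) :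
    ENNReal :=
  ∑' x : {x : K // x ∈ (I : FractionalIdeal (𝓞 K)⁰ K)},
    ENNReal.ofReal (Real.exp (-Real.pi * placeForm t x))

variable (K) in
/-- The inverse different. -/
noncomputable def invDifferent : (FractionalIdeal (𝓞 K)⁰ K)ˣ :=
  Units.mk0 (FractionalIdeal.dual ℤ ℚ 1) (FractionalIdeal.dual_ne_zero ℤ ℚ one_ne_zero)

/-- The norm of a fractional ideal as a real number. -/
noncomputable def fracNorm (I : (FractionalIdeal (𝓞 K)⁰ K)ˣ) : ℝ :=
  ((FractionalIdeal.absNorm (I : FractionalIdeal (𝓞 K)⁰ K) : ℚ) : ℝ)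

lemma fracNorm_mul (I J : (FractionalIdeal (𝓞 K)⁰ K)ˣ) :
    fracNorm (I * J) = fracNorm I * fracNorm J := by
  simp [fracNorm]

lemma fracNorm_pos (I : (FractionalIdeal (𝓞 K)⁰ K)ˣ) : 0 < fracNorm I := by
  have h := FractionalIdeal.absNorm_nonneg (I : FractionalIdeal (𝓞 K)⁰ K)
  have h2 : FractionalIdeal.absNorm (I : FractionalIdeal (𝓞 K)⁰ K) ≠ 0 := by
    rw [Ne, FractionalIdeal.absNorm_eq_zero_iff]
    exact I.ne_zero
  rw [fracNorm]
  exact_mod_cast lt_of_le_of_ne h (Ne.symm h2)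

lemma fracNorm_inv (I : (FractionalIdeal (𝓞 K)⁰ K)ˣ) : fracNorm I⁻¹ = (fracNorm I)⁻¹ := by
  refine eq_inv_of_mul_eq_one_left ?_
  rw [← fracNorm_mul]
  simp [fracNorm]

lemma fracNorm_invDifferent : fracNorm (invDifferent K) = |(discr K : ℝ)|⁻¹ := by
  have h1 : (invDifferent K)⁻¹.1 = ((differentIdeal ℤ (𝓞 K) : Ideal (𝓞 K)) :
    FractionalIdeal (𝓞 K)⁰ K) := by
    rw [coeIdeal_differentIdeal ℤ ℚ K (𝓞 K)]
    simp [invDifferent]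
  have h2 : fracNorm (invDifferent K)⁻¹ = |(discr K : ℝ)| := by
    rw [fracNorm, h1, FractionalIdeal.coeIdeal_absNorm, absNorm_differentIdeal K (𝓞 K)]
    simp
  rw [← h2, ← fracNorm_inv, inv_inv]

lemma sum_span_eq {ι : Type*} [Fintype ι] (b : Module.Basis ι ℚ K) (F : K → ENNReal) (S : Set K)
    (hS : ∀ x, x ∈ Submodule.span ℤ (Set.range b) ↔ x ∈ S) :
    ∑' m : ι → ℤ, F (∑ i, m i • b i) = ∑' x : S, F x := by
  let b' := b.restrictScalars ℤ
  let e : (ι → ℤ) ≃ S := b'.equivFun.symm.toEquiv.trans (Equiv.subtypeEquivRight hS)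
  rw [← e.tsum_eq]
  refine tsum_congr fun m => ?_
  congr 1
  simp [e, b', Module.Basis.equivFun_symm_apply]

lemma abs_discr_basisOfFractionalIdeal (I : (FractionalIdeal (𝓞 K)⁰ K)ˣ) :
    |(Algebra.discr ℚ (basisOfFractionalIdeal K I) : ℝ)| =
      |(discr K : ℝ)| * fracNorm I ^ 2 := by
  classical
  have e : (Module.Free.ChooseBasisIndex ℤ (𝓞 K)) ≃ (Module.Free.ChooseBasisIndex ℤ I) := by
    refine Fintype.equivOfCardEq ?_
    rw [← Module.finrank_eq_card_basis (integralBasis K),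
      ← Module.finrank_eq_card_basis (basisOfFractionalIdeal K I)]
  have h := det_basisOfFractionalIdeal_eq_absNorm K I e
  have h1 := Algebra.discr_of_matrix_vecMul (A := ℚ) (integralBasis K)
    ((integralBasis K).toMatrix ((basisOfFractionalIdeal K I).reindex e.symm))
  rw [Module.Basis.toMatrix_map_vecMul, ← Module.Basis.det_apply] at h1
  have h2 : Algebra.discr ℚ ((basisOfFractionalIdeal K I).reindex e.symm) =
      Algebra.discr ℚ (basisOfFractionalIdeal K I) := by
    simpa using Algebra.discr_reindex ℚ (basisOfFractionalIdeal K I) e.symm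
  rw [← h2, h1]
  have h3 : ((discr K : ℤ) : ℚ) = Algebra.discr ℚ (integralBasis K) := by
    rw [coe_discr]
  rw [← h3, ← sq_abs, h, fracNorm]
  push_cast
  rw [abs_mul, mul_comm]
  simp

lemma ofReal_idealTheta (I : (FractionalIdeal (𝓞 K)⁰ K)ˣ) {t : InfinitePlace K → ℝ}
    (ht : ∀ w, 0 < t w) :
    idealTheta I t = ENNReal.ofReal (∑' m : (Module.Free.ChooseBasisIndex ℤ I) → ℤ,
      Real.exp (-Real.pi * placeForm t (∑ i, m i • basisOfFractionalIdeal K I i))) := by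
  classical
  rw [ENNReal.ofReal_tsum_of_nonneg (fun _ => (Real.exp_pos _).le)
    (tsum_exp_placeForm (basisOfFractionalIdeal K I) ht).1]
  rw [sum_span_eq (basisOfFractionalIdeal K I)
    (fun x => ENNReal.ofReal (Real.exp (-Real.pi * placeForm t x)))
    {x : K | x ∈ (I : FractionalIdeal (𝓞 K)⁰ K)}]
  · rfl
  · intro x
    exact mem_span_basisOfFractionalIdeal K

lemma idealTheta_ne_top (I : (FractionalIdeal (𝓞 K)⁰ K)ˣ) {t : InfinitePlace K → ℝ}
    (ht : ∀ w, 0 < t w) : idealTheta I t ≠ ⊤ := by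
  rw [ofReal_idealTheta I ht]
  exact ENNReal.ofReal_ne_top

/-- The theta inversion formula for fractional ideals. -/
theorem idealTheta_inversion (I : (FractionalIdeal (𝓞 K)⁰ K)ˣ) {t : InfinitePlace K → ℝ}
    (ht : ∀ w, 0 < t w) :
    idealTheta I t = ENNReal.ofReal
      (Real.sqrt (|(discr K : ℝ)| * fracNorm I ^ 2 * ∏ w : InfinitePlace K, t w ^ w.mult))⁻¹ *
        idealTheta (invDifferent K * I⁻¹) (fun w => (t w)⁻¹) := by
  classical
  set b := basisOfFractionalIdeal K I with hb
  have h := tsum_exp_placeForm b ht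
  have hm : ∀ x : K, x ∈ Submodule.span ℤ (Set.range b.traceDual) ↔
      x ∈ ((invDifferent K * I⁻¹ : (FractionalIdeal (𝓞 K)⁰ K)ˣ) : FractionalIdeal (𝓞 K)⁰ K) := by
    intro x
    have h1 : ((invDifferent K * I⁻¹ : (FractionalIdeal (𝓞 K)⁰ K)ˣ) : FractionalIdeal (𝓞 K)⁰ K) =
        FractionalIdeal.dual ℤ ℚ (I : FractionalIdeal (𝓞 K)⁰ K) := by
      rw [FractionalIdeal.dual_eq_mul_inv]
      simp [invDifferent]
    rw [h1, ← Submodule.traceDual_span_of_basis ℤ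
      ((I : FractionalIdeal (𝓞 K)⁰ K) : Submodule (𝓞 K) K) b]
    · rw [Submodule.restrictScalars_mem, ← FractionalIdeal.coe_dual ℤ ℚ I.ne_zero]
      rfl
    · ext y
      exact (mem_span_basisOfFractionalIdeal K).symm
  have h2 : ∑' m : (Module.Free.ChooseBasisIndex ℤ I) → ℤ,
      ENNReal.ofReal (Real.exp (-Real.pi * placeForm (fun w => (t w)⁻¹)
        (∑ i, m i • b.traceDual i))) = idealTheta (invDifferent K * I⁻¹) (fun w => (t w)⁻¹) :=
    sum_span_eq b.traceDual
      (fun x => ENNReal.ofReal (Real.exp (-Real.pi * placeForm (fun w => (t w)⁻¹) x)))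
      {x : K | x ∈ ((invDifferent K * I⁻¹ : (FractionalIdeal (𝓞 K)⁰ K)ˣ) :
        FractionalIdeal (𝓞 K)⁰ K)} hm
  have hs := (tsum_exp_placeForm b.traceDual (t := fun w => (t w)⁻¹)
    (fun w => inv_pos.2 (ht w))).1
  rw [ofReal_idealTheta I ht, h.2, ENNReal.ofReal_mul (by positivity),
    abs_discr_basisOfFractionalIdeal, ← h2, ENNReal.ofReal_tsum_of_nonneg _ hs]
  exact fun _ => (Real.exp_pos _).le

end IdealTheta

section LogSpace

open nonZeroDivisors NumberField.Units NumberField.Units.dirichletUnitTheorem MeasureTheory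
open scoped Classical

variable {K : Type*} [Field K] [NumberField K]

variable (K) in
/-- The linear isomorphism of `logSpace K` with the hyperplane `∑ n_w h_w = 0`. -/
noncomputable def hvec : logSpace K →ₗ[ℝ] (InfinitePlace K → ℝ) where
  toFun y w := if h : w = w₀ then -2 * (∑ v, y v) / w.mult else 2 * y ⟨w, h⟩ / w.mult
  map_add' y z := by
    ext w
    by_cases h : w = w₀
    · simp [h, Finset.sum_add_distrib]; ring
    · simp [h]; ring
  map_smul' c y := by
    ext w
    by_cases h : w = w₀
    · simp [h, ← Finset.mul_sum]; ring
    · simp [h]; ring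

lemma hvec_w₀ (y : logSpace K) : hvec K y w₀ = -2 * (∑ v, y v) / (w₀ : InfinitePlace K).mult := by
  simp [hvec]

lemma hvec_ne (y : logSpace K) (v : {w : InfinitePlace K // w ≠ w₀}) :
    hvec K y v = 2 * y v / v.1.mult := by
  simp [hvec, v.2]

lemma mult_ne_zero' {K : Type*} [Field K] (w : InfinitePlace K) : (w.mult : ℝ) ≠ 0 := by
  have := InfinitePlace.mult_pos (w := w)
  positivity

lemma sum_mult_hvec (y : logSpace K) : ∑ w : InfinitePlace K, w.mult * hvec K y w = 0 := by
  rw [Fintype.sum_eq_add_sum_subtype_ne _ w₀, hvec_w₀]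
  simp_rw [hvec_ne]
  have h1 : ∀ w : InfinitePlace K, ∀ a : ℝ, w.mult * (a / w.mult) = a := fun w a =>
    mul_div_cancel₀ _ (mult_ne_zero' w)
  simp_rw [h1]
  rw [← Finset.mul_sum]
  ring

lemma hvec_injective_of (g g' : InfinitePlace K → ℝ) (hg : ∑ w : InfinitePlace K, w.mult * g w = 0)
    (hg' : ∑ w : InfinitePlace K, w.mult * g' w = 0) (h : ∀ w, w ≠ w₀ → g w = g' w) : g = g' := by
  funext w
  by_cases hw : w = w₀
  · rw [Fintype.sum_eq_add_sum_subtype_ne _ w₀] at hg hg'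
    have h1 : ∑ v : {w : InfinitePlace K // w ≠ w₀}, (v.1.mult : ℝ) * g v =
        ∑ v : {w : InfinitePlace K // w ≠ w₀}, (v.1.mult : ℝ) * g' v :=
      Finset.sum_congr rfl fun v _ => by rw [h v v.2]
    rw [h1] at hg
    have h2 : ((w₀ : InfinitePlace K).mult : ℝ) * g w₀ = (w₀ : InfinitePlace K).mult * g' w₀ := by
      linarith
    rw [hw]
    exact mul_left_cancel₀ (mult_ne_zero' w₀) h2
  · exact h w hw

lemma exists_hvec_eq (g : InfinitePlace K → ℝ) (hg : ∑ w : InfinitePlace K, w.mult * g w = 0) :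
    ∃ y, hvec K y = g := by
  refine ⟨fun v => v.1.mult * g v / 2, hvec_injective_of _ _ (sum_mult_hvec _) hg fun w hw => ?_⟩
  have := hvec_ne (fun v : {w : InfinitePlace K // w ≠ w₀} => v.1.mult * g v / 2) ⟨w, hw⟩
  rw [this]
  have := mult_ne_zero' w
  field_simp

lemma hvec_logEmbedding (u : (𝓞 K)ˣ) :
    hvec K (logEmbedding K (Additive.ofMul u)) = fun w => 2 * Real.log (w (u : K)) := by
  refine hvec_injective_of _ _ (sum_mult_hvec _) ?_ fun w hw => ?_
  · have := sum_mult_mul_log u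
    calc _ = 2 * ∑ w : InfinitePlace K, w.mult * Real.log (w (u : K)) := by
          rw [Finset.mul_sum]; exact Finset.sum_congr rfl fun w _ => by ring
      _ = 0 := by rw [this, mul_zero]
  · have := hvec_ne (logEmbedding K (Additive.ofMul u)) ⟨w, hw⟩
    rw [this, logEmbedding_component]
    have := mult_ne_zero' w
    field_simp

/-- The weights `τ e^{h_w(y)}`. -/
noncomputable def twist (τ : ℝ) (y : logSpace K) (w : InfinitePlace K) : ℝ :=
  τ * Real.exp (hvec K y w)

lemma twist_pos {τ : ℝ} (hτ : 0 < τ) (y : logSpace K) (w : InfinitePlace K) :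
    0 < twist τ y w := mul_pos hτ (Real.exp_pos _)

lemma twist_inv (τ : ℝ) (y : logSpace K) :
    (fun w => (twist τ y w)⁻¹) = twist τ⁻¹ (-y) := by
  funext w
  simp [twist, Real.exp_neg, mul_comm]

lemma prod_twist (τ : ℝ) (y : logSpace K) :
    ∏ w : InfinitePlace K, twist τ y w ^ w.mult = τ ^ Module.finrank ℚ K := by
  simp_rw [twist, mul_pow, Finset.prod_mul_distrib, ← Real.exp_nat_mul, ← Real.exp_sum,
    sum_mult_hvec, Real.exp_zero, mul_one, Finset.prod_pow_eq_pow_sum, InfinitePlace.sum_mult_eq]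

lemma placeForm_twist_unit (τ : ℝ) (y : logSpace K) (u : (𝓞 K)ˣ) (x : K) :
    placeForm (twist τ y) ((u : K) * x) =
      placeForm (twist τ (y + logEmbedding K (Additive.ofMul u))) x := by
  refine Finset.sum_congr rfl fun w _ => ?_
  have h : 0 < w (u : K) := pos_at_place u w
  simp only [twist, map_add, hvec_logEmbedding, Pi.add_apply, Real.exp_add, map_mul]
  rw [two_mul, Real.exp_add, Real.exp_log h]
  ring

/-- `∑ n_w e^{h_w(y)}`. -/
noncomputable def hsum (y : logSpace K) : ℝ :=
  ∑ w : InfinitePlace K, w.mult * Real.exp (hvec K y w)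

lemma one_le_hsum (y : logSpace K) : 1 ≤ hsum y := by
  have h1 : ∀ w : InfinitePlace K, (w.mult : ℝ) * (1 + hvec K y w) ≤
      w.mult * Real.exp (hvec K y w) := fun w => by
    gcongr
    rw [add_comm]; exact Real.add_one_le_exp _
  have h2 := Finset.sum_le_sum fun w (_ : w ∈ Finset.univ) => h1 w
  simp_rw [mul_add, mul_one, Finset.sum_add_distrib, sum_mult_hvec, add_zero] at h2
  rw [← Nat.cast_sum, InfinitePlace.sum_mult_eq] at h2
  refine le_trans ?_ h2
  exact_mod_cast Module.finrank_pos (R := ℚ) (M := K)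

/-- Diagonalizing: an element `x ≠ 0` acts by scaling and translation. -/
lemma exists_placeForm_twist (x : K) (hx : x ≠ 0) :
    ∃ y₀ : logSpace K, ∀ τ y, placeForm (twist τ y) x =
      τ * |(Algebra.norm ℚ x : ℝ)| ^ (2 / Module.finrank ℚ K : ℝ) * hsum (y + y₀) := by
  set n := Module.finrank ℚ K with hn
  have hn0 : (n : ℝ) ≠ 0 := by
    have := Module.finrank_pos (R := ℚ) (M := K)
    positivity
  set N := |(Algebra.norm ℚ x : ℝ)| with hN
  have hN0 : 0 < N := abs_pos.2 (by exact_mod_cast (Algebra.norm_ne_zero_iff.2 hx))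
  have hprod : ∏ w : InfinitePlace K, w x ^ w.mult = N := by
    rw [InfinitePlace.prod_eq_abs_norm, hN]; push_cast; rfl
  have hw : ∀ w : InfinitePlace K, 0 < w x := fun w => InfinitePlace.pos_iff.2 hx
  have hlog : ∑ w : InfinitePlace K, w.mult * Real.log (w x) = Real.log N := by
    rw [← hprod, Real.log_prod (fun w _ => pow_ne_zero _ (hw w).ne')]
    exact Finset.sum_congr rfl fun w _ => by rw [Real.log_pow]
  have hm : ∑ w : InfinitePlace K, (w.mult : ℝ) = n := by
    rw [← Nat.cast_sum, InfinitePlace.sum_mult_eq]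
  obtain ⟨y₀, hy₀⟩ := exists_hvec_eq (K := K)
    (fun w => 2 * Real.log (w x) - 2 / n * Real.log N) (by
      simp_rw [mul_sub, Finset.sum_sub_distrib, ← Finset.sum_mul, hm]
      have : ∑ w : InfinitePlace K, (w.mult : ℝ) * (2 * Real.log (w x)) = 2 * Real.log N := by
        rw [← hlog, Finset.mul_sum]; exact Finset.sum_congr rfl fun w _ => by ring
      rw [this]
      field_simp
      ring)
  refine ⟨y₀, fun τ y => ?_⟩
  rw [placeForm, hsum, Finset.mul_sum]
  refine Finset.sum_congr rfl fun w _ => ?_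
  have h1 : Real.exp (hvec K y₀ w) * N ^ (2 / n : ℝ) = w x ^ 2 := by
    rw [hy₀, Real.rpow_def_of_pos hN0, ← Real.exp_add]
    have : 2 * Real.log (w x) - 2 / n * Real.log N + Real.log N * (2 / n) =
      Real.log (w x) + Real.log (w x) := by ring
    rw [this, Real.exp_add, Real.exp_log (hw w), sq]
  rw [map_add, Pi.add_apply, Real.exp_add, twist, ← h1]
  ring

/-- The archimedean factor. -/
noncomputable def psiInf (K : Type*) [Field K] [NumberField K] (τ : ℝ) : ENNReal :=
  ∫⁻ y : logSpace K, ENNReal.ofReal (Real.exp (-Real.pi * (τ * hsum y)))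

lemma continuous_hvec : Continuous (hvec K) := LinearMap.continuous_of_finiteDimensional _

lemma continuous_hvec_apply (w : InfinitePlace K) : Continuous fun y => hvec K y w :=
  (continuous_apply w).comp continuous_hvec

lemma continuous_hsum : Continuous (hsum (K := K)) :=
  continuous_finsetSum _ fun w _ =>
    continuous_const.mul (Real.continuous_exp.comp (continuous_hvec_apply w))

lemma continuous_placeForm_twist (τ : ℝ) (x : K) :
    Continuous fun y : logSpace K => placeForm (twist τ y) x :=
  continuous_finsetSum _ fun w _ => continuous_const.mul
    ((continuous_const.mul (Real.continuous_exp.comp (continuous_hvec_apply w))).mul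
      continuous_const)

lemma measurable_exp_placeForm (τ : ℝ) (x : K) :
    Measurable fun y : logSpace K =>
      ENNReal.ofReal (Real.exp (-Real.pi * placeForm (twist τ y) x)) :=
  (ENNReal.continuous_ofReal.comp (Real.continuous_exp.comp
    (continuous_const.mul (continuous_placeForm_twist τ x)))).measurable

lemma tsum_units (G : logSpace K → ENNReal) :
    ∑' u : (𝓞 K)ˣ, G (logEmbedding K (Additive.ofMul u)) =
      (Nat.card (torsion K) : ENNReal) * ∑' l : unitLattice K, G l := by
  have hmem : ∀ u : (𝓞 K)ˣ, logEmbedding K (Additive.ofMul u) ∈ unitLattice K := fun u =>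
    ⟨Additive.ofMul u, trivial, rfl⟩
  let φ : (𝓞 K)ˣ → unitLattice K := fun u => ⟨_, hmem u⟩
  rw [← (Equiv.sigmaFiberEquiv φ).tsum_eq, ENNReal.tsum_sigma', ← ENNReal.tsum_mul_left]
  refine tsum_congr fun l => ?_
  have h1 : ∀ u : {u // φ u = l}, G (logEmbedding K (Additive.ofMul
      ((Equiv.sigmaFiberEquiv φ) ⟨l, u⟩))) = G l := fun u => by
    have := u.2
    conv_rhs => rw [← this]
    rfl
  rw [tsum_congr h1, ENNReal.tsum_const]
  congr 1
  obtain ⟨u₀, -, hu₀⟩ := l.2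
  have e : {u // φ u = l} ≃ torsion K :=
    { toFun := fun u => ⟨u.1 * (Additive.toMul u₀)⁻¹, by
        rw [← logEmbedding_eq_zero_iff, ofMul_mul, map_add, ofMul_inv, map_neg]
        have h2 : logEmbedding K (Additive.ofMul u.1) = l := congrArg Subtype.val u.2
        rw [h2, ← hu₀]
        exact add_neg_cancel _⟩
      invFun := fun t => ⟨t.1 * Additive.toMul u₀, by
        refine Subtype.ext ?_
        change logEmbedding K (Additive.ofMul (t.1 * Additive.toMul u₀)) = l
        rw [ofMul_mul, map_add, logEmbedding_eq_zero_iff.2 t.2, zero_add, ← hu₀]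
        rfl⟩
      left_inv := fun u => by simp
      right_inv := fun t => by simp }
  have hfin : Finite (torsion K) := inferInstance
  rw [ENat.card_congr e, ENat.card_eq_coe_natCard]
  simp

instance : VAddInvariantMeasure (unitLattice K) (logSpace K) volume :=
  inferInstanceAs (VAddInvariantMeasure (unitLattice K).toAddSubgroup (logSpace K) volume)

/-- Unfolding the sum over units. -/
lemma lintegral_tsum_units {F : Set (logSpace K)}
    (hF : IsAddFundamentalDomain (unitLattice K) F volume) (τ : ℝ) {x : K} (hx : x ≠ 0) :
    ∫⁻ y in F, ∑' u : (𝓞 K)ˣ,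
        ENNReal.ofReal (Real.exp (-Real.pi * placeForm (twist τ y) ((u : K) * x))) =
      (Nat.card (torsion K) : ENNReal) *
        psiInf K (τ * |(Algebra.norm ℚ x : ℝ)| ^ (2 / Module.finrank ℚ K : ℝ)) := by
  obtain ⟨y₀, hy₀⟩ := exists_placeForm_twist x hx
  have hm := measurable_exp_placeForm τ x
  set G : logSpace K → ENNReal := fun y =>
    ENNReal.ofReal (Real.exp (-Real.pi * placeForm (twist τ y) x)) with hG
  have h1 : ∀ y : logSpace K, ∑' u : (𝓞 K)ˣ,
      ENNReal.ofReal (Real.exp (-Real.pi * placeForm (twist τ y) ((u : K) * x))) =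
      (Nat.card (torsion K) : ENNReal) * ∑' l : unitLattice K, G (l +ᵥ y) := fun y => by
    have := tsum_units (fun z => G (y + z))
    simp_rw [placeForm_twist_unit]
    refine this.trans ?_
    congr 1
    refine tsum_congr fun l => ?_
    rw [add_comm]; rfl
  simp_rw [h1]
  have hm' : ∀ l : unitLattice K, Measurable fun y => G (l +ᵥ y) := fun l =>
    hm.comp (measurable_const_add (l : logSpace K))
  rw [lintegral_const_mul _ (Measurable.tsum hm'), lintegral_tsum fun l =>
    (hm' l).aemeasurable, ← hF.lintegral_eq_tsum'']
  congr 1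
  rw [psiInf]
  simp_rw [hG, hy₀]
  exact lintegral_add_right_eq_self
    (μ := (volume : Measure (logSpace K))) (fun y => ENNReal.ofReal (Real.exp (-Real.pi *
    (τ * |(Algebra.norm ℚ x : ℝ)| ^ (2 / Module.finrank ℚ K : ℝ) * hsum y)))) y₀

end LogSpace

section IdealSums

open nonZeroDivisors NumberField.Units NumberField.Units.dirichletUnitTheorem MeasureTheory
open FractionalIdeal (spanSingleton)
open scoped Classical

variable {K : Type*} [Field K] [NumberField K]

lemma classGroup_mk_eq_one_iff {I : (FractionalIdeal (𝓞 K)⁰ K)ˣ} :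
    ClassGroup.mk K I = 1 ↔ ∃ x : K, spanSingleton (𝓞 K)⁰ x = I := by
  rw [← (ClassGroup.equiv K).injective.eq_iff, map_one, ClassGroup.equiv_mk,
    QuotientGroup.mk'_apply,
    QuotientGroup.eq_one_iff, mem_principal_ideals_iff]
  simp

/-- Nonzero integral ideals in a given ideal class. -/
abbrev IdealsIn (c : ClassGroup (𝓞 K)) := {J : (Ideal (𝓞 K))⁰ // ClassGroup.mk0 J = c}

lemma exists_generator {I : (FractionalIdeal (𝓞 K)⁰ K)ˣ} {J : (Ideal (𝓞 K))⁰}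
    (h : ClassGroup.mk0 J = (ClassGroup.mk K I)⁻¹) :
    ∃ x : K, spanSingleton (𝓞 K)⁰ x =
      ((I * FractionalIdeal.mk0 K J : (FractionalIdeal (𝓞 K)⁰ K)ˣ) : FractionalIdeal (𝓞 K)⁰ K) := by
  rw [← classGroup_mk_eq_one_iff, map_mul, ClassGroup.mk_mk0, h, mul_inv_cancel]

variable (I : (FractionalIdeal (𝓞 K)⁰ K)ˣ)

/-- A generator of the principal fractional ideal `I * J`. -/
noncomputable def gen (J : IdealsIn (ClassGroup.mk K I)⁻¹) : K := (exists_generator J.2).choose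

lemma span_gen (J : IdealsIn (ClassGroup.mk K I)⁻¹) : spanSingleton (𝓞 K)⁰ (gen I J) =
    ((I * FractionalIdeal.mk0 K J.1 : (FractionalIdeal (𝓞 K)⁰ K)ˣ) : FractionalIdeal (𝓞 K)⁰ K) :=
  (exists_generator J.2).choose_spec

lemma gen_ne_zero (J : IdealsIn (ClassGroup.mk K I)⁻¹) : gen I J ≠ 0 := by
  intro h
  have := span_gen I J
  rw [h, FractionalIdeal.spanSingleton_zero] at this
  exact (Units.ne_zero _) this.symm

lemma abs_norm_gen (J : IdealsIn (ClassGroup.mk K I)⁻¹) :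
    |(Algebra.norm ℚ (gen I J) : ℝ)| = fracNorm I * Ideal.absNorm (J.1 : Ideal (𝓞 K)) := by
  have h := congrArg (fun A => ((FractionalIdeal.absNorm A : ℚ) : ℝ)) (span_gen I J)
  simp only [FractionalIdeal.absNorm_span_singleton] at h
  have h2 := fracNorm_mul I (FractionalIdeal.mk0 K J.1)
  rw [fracNorm] at h2
  rw [h2] at h
  have h3 : fracNorm (FractionalIdeal.mk0 K J.1) = Ideal.absNorm (J.1 : Ideal (𝓞 K)) := by
    rw [fracNorm, FractionalIdeal.coe_mk0, FractionalIdeal.coeIdeal_absNorm]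
    simp
  rw [h3] at h
  rw [← h]
  push_cast
  rfl

lemma unit_mul_gen_mem (J : IdealsIn (ClassGroup.mk K I)⁻¹) (u : (𝓞 K)ˣ) :
    (u : K) * gen I J ∈ (I : FractionalIdeal (𝓞 K)⁰ K) := by
  have h1 : gen I J ∈ (I : FractionalIdeal (𝓞 K)⁰ K) := by
    have h2 : gen I J ∈ spanSingleton (𝓞 K)⁰ (gen I J) := FractionalIdeal.mem_spanSingleton_self _ _
    rw [span_gen, Units.val_mul] at h2
    have h3 : (I : FractionalIdeal (𝓞 K)⁰ K) *
      (FractionalIdeal.mk0 K J.1 : (FractionalIdeal (𝓞 K)⁰ K)ˣ)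
        ≤ I * 1 := by
      gcongr
      exact FractionalIdeal.coeIdeal_le_one
    rw [mul_one] at h3
    exact h3 h2
  have := (I : FractionalIdeal (𝓞 K)⁰ K).val.smul_mem (u : 𝓞 K) h1
  rwa [Algebra.smul_def] at this

lemma spanSingleton_unit_mul (u : (𝓞 K)ˣ) (x : K) :
    spanSingleton (𝓞 K)⁰ ((u : K) * x) = spanSingleton (𝓞 K)⁰ x := by
  refine (FractionalIdeal.spanSingleton_eq_spanSingleton.2 ⟨u, ?_⟩).symm
  rw [Units.smul_def, Algebra.smul_def]

/-- Nonzero elements of `I` are pairs of an ideal in the inverse class and a unit. -/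
noncomputable def elementsEquiv : (Σ _ : IdealsIn (ClassGroup.mk K I)⁻¹, (𝓞 K)ˣ) ≃
    {x : {x : K // x ∈ (I : FractionalIdeal (𝓞 K)⁰ K)} // x.1 ≠ 0} := by
  refine Equiv.ofBijective (fun p => ⟨⟨(p.2 : K) * gen I p.1, unit_mul_gen_mem I p.1 p.2⟩,
    mul_ne_zero (Units.coe_ne_zero p.2) (gen_ne_zero I p.1)⟩) ⟨?_, ?_⟩
  · rintro ⟨J, u⟩ ⟨J', u'⟩ h
    have h1 : (u : K) * gen I J = u' * gen I J' := congrArg (fun z => z.1.1) h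
    have h2 := congrArg (spanSingleton (𝓞 K)⁰) h1
    rw [spanSingleton_unit_mul, spanSingleton_unit_mul, span_gen, span_gen] at h2
    have h3 := mul_left_cancel (Units.ext h2)
    have h4 : J = J' := by
      refine Subtype.ext (Subtype.ext ?_)
      have := congrArg Units.val h3
      rw [FractionalIdeal.coe_mk0, FractionalIdeal.coe_mk0] at this
      exact FractionalIdeal.coeIdeal_injective this
    subst h4
    have h5 := mul_right_cancel₀ (gen_ne_zero I J) h1
    have h6 : u = u' := Units.ext (RingOfIntegers.ext h5)
    rw [h6]
  · rintro ⟨⟨x, hx⟩, hx0⟩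
    simp only at hx0
    have h1 : spanSingleton (𝓞 K)⁰ x * (I⁻¹ : (FractionalIdeal (𝓞 K)⁰ K)ˣ) ≤ 1 := by
      have h2 : spanSingleton (𝓞 K)⁰ x ≤ I := by
        rwa [FractionalIdeal.spanSingleton_le_iff_mem]
      calc _ ≤ (I : FractionalIdeal (𝓞 K)⁰ K) * (I⁻¹ : (FractionalIdeal (𝓞 K)⁰ K)ˣ) := by gcongr
        _ = 1 := Units.mul_inv I
    obtain ⟨J, hJ⟩ := FractionalIdeal.le_one_iff_exists_coeIdeal.1 h1
    have hx1 : spanSingleton (𝓞 K)⁰ x ≠ 0 := FractionalIdeal.spanSingleton_ne_zero_iff.2 hx0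
    have hJ0 : J ≠ 0 := by
      rintro rfl
      have : spanSingleton (𝓞 K)⁰ x * (I⁻¹ : (FractionalIdeal (𝓞 K)⁰ K)ˣ) = 0 := by
        rw [← hJ]; simp
      exact (mul_ne_zero hx1 (Units.ne_zero _)) this
    have hxI : spanSingleton (𝓞 K)⁰ x = ((I * FractionalIdeal.mk0 K
        ⟨J, mem_nonZeroDivisors_of_ne_zero hJ0⟩ : (FractionalIdeal (𝓞 K)⁰ K)ˣ) :
          FractionalIdeal (𝓞 K)⁰ K) := by
      rw [Units.val_mul, FractionalIdeal.coe_mk0]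
      simp only
      rw [hJ, mul_comm, mul_assoc, Units.inv_mul, mul_one]
    have hcl : ClassGroup.mk0 (⟨J, mem_nonZeroDivisors_of_ne_zero hJ0⟩ : (Ideal (𝓞 K))⁰) =
        (ClassGroup.mk K I)⁻¹ := by
      have := classGroup_mk_eq_one_iff.2 ⟨x, hxI⟩
      rw [map_mul, ClassGroup.mk_mk0] at this
      exact eq_inv_of_mul_eq_one_right this
    have h3 := hxI.symm.trans (Eq.refl _)
    have h4 := span_gen I ⟨_, hcl⟩
    obtain ⟨u, hu⟩ := FractionalIdeal.spanSingleton_eq_spanSingleton.1 (h4.trans h3)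
    refine ⟨⟨⟨_, hcl⟩, u⟩, Subtype.ext (Subtype.ext ?_)⟩
    rw [Units.smul_def, Algebra.smul_def] at hu
    exact hu

variable (K) in
lemma countable_numberField : Countable K :=
  (Module.finBasis ℚ K).equivFun.toEquiv.countable_iff.2 inferInstance

instance countable_units : Countable (𝓞 K)ˣ := by
  have := countable_numberField K
  exact Function.Injective.countable (f := fun u : (𝓞 K)ˣ => (u : K))
    (fun _ _ h => Units.ext (RingOfIntegers.ext h))

instance countable_ideals : Countable (Ideal (𝓞 K)) := by
  have := countable_numberField K
  have : Countable (𝓞 K) := Function.Injective.countable (f := fun u : 𝓞 K => (u : K))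
    (fun _ _ h => RingOfIntegers.ext h)
  refine Function.Surjective.countable (f := fun s : Finset (𝓞 K) => Ideal.span (s : Set (𝓞 K)))
    fun J => ?_
  exact (isNoetherianRing_iff_ideal_fg _).1 inferInstance J

/-- The contribution of an ideal class. -/
noncomputable def classTheta (F : Set (logSpace K)) (c : ClassGroup (𝓞 K)) (τ : ℝ) : ENNReal :=
  volume F + Nat.card (torsion K) * ∑' J : IdealsIn c,
    psiInf K (τ * (Ideal.absNorm (J.1 : Ideal (𝓞 K)) : ℝ) ^ (2 / Module.finrank ℚ K : ℝ))

lemma lintegral_idealTheta {F : Set (logSpace K)}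
    (hF : IsAddFundamentalDomain (unitLattice K) F volume) (τ : ℝ) :
    ∫⁻ y in F, idealTheta I (twist τ y) = classTheta F (ClassGroup.mk K I)⁻¹
      (τ * fracNorm I ^ (2 / Module.finrank ℚ K : ℝ)) := by
  have h1 : ∀ y, idealTheta I (twist τ y) = 1 + ∑' J : IdealsIn (ClassGroup.mk K I)⁻¹,
      ∑' u : (𝓞 K)ˣ, ENNReal.ofReal (Real.exp (-Real.pi * placeForm (twist τ y)
        ((u : K) * gen I J))) := fun y => by
    set f : {x : K // x ∈ (I : FractionalIdeal (𝓞 K)⁰ K)} → ENNReal :=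
      fun x => ENNReal.ofReal (Real.exp (-Real.pi * placeForm (twist τ y) x)) with hf
    have h2 : ∑' x : {x : {x : K // x ∈ (I : FractionalIdeal (𝓞 K)⁰ K)} // x.1 ≠ 0}, f x =
        ∑' J : IdealsIn (ClassGroup.mk K I)⁻¹, ∑' u : (𝓞 K)ˣ, ENNReal.ofReal (Real.exp
          (-Real.pi * placeForm (twist τ y) ((u : K) * gen I J))) := by
      rw [← (elementsEquiv I).tsum_eq, ENNReal.tsum_sigma']
      rfl
    have h3 := tsum_subtype {x : {x : K // x ∈ (I : FractionalIdeal (𝓞 K)⁰ K)} | x.1 ≠ 0} f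
    rw [← h2]
    refine Eq.trans ?_ (congrArg (1 + ·) h3.symm)
    rw [idealTheta, ENNReal.tsum_eq_add_tsum_ite
      (⟨0, (I : FractionalIdeal (𝓞 K)⁰ K).zero_mem⟩ :
        {x : K // x ∈ (I : FractionalIdeal (𝓞 K)⁰ K)})]
    congr 1
    · simp [placeForm]
    · refine tsum_congr fun x => ?_
      by_cases hx : x.1 = 0
      · have : x = ⟨0, (I : FractionalIdeal (𝓞 K)⁰ K).zero_mem⟩ := Subtype.ext hx
        rw [if_pos this, Set.indicator_of_notMem]
        simpa using hx
      · rw [if_neg (fun h => hx (by rw [h])), Set.indicator_of_mem (by exact hx)]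
  simp_rw [h1]
  have hm : ∀ J : IdealsIn (ClassGroup.mk K I)⁻¹,
    Measurable fun y : logSpace K => ∑' u : (𝓞 K)ˣ, ENNReal.ofReal
      (Real.exp (-Real.pi * placeForm (twist τ y) ((u : K) * gen I J))) := fun J =>
    Measurable.tsum fun u => measurable_exp_placeForm τ _
  rw [lintegral_add_left measurable_const, lintegral_const, one_mul, Measure.restrict_apply_univ,
    lintegral_tsum fun J => (hm J).aemeasurable, classTheta, ← ENNReal.tsum_mul_left]
  congr 1
  refine tsum_congr fun J => ?_
  rw [lintegral_tsum_units hF τ (gen_ne_zero I J), abs_norm_gen,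
    Real.mul_rpow (fracNorm_pos I).le (Nat.cast_nonneg _), mul_assoc]

end IdealSums

section FunctionalEquation

open nonZeroDivisors NumberField.Units NumberField.Units.dirichletUnitTheorem MeasureTheory
open scoped Classical

variable {K : Type*} [Field K] [NumberField K]

variable (K) in
/-- A fundamental domain for the unit lattice. -/
noncomputable def unitDomain : Set (logSpace K) :=
  ZSpan.fundamentalDomain ((basisUnitLattice K).ofZLatticeBasis ℝ (unitLattice K))

lemma isAddFundamentalDomain_unitDomain :
    IsAddFundamentalDomain (unitLattice K) (unitDomain K) volume :=
  ZLattice.isAddFundamentalDomain (basisUnitLattice K) volume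

lemma measurableSet_unitDomain : MeasurableSet (unitDomain K) :=
  ZSpan.fundamentalDomain_measurableSet _

lemma isBounded_unitDomain : Bornology.IsBounded (unitDomain K) :=
  ZSpan.fundamentalDomain_isBounded _

lemma volume_unitDomain_ne_top : volume (unitDomain K) ≠ ⊤ :=
  isBounded_unitDomain.measure_lt_top.ne

lemma isAddFundamentalDomain_neg :
    IsAddFundamentalDomain (unitLattice K) (Neg.neg ⁻¹' unitDomain K) volume := by
  refine isAddFundamentalDomain_unitDomain.preimage_of_equiv
    (Measure.measurePreserving_neg volume).quasiMeasurePreserving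
    (e := Neg.neg) neg_involutive.bijective fun g x => ?_
  simp [Submodule.vadd_def, add_comm]

lemma classTheta_functional (I : (FractionalIdeal (𝓞 K)⁰ K)ˣ) {τ : ℝ} (hτ : 0 < τ) :
    classTheta (unitDomain K) (ClassGroup.mk K I)⁻¹
        (τ * fracNorm I ^ (2 / Module.finrank ℚ K : ℝ)) =
      ENNReal.ofReal (√(|(discr K : ℝ)| * fracNorm I ^ 2 * τ ^ Module.finrank ℚ K))⁻¹ *
      classTheta (unitDomain K) (ClassGroup.mk K (invDifferent K * I⁻¹))⁻¹
        (τ⁻¹ * fracNorm (invDifferent K * I⁻¹) ^ (2 / Module.finrank ℚ K : ℝ)) := by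
  rw [← lintegral_idealTheta I isAddFundamentalDomain_unitDomain]
  have h1 : ∀ y : logSpace K, idealTheta I (twist τ y) =
      ENNReal.ofReal (√(|(discr K : ℝ)| * fracNorm I ^ 2 * τ ^ Module.finrank ℚ K))⁻¹ *
        idealTheta (invDifferent K * I⁻¹) (twist τ⁻¹ (-y)) := fun y => by
    rw [idealTheta_inversion I (twist_pos hτ y), prod_twist, twist_inv]
  simp_rw [h1]
  rw [lintegral_const_mul' _ _ ENNReal.ofReal_ne_top]
  congr 1
  have h2 := (Measure.measurePreserving_neg (volume : Measure (logSpace K)))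
    |>.setLIntegral_comp_preimage_emb (MeasurableEquiv.neg _).measurableEmbedding
      (fun y => idealTheta (invDifferent K * I⁻¹) (twist τ⁻¹ y)) (Neg.neg ⁻¹' unitDomain K)
  have h3 : (Neg.neg ⁻¹' (Neg.neg ⁻¹' unitDomain K) : Set (logSpace K)) = unitDomain K := by
    ext y; simp
  rw [h3] at h2
  rw [h2, lintegral_idealTheta _ isAddFundamentalDomain_neg, classTheta, classTheta,
    isAddFundamentalDomain_neg.measure_eq isAddFundamentalDomain_unitDomain]

variable (K) in
/-- The normalised theta function of the number field. -/
noncomputable def heckeTheta (τ : ℝ) : ENNReal :=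
  ∑ c : ClassGroup (𝓞 K), classTheta (unitDomain K) c
    (|(discr K : ℝ)| ^ (-1 / Module.finrank ℚ K : ℝ) * τ)

lemma abs_discr_pos : 0 < |(discr K : ℝ)| := abs_pos.2 (by exact_mod_cast discr_ne_zero K)

lemma finrank_ne_zero_real : (Module.finrank ℚ K : ℝ) ≠ 0 := by
  have := Module.finrank_pos (R := ℚ) (M := K)
  positivity

lemma classTheta_functional' (c : ClassGroup (𝓞 K)) {τ : ℝ} (hτ : 0 < τ) :
    classTheta (unitDomain K) c (|(discr K : ℝ)| ^ (-1 / Module.finrank ℚ K : ℝ) * τ) =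
      ENNReal.ofReal (√(τ ^ Module.finrank ℚ K))⁻¹ *
      classTheta (unitDomain K) ((ClassGroup.mk K (invDifferent K))⁻¹ * c⁻¹)
        (|(discr K : ℝ)| ^ (-1 / Module.finrank ℚ K : ℝ) * τ⁻¹) := by
  obtain ⟨I, hI⟩ : ∃ I, c⁻¹ = ClassGroup.mk K I :=
    ClassGroup.induction K (P := fun c => ∃ I, c = ClassGroup.mk K I) (fun I => ⟨I, rfl⟩) c⁻¹
  obtain rfl : c = (ClassGroup.mk K I)⁻¹ := by rw [← hI, inv_inv]
  have hN := fracNorm_pos I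
  have hD := abs_discr_pos (K := K)
  have hn := finrank_ne_zero_real (K := K)
  set n := Module.finrank ℚ K with hn_def
  set D := |(discr K : ℝ)| with hD_def
  set N := fracNorm I with hN_def
  have hNn : 0 < N ^ (2 / n : ℝ) := by positivity
  have hDn : 0 < D ^ (-1 / n : ℝ) := by positivity
  have key := classTheta_functional I (τ := D ^ (-1 / n : ℝ) * τ / N ^ (2 / n : ℝ)) (by positivity)
  rw [← hn_def, ← hN_def, ← hD_def] at key
  rw [div_mul_cancel₀ _ hNn.ne'] at key
  have e1 : D * N ^ 2 * (D ^ (-1 / n : ℝ) * τ / N ^ (2 / n : ℝ)) ^ n = τ ^ n := by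
    have a1 : (D ^ (-1 / n : ℝ)) ^ n = D⁻¹ := by
      rw [← Real.rpow_natCast, ← Real.rpow_mul hD.le, div_mul_cancel₀ _ hn, Real.rpow_neg_one]
    have a2 : (N ^ (2 / n : ℝ)) ^ n = N ^ 2 := by
      rw [← Real.rpow_natCast, ← Real.rpow_mul hN.le, div_mul_cancel₀ _ hn]
      norm_num
    rw [div_pow, mul_pow, a1, a2]
    field_simp
  have e2 : (D ^ (-1 / n : ℝ) * τ / N ^ (2 / n : ℝ))⁻¹ *
      fracNorm (invDifferent K * I⁻¹) ^ (2 / n : ℝ) = D ^ (-1 / n : ℝ) * τ⁻¹ := by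
    rw [fracNorm_mul, fracNorm_invDifferent, fracNorm_inv, ← hD_def, ← hN_def,
      Real.mul_rpow (by positivity) (by positivity), Real.inv_rpow hD.le, Real.inv_rpow hN.le]
    have a3 : D ^ (2 / n : ℝ) * (D ^ (-1 / n : ℝ) * D ^ (-1 / n : ℝ)) = 1 := by
      rw [← Real.rpow_add hD, ← Real.rpow_add hD]
      rw [show (2 / n + (-1 / n + -1 / n) : ℝ) = 0 by ring, Real.rpow_zero]
    have hD2 : 0 < D ^ (2 / n : ℝ) := by positivity
    generalize D ^ (-1 / n : ℝ) = E at *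
    field_simp
    linear_combination -a3
  rw [e1, e2] at key
  rw [key]
  simp [mul_comm]

lemma heckeTheta_functional {τ : ℝ} (hτ : 0 < τ) :
    heckeTheta K τ = ENNReal.ofReal (√(τ ^ Module.finrank ℚ K))⁻¹ * heckeTheta K τ⁻¹ := by
  rw [heckeTheta, heckeTheta, Finset.mul_sum]
  simp_rw [classTheta_functional' _ hτ]
  refine Fintype.sum_bijective (fun c => (ClassGroup.mk K (invDifferent K))⁻¹ * c⁻¹)
    ((Equiv.inv (ClassGroup (𝓞 K))).trans
      (Equiv.mulLeft (ClassGroup.mk K (invDifferent K))⁻¹)).bijective _ _ fun c => rfl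

lemma heckeTheta_eq (τ : ℝ) : heckeTheta K τ =
    Nat.card (ClassGroup (𝓞 K)) * volume (unitDomain K) +
      Nat.card (torsion K) * ∑' J : (Ideal (𝓞 K))⁰,
        psiInf K (|(discr K : ℝ)| ^ (-1 / Module.finrank ℚ K : ℝ) * τ *
          (Ideal.absNorm (J : Ideal (𝓞 K)) : ℝ) ^ (2 / Module.finrank ℚ K : ℝ)) := by
  simp_rw [heckeTheta, classTheta, Finset.sum_add_distrib, ← Finset.mul_sum]
  congr 1
  · simp
  · rw [← (Equiv.sigmaFiberEquiv (ClassGroup.mk0 (R := 𝓞 K))).tsum_eq, ENNReal.tsum_sigma',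
      tsum_fintype]
    rfl

lemma measurable_exp_hsum (τ : ℝ) :
    Measurable fun y : logSpace K => ENNReal.ofReal (Real.exp (-Real.pi * (τ * hsum y))) :=
  (ENNReal.continuous_ofReal.comp (Real.continuous_exp.comp
    (continuous_const.mul (continuous_const.mul continuous_hsum)))).measurable

lemma psiInf_decay {a τ : ℝ} (ha : 0 ≤ a) (hτ : 1 ≤ τ) :
    psiInf K (a * τ) ≤ ENNReal.ofReal (Real.exp (-Real.pi * (a * (τ - 1)))) * psiInf K a := by
  rw [psiInf, psiInf, ← lintegral_const_mul _ (measurable_exp_hsum a)]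
  refine lintegral_mono fun y => ?_
  rw [← ENNReal.ofReal_mul (Real.exp_pos _).le, ← Real.exp_add]
  refine ENNReal.ofReal_le_ofReal (Real.exp_le_exp.2 ?_)
  have h1 := one_le_hsum y
  have h2 : 0 ≤ Real.pi * a * (τ - 1) * (hsum y - 1) := by
    have := Real.pi_pos
    have : 0 ≤ τ - 1 := by linarith
    have : 0 ≤ hsum y - 1 := by linarith
    positivity
  linarith

lemma psiInf_antitone : Antitone (psiInf K) := fun a b hab => by
  refine lintegral_mono fun y => ENNReal.ofReal_le_ofReal (Real.exp_le_exp.2 ?_)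
  have h1 := one_le_hsum y
  have h2 : 0 ≤ Real.pi * (b - a) * hsum y := by
    have := Real.pi_pos
    have : 0 ≤ b - a := by linarith
    positivity
  linarith

lemma heckeTheta_antitone : Antitone (heckeTheta K) := fun a b hab => by
  rw [heckeTheta_eq, heckeTheta_eq]
  gcongr with J
  exact psiInf_antitone (by gcongr)

lemma classTheta_ne_top (c : ClassGroup (𝓞 K)) {τ : ℝ} (hτ : 0 < τ) :
    classTheta (unitDomain K) c τ ≠ ⊤ := by
  obtain ⟨I, hI⟩ : ∃ I, c⁻¹ = ClassGroup.mk K I :=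
    ClassGroup.induction K (P := fun c => ∃ I, c = ClassGroup.mk K I) (fun I => ⟨I, rfl⟩) c⁻¹
  obtain rfl : c = (ClassGroup.mk K I)⁻¹ := by rw [← hI, inv_inv]
  have hN := fracNorm_pos I
  have hNn : 0 < fracNorm I ^ (2 / Module.finrank ℚ K : ℝ) := by positivity
  have h := lintegral_idealTheta I isAddFundamentalDomain_unitDomain
    (τ / fracNorm I ^ (2 / Module.finrank ℚ K : ℝ))
  rw [div_mul_cancel₀ _ hNn.ne'] at h
  rw [← h]
  set t := τ / fracNorm I ^ (2 / Module.finrank ℚ K : ℝ)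
  have ht : 0 < t := by positivity
  obtain ⟨R, hR⟩ : ∃ R : ℝ, ∀ y ∈ unitDomain K, ∀ w, -R ≤ hvec K y w := by
    have hb : Bornology.IsBounded (hvec K '' unitDomain K) :=
      (LinearMap.toContinuousLinearMap (hvec K)).lipschitz.isBounded_image isBounded_unitDomain
    obtain ⟨R, hR⟩ := isBounded_iff_forall_norm_le.1 hb
    refine ⟨R, fun y hy w => ?_⟩
    have := (norm_le_pi_norm (hvec K y) w).trans (hR _ ⟨y, hy, rfl⟩)
    exact (abs_le.1 this).1
  have hle : ∀ y ∈ unitDomain K, idealTheta I (twist t y) ≤ idealTheta I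
      (fun _ => t * Real.exp (-R)) := fun y hy => by
    refine ENNReal.tsum_le_tsum fun x => ENNReal.ofReal_le_ofReal (Real.exp_le_exp.2 ?_)
    have : placeForm (fun _ => t * Real.exp (-R)) (x : K) ≤ placeForm (twist t y) (x : K) := by
      refine Finset.sum_le_sum fun w _ => ?_
      have := Real.exp_le_exp.2 (hR y hy w)
      unfold twist
      beta_reduce
      gcongr
    have := Real.pi_pos
    nlinarith
  refine ne_top_of_le_ne_top ?_ (setLIntegral_mono' measurableSet_unitDomain hle)
  rw [setLIntegral_const]
  exact ENNReal.mul_ne_top (idealTheta_ne_top I fun _ => by positivity) volume_unitDomain_ne_top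

lemma heckeTheta_ne_top {τ : ℝ} (hτ : 0 < τ) : heckeTheta K τ ≠ ⊤ :=
  ENNReal.sum_ne_top.2 fun c _ => classTheta_ne_top c (mul_pos
    (Real.rpow_pos_of_pos abs_discr_pos _) hτ)

end FunctionalEquation

section HeckePair

open nonZeroDivisors NumberField.Units NumberField.Units.dirichletUnitTheorem MeasureTheory
open Set Filter Asymptotics
open scoped Classical

variable {K : Type*} [Field K] [NumberField K]

variable (K) in
/-- The sum over ideals in the theta function. -/
noncomputable def heckeSum (τ : ℝ) : ENNReal :=
  Nat.card (torsion K) * ∑' J : (Ideal (𝓞 K))⁰,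
    psiInf K (|(discr K : ℝ)| ^ (-1 / Module.finrank ℚ K : ℝ) * τ *
      (Ideal.absNorm (J : Ideal (𝓞 K)) : ℝ) ^ (2 / Module.finrank ℚ K : ℝ))

variable (K) in
/-- The constant term of the theta function. -/
noncomputable def heckeConst : ENNReal :=
  Nat.card (ClassGroup (𝓞 K)) * volume (unitDomain K)

lemma heckeTheta_eq_add (τ : ℝ) : heckeTheta K τ = heckeConst K + heckeSum K τ := heckeTheta_eq τ

lemma heckeConst_ne_top : heckeConst K ≠ ⊤ :=
  ENNReal.mul_ne_top (ENNReal.natCast_ne_top _) volume_unitDomain_ne_top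

lemma heckeSum_ne_top {τ : ℝ} (hτ : 0 < τ) : heckeSum K τ ≠ ⊤ :=
  ne_top_of_le_ne_top (heckeTheta_ne_top (K := K) hτ)
    (heckeTheta_eq_add (K := K) τ ▸ le_add_self)

lemma heckeTheta_toReal {τ : ℝ} (hτ : 0 < τ) :
    (heckeTheta K τ).toReal = (heckeConst K).toReal + (heckeSum K τ).toReal := by
  rw [heckeTheta_eq_add, ENNReal.toReal_add heckeConst_ne_top (heckeSum_ne_top hτ)]

lemma heckeSum_decay {τ : ℝ} (hτ : 1 ≤ τ) : heckeSum K τ ≤ ENNReal.ofReal (Real.exp (-Real.pi *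
    (|(discr K : ℝ)| ^ (-1 / Module.finrank ℚ K : ℝ) * (τ - 1)))) * heckeSum K 1 := by
  rw [heckeSum, heckeSum, mul_left_comm]
  refine mul_le_mul_right ?_ _
  rw [← ENNReal.tsum_mul_left]
  refine ENNReal.tsum_le_tsum fun J => ?_
  have hD := abs_discr_pos (K := K)
  set a := |(discr K : ℝ)| ^ (-1 / Module.finrank ℚ K : ℝ)
  have ha : 0 < a := Real.rpow_pos_of_pos hD _
  have hJ : (1 : ℝ) ≤ (Ideal.absNorm (J : Ideal (𝓞 K)) : ℝ) := by
    exact_mod_cast Nat.one_le_iff_ne_zero.2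
      (Ideal.absNorm_eq_zero_iff.not.2 (nonZeroDivisors.coe_ne_zero J))
  have hJ2 : 1 ≤ (Ideal.absNorm (J : Ideal (𝓞 K)) : ℝ) ^ (2 / Module.finrank ℚ K : ℝ) :=
    Real.one_le_rpow hJ (by positivity)
  set b := (Ideal.absNorm (J : Ideal (𝓞 K)) : ℝ) ^ (2 / Module.finrank ℚ K : ℝ)
  rw [mul_right_comm a τ b, mul_one]
  refine (psiInf_decay (by positivity) hτ).trans ?_
  gcongr ENNReal.ofReal (Real.exp ?_) * _
  have h1 : 0 ≤ Real.pi * (a * (b - 1) * (τ - 1)) :=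
    mul_nonneg Real.pi_pos.le (mul_nonneg (mul_nonneg ha.le (by linarith)) (by linarith))
  linarith

lemma heckeSum_toReal_isBigO (r : ℝ) :
    (fun τ => (((heckeTheta K τ).toReal : ℂ) - ((heckeConst K).toReal : ℂ)))
      =O[atTop] (fun τ : ℝ => τ ^ r) := by
  have ha : 0 < Real.pi * |(discr K : ℝ)| ^ (-1 / Module.finrank ℚ K : ℝ) :=
    mul_pos Real.pi_pos (Real.rpow_pos_of_pos abs_discr_pos _)
  set a := Real.pi * |(discr K : ℝ)| ^ (-1 / Module.finrank ℚ K : ℝ) with ha_def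
  refine IsBigO.trans ?_ (isLittleO_exp_neg_mul_rpow_atTop ha r).isBigO
  refine IsBigO.of_bound (Real.exp a * (heckeSum K 1).toReal) ?_
  filter_upwards [eventually_ge_atTop 1] with τ hτ
  rw [heckeTheta_toReal (by linarith), Complex.ofReal_add, add_sub_cancel_left, Complex.norm_real,
    Real.norm_of_nonneg ENNReal.toReal_nonneg, Real.norm_of_nonneg (Real.exp_pos _).le]
  have h := ENNReal.toReal_mono (ENNReal.mul_ne_top ENNReal.ofReal_ne_top
    (heckeSum_ne_top one_pos)) (heckeSum_decay (K := K) hτ)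
  rw [ENNReal.toReal_mul, ENNReal.toReal_ofReal (Real.exp_pos _).le] at h
  refine h.trans_eq ?_
  rw [mul_right_comm, ← Real.exp_add, ha_def]
  congr 2
  ring

lemma heckeTheta_locallyIntegrableOn :
    LocallyIntegrableOn (fun τ => ((heckeTheta K τ).toReal : ℂ)) (Ioi 0) := by
  rw [locallyIntegrableOn_iff isOpen_Ioi.isLocallyClosed]
  intro k hk hkc
  refine Integrable.ofReal ?_
  refine AntitoneOn.integrableOn_isCompact hkc fun x hx y _ hxy => ?_
  exact ENNReal.toReal_mono (heckeTheta_ne_top (hk hx)) (heckeTheta_antitone hxy)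

lemma heckeTheta_inv {x : ℝ} (hx : 0 < x) : (heckeTheta K (1 / x)).toReal =
    x ^ (Module.finrank ℚ K / 2 : ℝ) * (heckeTheta K x).toReal := by
  have h := congrArg ENNReal.toReal (heckeTheta_functional (K := K) hx)
  rw [ENNReal.toReal_mul, ENNReal.toReal_ofReal (by positivity)] at h
  have h2 : √(x ^ Module.finrank ℚ K) = x ^ (Module.finrank ℚ K / 2 : ℝ) := by
    rw [Real.sqrt_eq_rpow, ← Real.rpow_natCast, ← Real.rpow_mul hx.le]
    congr 1; ring
  have h3 : 0 < x ^ (Module.finrank ℚ K / 2 : ℝ) := by positivity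
  rw [h, h2, one_div]
  field_simp

variable (K) in
/-- The Hecke theta function as a Mellin pair. -/
noncomputable def heckePair : WeakFEPair ℂ where
  f τ := ((heckeTheta K τ).toReal : ℂ)
  g τ := ((heckeTheta K τ).toReal : ℂ)
  k := Module.finrank ℚ K / 2
  ε := 1
  f₀ := ((heckeConst K).toReal : ℂ)
  g₀ := ((heckeConst K).toReal : ℂ)
  hf_int := heckeTheta_locallyIntegrableOn
  hg_int := heckeTheta_locallyIntegrableOn
  hk := by
    have := Module.finrank_pos (R := ℚ) (M := K)
    positivity
  hε := one_ne_zero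
  h_feq x hx := by
    rw [heckeTheta_inv hx, one_mul, Complex.ofReal_mul, smul_eq_mul]
  hf_top := heckeSum_toReal_isBigO
  hg_top := heckeSum_toReal_isBigO

lemma heckePair_modif : ∃ φ : ℝ → ℝ, (∀ x, 0 < x → 0 ≤ φ x) ∧
    ∀ x, 0 < x → (heckePair K).f_modif x = φ x := by
  refine ⟨fun x => ((heckePair K).f_modif x).re, ?_⟩
  have h : ∀ x, 0 < x → ∃ y : ℝ, 0 ≤ y ∧ (heckePair K).f_modif x = y := fun x hx => by
    rcases lt_trichotomy x 1 with h | h | h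
    · refine ⟨x ^ (-(Module.finrank ℚ K / 2) : ℝ) * (heckeSum K (1 / x)).toReal, by positivity, ?_⟩
      have h1 := heckeTheta_inv (K := K) (x := 1 / x) (by positivity)
      rw [one_div_one_div, heckeTheta_toReal (τ := 1 / x) (by positivity), one_div,
        Real.inv_rpow hx.le, ← Real.rpow_neg hx.le] at h1
      simp [WeakFEPair.f_modif, heckePair, hx, h, h.le, h1]
      ring
    · exact ⟨0, le_rfl, by simp [WeakFEPair.f_modif, h]⟩
    · refine ⟨(heckeSum K x).toReal, by positivity, ?_⟩
      simp [WeakFEPair.f_modif, heckePair, h, h.le, heckeTheta_toReal hx]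
  refine ⟨fun x hx => ?_, fun x hx => ?_⟩ <;> obtain ⟨y, hy, hxy⟩ := h x hx
  · simpa [hxy] using hy
  · simp [hxy]

lemma heckePair_norm_le {σ : ℝ} {s : ℂ} (h1 : (heckePair K).k - σ ≤ s.re) (h2 : s.re ≤ σ) :
    ‖(heckePair K).Λ₀ s‖ ≤ 2 * ‖(heckePair K).Λ₀ σ‖ ∧ ∃ A : ℝ, 0 ≤ A ∧ (heckePair K).Λ₀ σ = A := by
  obtain ⟨φ, hφ, hf⟩ := heckePair_modif (K := K)
  have hconv : ∀ s : ℂ, MellinConvergent (heckePair K).f_modif s := fun s =>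
    ((heckePair K).isStrongFEPair_toStrongFEPair.hasMellin s).1
  have hre : ∀ u : ℝ, ∃ A : ℝ, A = ∫ x in Ioi (0 : ℝ), x ^ (u - 1) * φ x ∧ 0 ≤ A ∧
      (heckePair K).Λ₀ u = A ∧ IntegrableOn (fun x => x ^ (u - 1) * φ x) (Ioi (0 : ℝ)) :=
        fun u => by
    have e : ∀ x ∈ Ioi (0 : ℝ), (x : ℂ) ^ ((u : ℂ) - 1) • (heckePair K).f_modif x =
        ((x ^ (u - 1) * φ x : ℝ) : ℂ) := fun x hx => by
      rw [hf x hx, smul_eq_mul, Complex.ofReal_mul, Complex.ofReal_cpow (le_of_lt hx)]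
      simp
    refine ⟨_, rfl, setIntegral_nonneg measurableSet_Ioi fun x hx =>
      mul_nonneg (Real.rpow_nonneg (le_of_lt hx) _) (hφ x hx), ?_, ?_⟩
    · rw [← integral_complex_ofReal]
      exact setIntegral_congr_fun measurableSet_Ioi e
    · have := (hconv u).congr_fun e measurableSet_Ioi
      simpa using! this.re
  obtain ⟨A, hA, hA0, hA1, hA2⟩ := hre σ
  obtain ⟨B, hB, hB0, hB1, hB2⟩ := hre ((heckePair K).k - σ)
  have hfe : (heckePair K).Λ₀ ((heckePair K).k - σ) = (heckePair K).Λ₀ σ := by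
    rw [(heckePair K).functional_equation₀]
    have : (heckePair K).symm = heckePair K := by
      simp [WeakFEPair.symm, heckePair]
    rw [this]
    simp [heckePair]
  have hAB : A = B := by
    rw [Complex.ofReal_sub, hfe, hA1] at hB1
    exact_mod_cast hB1
  refine ⟨?_, A, hA0, hA1⟩
  rw [hA1, Complex.norm_real, Real.norm_of_nonneg hA0]
  calc ‖(heckePair K).Λ₀ s‖ ≤ ∫ x in Ioi (0 : ℝ), ‖(x : ℂ) ^ (s - 1) • (heckePair K).f_modif x‖ :=
        norm_integral_le_integral_norm _
    _ ≤ ∫ x in Ioi (0 : ℝ), (x ^ (σ - 1) * φ x + x ^ ((heckePair K).k - σ - 1) * φ x) := by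
        refine setIntegral_mono_on (hconv s).norm (hA2.add hB2) measurableSet_Ioi fun x hx => ?_
        have hx' : (0 : ℝ) < x := hx
        rw [norm_smul, hf x hx, Complex.norm_real, Real.norm_of_nonneg (hφ x hx), ← add_mul,
          Complex.norm_cpow_eq_rpow_re_of_pos hx]
        refine mul_le_mul_of_nonneg_right ?_ (hφ x hx)
        rcases le_total 1 x with h | h
        · refine le_add_of_le_of_nonneg (Real.rpow_le_rpow_of_exponent_le h ?_)
            (Real.rpow_nonneg hx'.le _)
          simpa using h2
        · refine le_add_of_nonneg_of_le (Real.rpow_nonneg hx'.le _)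
            (Real.rpow_le_rpow_of_exponent_ge hx h ?_)
          simpa using h1
    _ = 2 * A := by
        rw [integral_add hA2 hB2, ← hA, ← hB, ← hAB, two_mul]

lemma heckePair_bound {σ : ℝ} (hσ : (heckePair K).k < σ) :
    (∀ s : ℂ, (heckePair K).k - σ ≤ s.re → s.re ≤ σ →
      ‖(heckePair K).Λ₀ s‖ ≤ 2 * ‖(heckePair K).Λ σ‖) ∧
    (heckePair K).k * (heckeConst K).toReal ≤
      σ * (σ - (heckePair K).k) * ‖(heckePair K).Λ σ‖ := by
  have hk := (heckePair K).hk
  obtain ⟨A, hA, hA1⟩ := (heckePair_norm_le (K := K) (s := σ) (σ := σ) (by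
    simp; linarith) (by simp)).2
  have h := (heckePair K).Λ₀_eq σ
  rw [hA1] at h
  set k := (heckePair K).k
  set r := (heckeConst K).toReal
  have hr : 0 ≤ r := ENNReal.toReal_nonneg
  have h0 : 0 < σ := by linarith
  have h1 : 0 < σ - k := by linarith
  have h2 : (heckePair K).Λ σ = ((A + k * r / (σ * (σ - k)) : ℝ) : ℂ) := by
    have e1 : (1 / (σ : ℂ)) • (heckePair K).f₀ + ((heckePair K).ε / (k - σ)) • (heckePair K).g₀ =
        ((-(k * r / (σ * (σ - k))) : ℝ) : ℂ) := by
      have h1' : k - σ ≠ 0 := by linarith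
      simp only [heckePair, smul_eq_mul]
      rw [show (1 : ℂ) / σ * r + 1 / (k - σ) * r = ((1 / σ * r + 1 / (k - σ) * r : ℝ) : ℂ) by
        push_cast; rfl]
      congr 1
      have h3 := h1.ne'
      field_simp
      ring
    rw [add_assoc, e1] at h
    rw [Complex.ofReal_add, h, Complex.ofReal_neg]
    ring
  have h4 : ‖(heckePair K).Λ σ‖ = A + k * r / (σ * (σ - k)) := by
    rw [h2, Complex.norm_real, Real.norm_of_nonneg (by positivity)]
  refine ⟨fun s hs1 hs2 => ?_, ?_⟩
  · have := (heckePair_norm_le (K := K) hs1 hs2).1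
    rw [hA1, Complex.norm_real, Real.norm_of_nonneg hA] at this
    have h5 : 0 ≤ k * r / (σ * (σ - k)) := by positivity
    linarith
  · rw [h4, mul_add, mul_div_cancel₀ _ (by positivity)]
    have : 0 ≤ σ * (σ - k) * A := by positivity
    linarith

end HeckePair

section ZetaSum

open Filter Asymptotics Topology

variable {K : Type*} [Field K] [NumberField K]

lemma lseriesSummable_ideal_count {s : ℂ} (hs : 1 < s.re) : LSeriesSummable
    (fun n ↦ (Nat.card {I : Ideal (𝓞 K) // Ideal.absNorm I = n} : ℂ)) s := by
  have h := LSeriesSummable_of_sum_norm_bigO_and_nonneg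
    (f := fun n ↦ (Nat.card {I : Ideal (𝓞 K) // Ideal.absNorm I = n} : ℝ)) (r := 1) (s := s)
    ?_ (fun _ => Nat.cast_nonneg _) zero_le_one hs
  · exact_mod_cast h
  have h1 := ((Ideal.tendsto_norm_le_div_atTop₀ K).comp tendsto_natCast_atTop_atTop)
  have h2 : Tendsto (fun n : ℕ => (∑ k ∈ Finset.Icc 1 n,
      (Nat.card {I : Ideal (𝓞 K) // Ideal.absNorm I = k} : ℝ)) / (n : ℝ)) atTop
      (𝓝 (dedekindZeta_residue K)) := by
    refine h1.congr fun n ↦ ?_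
    simp only [Function.comp_apply, Nat.cast_le, ← Nat.cast_sum]
    congr
    rw [← add_left_inj 1, ← Ideal.card_norm_le_eq_card_norm_le_add_one,
      show Finset.Icc 1 n = Finset.Ioc 0 n from Finset.Icc_succ_left_eq_Ioc _ _,
      show 1 = Nat.card {I : Ideal (𝓞 K) // Ideal.absNorm I = 0} by
        simp [Ideal.absNorm_eq_zero_iff],
      Finset.sum_Ioc_add_eq_sum_Icc (n.zero_le),
      ← Finset.card_preimage_eq_sum_card_image_eq
        (fun k _ ↦ Ideal.finite_setOfPred_absNorm_eq k)]
    simp [Set.coe_eq_subtype]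
  simp_rw [Real.rpow_one]
  exact isBigO_of_div_tendsto_nhds (by
    filter_upwards [eventually_ne_atTop 0] with n hn h
    exact absurd h (by exact_mod_cast hn)) _ h2

lemma fintype_absNorm_fiber (n : ℕ) : Finite {I : Ideal (𝓞 K) // Ideal.absNorm I = n} :=
  Ideal.finite_setOfPred_absNorm_eq n

lemma summable_absNorm_rpow {s : ℝ} (hs : 1 < s) :
    Summable fun J : Ideal (𝓞 K) => (Ideal.absNorm J : ℝ) ^ (-s) := by
  rw [← (Equiv.sigmaFiberEquiv (Ideal.absNorm (S := 𝓞 K))).summable_iff]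
  have hfin : ∀ n : ℕ, Finite {I : Ideal (𝓞 K) // Ideal.absNorm I = n} := fintype_absNorm_fiber
  refine (summable_sigma_of_nonneg fun _ => by
    simp only [Function.comp_apply]; positivity).2 ⟨fun n => Summable.of_finite, ?_⟩
  have h := (lseriesSummable_ideal_count (K := K) (s := s) (by simpa using hs)).norm
  refine h.congr fun n => ?_
  have e : ∀ J : {I : Ideal (𝓞 K) // Ideal.absNorm I = n},
      ((fun J : Ideal (𝓞 K) => (Ideal.absNorm J : ℝ) ^ (-s)) ∘
        (Equiv.sigmaFiberEquiv (Ideal.absNorm (S := 𝓞 K)))) ⟨n, J⟩ = (n : ℝ) ^ (-s) := fun J => by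
    simp [Equiv.sigmaFiberEquiv, J.2]
  simp_rw [e, tsum_const, nsmul_eq_mul]
  rcases eq_or_ne n 0 with rfl | hn
  · simp [Real.zero_rpow (by linarith : -s ≠ 0)]
  · rw [LSeries.norm_term_eq, if_neg hn]
    simp [Real.rpow_neg, div_eq_mul_inv]

lemma summable_absNorm_cpow {s : ℂ} (hs : 1 < s.re) :
    Summable fun J : Ideal (𝓞 K) => (Ideal.absNorm J : ℂ) ^ (-s) := by
  refine Summable.of_norm_bounded (summable_absNorm_rpow hs) fun J => ?_
  rcases eq_or_ne (Ideal.absNorm J) 0 with h | h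
  · have : -s ≠ 0 := fun h => by
      rw [neg_eq_zero] at h; rw [h] at hs; simp at hs; linarith
    rw [h]
    simp [Complex.zero_cpow this, Real.zero_rpow (by linarith : -s.re ≠ 0)]
  · rw [Complex.norm_natCast_cpow_of_pos (Nat.pos_of_ne_zero h), Complex.neg_re]

lemma tsum_absNorm_cpow {s : ℂ} (hs : 1 < s.re) :
    ∑' J : Ideal (𝓞 K), (Ideal.absNorm J : ℂ) ^ (-s) = dedekindZeta K s := by
  have hfin : ∀ n : ℕ, Finite {I : Ideal (𝓞 K) // Ideal.absNorm I = n} := fintype_absNorm_fiber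
  have h := summable_absNorm_cpow (K := K) hs
  rw [← (Equiv.sigmaFiberEquiv (Ideal.absNorm (S := 𝓞 K))).summable_iff, Function.comp_def] at h
  rw [← (Equiv.sigmaFiberEquiv (Ideal.absNorm (S := 𝓞 K))).tsum_eq,
    h.tsum_sigma' fun n => Summable.of_finite, dedekindZeta, LSeries]
  refine tsum_congr fun n => ?_
  have e : ∀ J : {I : Ideal (𝓞 K) // Ideal.absNorm I = n},
      ((Ideal.absNorm (Equiv.sigmaFiberEquiv (Ideal.absNorm (S := 𝓞 K)) ⟨n, J⟩) : ℕ) : ℂ) ^ (-s) =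
        (n : ℂ) ^ (-s) := fun J => by
    simp [Equiv.sigmaFiberEquiv, J.2]
  simp_rw [e, tsum_const, nsmul_eq_mul]
  rcases eq_or_ne n 0 with rfl | hn
  · have : -s ≠ 0 := fun h => by
      rw [neg_eq_zero] at h; rw [h] at hs; simp at hs; linarith
    simp [Complex.zero_cpow this]
  · rw [LSeries.term_of_ne_zero hn, Complex.cpow_neg, div_eq_mul_inv]

lemma isDedekindZeta_iff {f : ℂ → ℂ} : isDedekindZeta K f ↔
    (∀ s : ℂ, s ≠ 1 → DifferentiableAt ℂ f s) ∧ ∀ s : ℂ, 1 < s.re → f s = dedekindZeta K s := by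
  refine and_congr_right fun _ => forall₂_congr fun s hs => ?_
  rw [← tsum_absNorm_cpow hs]
  rfl

end ZetaSum

section HeckeMellin

open nonZeroDivisors NumberField.Units NumberField.Units.dirichletUnitTheorem MeasureTheory
open Set Filter Asymptotics
open scoped Classical

lemma lintegral_Ioi_eq_lintegral_exp (f : ℝ → ENNReal) :
    ∫⁻ t in Ioi (0 : ℝ), f t = ∫⁻ u : ℝ, ENNReal.ofReal (Real.exp u) * f (Real.exp u) := by
  have h := lintegral_image_eq_lintegral_abs_deriv_mul (s := univ) MeasurableSet.univ
    (fun x _ => (Real.hasDerivAt_exp x).hasDerivWithinAt) Real.exp_injective.injOn f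
  rw [image_univ, Real.range_exp] at h
  simpa [abs_of_pos (Real.exp_pos _)] using h

lemma integral_exp_gamma {a r : ℝ} (ha : 0 < a) (hr : 0 < r) :
    Integrable (fun u : ℝ => Real.exp (a * u - r * Real.exp u)) ∧
    ∫ u : ℝ, Real.exp (a * u - r * Real.exp u) = (1 / r) ^ a * Real.Gamma a := by
  have h1 := Real.integral_rpow_mul_exp_neg_mul_Ioi ha hr
  have h2 := integral_image_eq_integral_abs_deriv_smul (s := univ) MeasurableSet.univ
    (fun x _ => (Real.hasDerivAt_exp x).hasDerivWithinAt) Real.exp_injective.injOn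
    (fun t : ℝ => t ^ (a - 1) * Real.exp (-(r * t)))
  rw [image_univ, Real.range_exp, h1] at h2
  have e : ∀ u : ℝ, |Real.exp u| • (Real.exp u ^ (a - 1) * Real.exp (-(r * Real.exp u))) =
      Real.exp (a * u - r * Real.exp u) := fun u => by
    rw [abs_of_pos (Real.exp_pos _), smul_eq_mul, ← Real.exp_mul, ← Real.exp_add, ← Real.exp_add]
    congr 1; ring
  simp_rw [e, Measure.restrict_univ] at h2
  refine ⟨?_, h2.symm⟩
  by_contra hn
  rw [integral_undef hn] at h2
  have : 0 < (1 / r) ^ a * Real.Gamma a := mul_pos (by positivity) (Real.Gamma_pos_of_pos ha)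
  exact this.ne' h2

variable {K : Type*} [Field K] [NumberField K]

variable (K) in
/-- Logarithmic polar coordinates at the infinite places. -/
noncomputable def logPolar : (ℝ × logSpace K) ≃L[ℝ] (InfinitePlace K → ℝ) :=
  (LinearEquiv.ofBijective
    (((LinearMap.pi fun _ => LinearMap.id) : ℝ →ₗ[ℝ] (InfinitePlace K → ℝ)).coprod (hvec K)) <| by
      have hs : ∑ w : InfinitePlace K, (w.mult : ℝ) ≠ 0 := by
        have : ∑ w : InfinitePlace K, w.mult = Module.finrank ℚ K := InfinitePlace.sum_mult_eq
        have h2 := Module.finrank_pos (R := ℚ) (M := K)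
        rw [← Nat.cast_sum, this]
        positivity
      constructor
      · rw [← LinearMap.ker_eq_bot, LinearMap.ker_eq_bot']
        rintro ⟨x, y⟩ h
        have h' : ∀ w, x + hvec K y w = 0 := fun w => by simpa using congrFun h w
        have h1 := sum_mult_hvec y
        have h2 : ∀ w, hvec K y w = -x := fun w => by linarith [h' w]
        simp_rw [h2] at h1
        rw [← Finset.sum_mul] at h1
        have hx : x = 0 := by simpa [hs] using h1
        subst hx
        have : y = 0 := by
          funext v
          have h3 := hvec_ne y v
          rw [h2] at h3
          have := mult_ne_zero' v.1
          field_simp at h3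
          simpa using h3.symm
        simp [this]
      · intro u
        set x := (∑ w : InfinitePlace K, w.mult * u w) / ∑ w : InfinitePlace K, (w.mult : ℝ)
        obtain ⟨y, hy⟩ := exists_hvec_eq (K := K) (fun w => u w - x) (by
          simp_rw [mul_sub]
          rw [Finset.sum_sub_distrib, ← Finset.sum_mul, mul_div_cancel₀ _ hs, sub_self])
        refine ⟨(x, y), ?_⟩
        funext w
        simp [hy]).toContinuousLinearEquiv

lemma logPolar_apply (x : ℝ) (y : logSpace K) (w : InfinitePlace K) :
    logPolar K (x, y) w = x + hvec K y w := by
  change (((LinearMap.pi fun _ => LinearMap.id) : ℝ →ₗ[ℝ] (InfinitePlace K → ℝ)).coprod (hvec K))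
    (x, y) w = _
  simp

lemma exists_map_logPolar : ∃ c : ℝ, 0 < c ∧
    (volume : Measure (ℝ × logSpace K)).map (logPolar K) = ENNReal.ofReal c • volume := by
  have h0 : (volume : Measure (ℝ × logSpace K)).IsAddHaarMeasure :=
    inferInstanceAs ((volume : Measure ℝ).prod (volume : Measure (logSpace K))).IsAddHaarMeasure
  have : ((volume : Measure (ℝ × logSpace K)).map (logPolar K)).IsAddHaarMeasure :=
    (logPolar K).isAddHaarMeasure_map _
  have h := Measure.isAddLeftInvariant_eq_smul
    ((volume : Measure (ℝ × logSpace K)).map (logPolar K)) volume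
  have hpos := Measure.addHaarScalarFactor_pos_of_isAddHaarMeasure
    ((volume : Measure (ℝ × logSpace K)).map (logPolar K)) volume
  refine ⟨_, NNReal.coe_pos.2 hpos, ?_⟩
  rw [ENNReal.ofReal_coe_nnreal]
  exact h

variable (K) in
/-- The gamma factor of the completed zeta function, as a function of `n s / 2`. -/
noncomputable def gammaInf (s : ℝ) : ℝ :=
  ∏ w : InfinitePlace K, ((1 / (Real.pi * w.mult)) ^ (w.mult * s / Module.finrank ℚ K) *
    Real.Gamma (w.mult * s / Module.finrank ℚ K))

lemma gammaInf_pos {s : ℝ} (hs : 0 < s) : 0 < gammaInf K s := by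
  have hn : (0 : ℝ) < Module.finrank ℚ K := by exact_mod_cast Module.finrank_pos (R := ℚ) (M := K)
  refine Finset.prod_pos fun w _ => ?_
  have hw : (0 : ℝ) < w.mult := by exact_mod_cast w.mult_pos
  exact mul_pos (Real.rpow_pos_of_pos (by positivity) _) (Real.Gamma_pos_of_pos (by positivity))

lemma exists_lintegral_psiInf : ∃ c : ℝ, 0 < c ∧ ∀ s : ℝ, 0 < s →
    ∫⁻ t in Ioi (0 : ℝ), ENNReal.ofReal (t ^ (s - 1)) * psiInf K t =
      ENNReal.ofReal (c * gammaInf K s) := by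
  obtain ⟨c, hc, hmap⟩ := exists_map_logPolar (K := K)
  refine ⟨c, hc, fun s hs => ?_⟩
  have hn : (0 : ℝ) < Module.finrank ℚ K := by exact_mod_cast Module.finrank_pos (R := ℚ) (M := K)
  set n : ℝ := ((Module.finrank ℚ K : ℕ) : ℝ) with hn_def
  have hmult : ∑ w : InfinitePlace K, (w.mult : ℝ) = n := by
    rw [← Nat.cast_sum, InfinitePlace.sum_mult_eq]
  set F : InfinitePlace K → ℝ → ℝ := fun w u =>
    Real.exp (w.mult * s / n * u - Real.pi * w.mult * Real.exp u)
  have hg : ∀ w : InfinitePlace K, Integrable (F w) ∧ ∫ u, F w u =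
      (1 / (Real.pi * w.mult)) ^ (w.mult * s / n) * Real.Gamma (w.mult * s / n) := fun w => by
    have hw : (0 : ℝ) < w.mult := by exact_mod_cast w.mult_pos
    exact integral_exp_gamma (by positivity) (by positivity)
  have hF : ∫⁻ u : InfinitePlace K → ℝ, ENNReal.ofReal (∏ w, F w (u w)) =
      ENNReal.ofReal (gammaInf K s) := by
    have hi : Integrable fun u : InfinitePlace K → ℝ => ∏ w, F w (u w) :=
      Integrable.fintype_prod fun w => (hg w).1
    rw [← ofReal_integral_eq_lintegral_ofReal hi
      (Filter.Eventually.of_forall fun u => Finset.prod_nonneg fun w _ => (Real.exp_pos _).le),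
      integral_fintype_prod_volume_eq_prod]
    simp_rw [(hg _).2]
    rfl
  have hFc : Measurable fun u : InfinitePlace K → ℝ => ENNReal.ofReal (∏ w, F w (u w)) := by
    fun_prop
  calc ∫⁻ t in Ioi (0 : ℝ), ENNReal.ofReal (t ^ (s - 1)) * psiInf K t
      = ∫⁻ x : ℝ, ∫⁻ y : logSpace K, ENNReal.ofReal (∏ w, F w (logPolar K (x, y) w)) := by
        rw [lintegral_Ioi_eq_lintegral_exp]
        refine lintegral_congr fun x => ?_
        rw [psiInf, ← mul_assoc, ← lintegral_const_mul]
        · refine lintegral_congr fun y => ?_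
          rw [← ENNReal.ofReal_mul (by positivity), ← ENNReal.ofReal_mul (by positivity),
            ← Real.exp_sum, ← Real.exp_mul, ← Real.exp_add, ← Real.exp_add]
          congr 2
          simp_rw [logPolar_apply]
          rw [Finset.sum_sub_distrib]
          have e1 : ∑ w : InfinitePlace K, w.mult * s / n * (x + hvec K y w) = s * x := by
            have : ∀ w : InfinitePlace K, (w.mult : ℝ) * s / n * (x + hvec K y w) =
                s / n * (w.mult * x) + s / n * (w.mult * hvec K y w) := fun w => by ring
            simp_rw [this]
            rw [Finset.sum_add_distrib, ← Finset.mul_sum, ← Finset.mul_sum, sum_mult_hvec,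
              ← Finset.sum_mul, hmult]
            field_simp
            ring
          have e2 : ∑ w : InfinitePlace K, Real.pi * w.mult * Real.exp (x + hvec K y w) =
              Real.pi * (Real.exp x * hsum y) := by
            rw [hsum, Finset.mul_sum, Finset.mul_sum]
            refine Finset.sum_congr rfl fun w _ => ?_
            rw [Real.exp_add]; ring
          rw [e1, e2]
          ring
        · exact measurable_exp_hsum _
    _ = ∫⁻ p : ℝ × logSpace K, ENNReal.ofReal (∏ w, F w (logPolar K p w)) := by
        rw [Measure.volume_eq_prod, lintegral_prod]
        exact (hFc.comp (logPolar K).continuous.measurable).aemeasurable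
    _ = ENNReal.ofReal (c * gammaInf K s) := by
        rw [← lintegral_map hFc (logPolar K).continuous.measurable, hmap, lintegral_smul_measure,
          hF, smul_eq_mul, ← ENNReal.ofReal_mul hc.le]

lemma lintegral_rpow_comp_mul {a : ℝ} (ha : 0 < a) (s : ℝ) (g : ℝ → ENNReal) :
    ∫⁻ t in Ioi (0 : ℝ), ENNReal.ofReal (t ^ (s - 1)) * g (a * t) =
      ENNReal.ofReal (a ^ (-s)) * ∫⁻ t in Ioi (0 : ℝ), ENNReal.ofReal (t ^ (s - 1)) * g t := by
  have e : ∀ h : ℝ → ENNReal, ∫⁻ t in Ioi (0 : ℝ), ENNReal.ofReal (t ^ (s - 1)) * h t =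
      ∫⁻ u : ℝ, ENNReal.ofReal (Real.exp (s * u)) * h (Real.exp u) := fun h => by
    rw [lintegral_Ioi_eq_lintegral_exp]
    refine lintegral_congr fun u => ?_
    rw [← mul_assoc, ← ENNReal.ofReal_mul (Real.exp_pos _).le, ← Real.exp_mul, ← Real.exp_add]
    congr 3; ring
  rw [e (fun t => g (a * t)), e g,
    ← lintegral_add_right_eq_self (μ := (volume : Measure ℝ))
      (fun u => ENNReal.ofReal (Real.exp (s * u)) * g (Real.exp u)) (Real.log a),
    ← lintegral_const_mul' _ _ ENNReal.ofReal_ne_top]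
  refine lintegral_congr fun u => ?_
  rw [← mul_assoc, ← ENNReal.ofReal_mul (by positivity), Real.exp_add u, Real.exp_log ha,
    mul_comm a, mul_add, Real.exp_add, Real.rpow_neg ha.le, mul_comm s (Real.log a),
    ← Real.rpow_def_of_pos ha]
  congr 2
  field_simp

variable (K) in
/-- The Dedekind zeta function at real arguments. -/
noncomputable def zetaReal (s : ℝ) : ℝ := ∑' J : Ideal (𝓞 K), (Ideal.absNorm J : ℝ) ^ (-s)

lemma dedekindZeta_ofReal {s : ℝ} (hs : 1 < s) : dedekindZeta K s = zetaReal K s := by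
  rw [← tsum_absNorm_cpow (by simpa using hs), zetaReal, Complex.ofReal_tsum]
  refine tsum_congr fun J => ?_
  rw [Complex.ofReal_cpow (by positivity)]
  simp

lemma one_le_zetaReal {s : ℝ} (hs : 1 < s) : 1 ≤ zetaReal K s := by
  have := (summable_absNorm_rpow (K := K) hs).le_tsum (⊤ : Ideal (𝓞 K))
    (fun J _ => by positivity)
  simpa [zetaReal] using this

lemma tsum_nonzero_absNorm {s : ℝ} (hs : 1 < s) :
    ∑' J : (Ideal (𝓞 K))⁰, ENNReal.ofReal ((Ideal.absNorm (J : Ideal (𝓞 K)) : ℝ) ^ (-s)) =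
      ENNReal.ofReal (zetaReal K s) := by
  rw [zetaReal, ENNReal.ofReal_tsum_of_nonneg (fun J => by positivity) (summable_absNorm_rpow hs)]
  refine tsum_subtype_eq_of_support_subset (f := fun J : Ideal (𝓞 K) =>
    ENNReal.ofReal ((Ideal.absNorm J : ℝ) ^ (-s))) fun J hJ => ?_
  by_contra h
  have h0 : J = 0 := by
    by_contra h0
    exact h (mem_nonZeroDivisors_iff_ne_zero.2 h0)
  subst h0
  simp [Real.zero_rpow (by linarith : -s ≠ 0)] at hJ

lemma measurable_psiInf : Measurable (psiInf K) := psiInf_antitone.measurable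

lemma measurable_heckeSum : Measurable (heckeSum K) := by
  have : Countable (Ideal (𝓞 K))⁰ := Subtype.countable
  refine Measurable.const_mul (Measurable.tsum fun J => ?_) _
  exact measurable_psiInf.comp (by fun_prop)

variable (K) in
/-- The completing factor of the zeta function up to a constant, in terms of `n s / 2`. -/
noncomputable def complFactor (s : ℝ) : ℝ :=
  |(discr K : ℝ)| ^ (s / Module.finrank ℚ K) * gammaInf K s

lemma complFactor_pos {s : ℝ} (hs : 0 < s) : 0 < complFactor K s :=
  mul_pos (Real.rpow_pos_of_pos abs_discr_pos _) (gammaInf_pos hs)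

lemma exists_heckePair_Λ : ∃ c : ℝ, 0 < c ∧ ∀ s : ℝ, (heckePair K).k < s →
    (heckePair K).Λ s = ((c * complFactor K s * zetaReal K
      (2 * s / Module.finrank ℚ K) : ℝ) : ℂ) := by
  obtain ⟨c, hc, h⟩ := exists_lintegral_psiInf (K := K)
  have hW : 0 < Nat.card (torsion K) := Nat.card_pos
  have hn : (0 : ℝ) < Module.finrank ℚ K := by exact_mod_cast Module.finrank_pos (R := ℚ) (M := K)
  have hcount : Countable (Ideal (𝓞 K))⁰ := Subtype.countable
  refine ⟨Nat.card (torsion K) * c, by positivity, fun s hs => ?_⟩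
  have hk : (heckePair K).k = Module.finrank ℚ K / 2 := rfl
  have hs0 : 0 < s := by rw [hk] at hs; linarith
  set n : ℝ := ((Module.finrank ℚ K : ℕ) : ℝ) with hn_def
  have hs1 : 1 < 2 * s / n := by
    rw [lt_div_iff₀ hn]; rw [hk] at hs; linarith
  have hG : 0 < gammaInf K s := gammaInf_pos hs0
  have key : ∫⁻ t in Ioi (0 : ℝ), ENNReal.ofReal (t ^ (s - 1)) * heckeSum K t =
      ENNReal.ofReal (Nat.card (torsion K) * c * complFactor K s * zetaReal K (2 * s / n)) := by
    have e : ∀ t : ℝ, ENNReal.ofReal (t ^ (s - 1)) * heckeSum K t = Nat.card (torsion K) *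
        ∑' J : (Ideal (𝓞 K))⁰, ENNReal.ofReal (t ^ (s - 1)) *
          psiInf K ((|(discr K : ℝ)| ^ (-1 / n) *
            (Ideal.absNorm (J : Ideal (𝓞 K)) : ℝ) ^ (2 / n)) * t) := fun t => by
      rw [heckeSum, mul_left_comm, ← ENNReal.tsum_mul_left]
      simp_rw [mul_right_comm _ t, ← hn_def]
    have hm : ∀ J : (Ideal (𝓞 K))⁰, AEMeasurable (fun t : ℝ => ENNReal.ofReal (t ^ (s - 1)) *
          psiInf K ((|(discr K : ℝ)| ^ (-1 / n) *
            (Ideal.absNorm (J : Ideal (𝓞 K)) : ℝ) ^ (2 / n)) * t))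
          ((volume : Measure ℝ).restrict (Ioi 0)) := fun J =>
      (Measurable.mul (by fun_prop) (measurable_psiInf.comp (by fun_prop))).aemeasurable
    simp_rw [e]
    rw [lintegral_const_mul' _ _ (ENNReal.natCast_ne_top _), lintegral_tsum hm]
    have e2 : ∀ J : (Ideal (𝓞 K))⁰, ∫⁻ t in Ioi (0 : ℝ), ENNReal.ofReal (t ^ (s - 1)) *
          psiInf K ((|(discr K : ℝ)| ^ (-1 / n) *
            (Ideal.absNorm (J : Ideal (𝓞 K)) : ℝ) ^ (2 / n)) * t) =
        ENNReal.ofReal (|(discr K : ℝ)| ^ (s / n) * (c * gammaInf K s)) *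
          ENNReal.ofReal ((Ideal.absNorm (J : Ideal (𝓞 K)) : ℝ) ^ (-(2 * s / n))) := fun J => by
      have hD := abs_discr_pos (K := K)
      have hJ : (0 : ℝ) < (Ideal.absNorm (J : Ideal (𝓞 K)) : ℝ) := by
        exact_mod_cast Nat.pos_of_ne_zero
          (Ideal.absNorm_eq_zero_iff.not.2 (nonZeroDivisors.coe_ne_zero J))
      rw [lintegral_rpow_comp_mul (by positivity), h s hs0, ← ENNReal.ofReal_mul (by positivity),
        ← ENNReal.ofReal_mul (by positivity), Real.mul_rpow (by positivity) (by positivity),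
        ← Real.rpow_mul hD.le, ← Real.rpow_mul hJ.le]
      rw [show -1 / n * -s = s / n by ring, show 2 / n * -s = -(2 * s / n) by ring]
      congr 1; ring
    simp_rw [e2]
    rw [ENNReal.tsum_mul_left, tsum_nonzero_absNorm hs1, ← ENNReal.ofReal_mul (by positivity),
      ← ENNReal.ofReal_natCast, ← ENNReal.ofReal_mul (by positivity), complFactor]
    congr 1; ring
  have h1 := ((heckePair K).hasMellin (s := s) (by simpa using hs)).2
  rw [← h1, mellin]
  have e : ∀ t ∈ Ioi (0 : ℝ), (t : ℂ) ^ ((s : ℂ) - 1) • ((heckePair K).f t - (heckePair K).f₀) =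
      (((ENNReal.ofReal (t ^ (s - 1)) * heckeSum K t).toReal : ℝ) : ℂ) := fun t ht => by
    have ht' : (0 : ℝ) < t := ht
    simp only [heckePair]
    rw [heckeTheta_toReal ht, ENNReal.toReal_mul, ENNReal.toReal_ofReal (by positivity),
      Complex.ofReal_mul, Complex.ofReal_cpow ht'.le, smul_eq_mul]
    simp
  rw [setIntegral_congr_fun measurableSet_Ioi e, integral_complex_ofReal, integral_toReal, key,
    ENNReal.toReal_ofReal]
  · have := one_le_zetaReal (K := K) hs1
    have := complFactor_pos (K := K) hs0
    positivity
  · exact (Measurable.mul (by fun_prop) measurable_heckeSum).aemeasurable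
  · filter_upwards [ae_restrict_mem measurableSet_Ioi] with t ht
    exact ENNReal.mul_lt_top ENNReal.ofReal_lt_top (heckeSum_ne_top ht).lt_top

end HeckeMellin

section ZetaContinuation

open nonZeroDivisors NumberField.Units NumberField.Units.dirichletUnitTheorem MeasureTheory
open Set Filter Topology
open scoped Classical

variable {K : Type*} [Field K] [NumberField K]

lemma abscissa_ideal_count : LSeries.abscissaOfAbsConv
    (fun n ↦ (Nat.card {I : Ideal (𝓞 K) // Ideal.absNorm I = n} : ℂ)) ≤ 1 := by
  refine LSeries.abscissaOfAbsConv_le_of_forall_lt_LSeriesSummable fun y hy => ?_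
  exact lseriesSummable_ideal_count (by simpa using hy)

lemma analyticOnNhd_dedekindZeta :
    AnalyticOnNhd ℂ (dedekindZeta K) {s : ℂ | 1 < s.re} := by
  refine (LSeries_analyticOnNhd _).mono fun s hs => ?_
  refine lt_of_le_of_lt abscissa_ideal_count ?_
  exact_mod_cast hs

variable (K) in
/-- The inverse of the completing factor, divided by `s`. -/
noncomputable def invComplFactor (s : ℂ) : ℂ :=
  ((|(discr K : ℝ)| : ℝ) : ℂ) ^ (-s / 2) * ((w₀ : InfinitePlace K).mult / 2 *
    (Complex.Gamma ((w₀ : InfinitePlace K).mult * s / 2 + 1))⁻¹) *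
    (∏ w : {w : InfinitePlace K // w ≠ w₀}, (Complex.Gamma (w.1.mult * s / 2))⁻¹) *
    ∏ w : InfinitePlace K, ((Real.pi * w.mult : ℝ) : ℂ) ^ (w.mult * s / 2)

lemma differentiable_invComplFactor : Differentiable ℂ (invComplFactor K) := by
  have hD := abs_discr_pos (K := K)
  have hG : ∀ a b : ℂ, Differentiable ℂ fun s => (Complex.Gamma (a * s / 2 + b))⁻¹ := fun a b =>
    Complex.differentiable_one_div_Gamma.comp (by fun_prop)
  unfold invComplFactor
  refine ((Differentiable.mul ?_ ((hG _ _).const_mul _)).mul ?_).mul ?_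
  · refine Differentiable.const_cpow (by fun_prop) (Or.inl ?_)
    exact_mod_cast hD.ne'
  · refine Differentiable.fun_finsetProd fun w _ => ?_
    simpa using hG w.1.mult 0
  · refine Differentiable.fun_finsetProd fun w _ => ?_
    refine Differentiable.const_cpow (by fun_prop) (Or.inl ?_)
    have := mult_ne_zero' w
    exact_mod_cast mul_ne_zero Real.pi_ne_zero this

lemma invComplFactor_ofReal {s : ℝ} (hs : 0 < s) : invComplFactor K s =
    ((s * complFactor K (Module.finrank ℚ K / 2 * s))⁻¹ : ℝ) := by
  have hn : (0 : ℝ) < Module.finrank ℚ K := by exact_mod_cast Module.finrank_pos (R := ℚ) (M := K)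
  have hD := abs_discr_pos (K := K)
  have e1 : ∀ w : InfinitePlace K,
    (w.mult * (Module.finrank ℚ K / 2 * s) / Module.finrank ℚ K : ℝ) =
      w.mult * s / 2 := fun w => by field_simp
  have hw0 := mult_ne_zero' (w₀ : InfinitePlace K)
  have hw : ∀ w : InfinitePlace K, (0 : ℝ) < w.mult := fun w => by exact_mod_cast w.mult_pos
  have e2 : ((w₀ : InfinitePlace K).mult / 2 *
      (Complex.Gamma ((w₀ : InfinitePlace K).mult * s / 2 + 1))⁻¹ : ℂ) =
      (s : ℂ)⁻¹ * (Complex.Gamma ((w₀ : InfinitePlace K).mult * s / 2))⁻¹ := by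
    rw [Complex.one_div_Gamma_eq_self_mul_one_div_Gamma_add_one
      ((w₀ : InfinitePlace K).mult * s / 2)]
    have : (s : ℂ) ≠ 0 := by exact_mod_cast hs.ne'
    field_simp
  have e3 : ∀ w : InfinitePlace K, (Complex.Gamma (w.mult * s / 2))⁻¹ =
      (((Real.Gamma (w.mult * s / 2))⁻¹ : ℝ) : ℂ) := fun w => by
    rw [Complex.ofReal_inv, ← Complex.Gamma_ofReal]
    push_cast
    rfl
  have e4 : ∀ w : InfinitePlace K, ((Real.pi * w.mult : ℝ) : ℂ) ^ (w.mult * s / 2 : ℂ) =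
      (((Real.pi * w.mult) ^ (w.mult * s / 2 : ℝ) : ℝ) : ℂ) := fun w => by
    rw [Complex.ofReal_cpow (by have := hw w; positivity)]
    push_cast
    rfl
  have e5 : ((|(discr K : ℝ)| : ℝ) : ℂ) ^ (-s / 2 : ℂ) =
    ((|(discr K : ℝ)| ^ (-s / 2) : ℝ) : ℂ) := by
    rw [Complex.ofReal_cpow hD.le]
    push_cast
    rfl
  rw [invComplFactor, e2, complFactor, gammaInf]
  simp_rw [e1, e3, e4, e5]
  rw [← Complex.ofReal_inv, ← Complex.ofReal_mul, ← Complex.ofReal_prod, ← Complex.ofReal_prod,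
    ← Complex.ofReal_mul, ← Complex.ofReal_mul, ← Complex.ofReal_mul]
  congr 1
  rw [Finset.prod_mul_distrib, Fintype.prod_eq_mul_prod_subtype_ne (fun w => Real.Gamma _) w₀]
  have e6 : ∀ w : InfinitePlace K, (1 / (Real.pi * w.mult)) ^ (w.mult * s / 2 : ℝ) =
      ((Real.pi * w.mult) ^ (w.mult * s / 2 : ℝ))⁻¹ := fun w => by
    rw [one_div, Real.inv_rpow (mul_nonneg Real.pi_pos.le (hw _).le)]
  simp_rw [e6]
  simp only [Finset.prod_inv_distrib, mul_inv, inv_inv]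
  rw [show -s / 2 = -(Module.finrank ℚ K / 2 * s / Module.finrank ℚ K : ℝ) by field_simp,
    Real.rpow_neg hD.le]
  ring

variable (K) in
/-- The entire function `s (s - k) Λ(s)`. -/
noncomputable def xiFun (s : ℂ) : ℂ :=
  s * (s - (heckePair K).k) * (heckePair K).Λ₀ s + (heckePair K).k * (heckeConst K).toReal

lemma differentiable_xiFun : Differentiable ℂ (xiFun K) := by
  have := (heckePair K).differentiable_Λ₀
  unfold xiFun
  fun_prop

lemma xiFun_eq {s : ℂ} (h0 : s ≠ 0) (h1 : s ≠ (heckePair K).k) :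
    xiFun K s = s * (s - (heckePair K).k) * (heckePair K).Λ s := by
  have h := (heckePair K).Λ₀_eq s
  have h2 : s - (heckePair K).k ≠ 0 := sub_ne_zero.2 h1
  have h3 : (heckePair K).k - s ≠ 0 := sub_ne_zero.2 h1.symm
  rw [xiFun, h]
  simp only [heckePair, smul_eq_mul] at h2 h3 ⊢
  field_simp
  ring

lemma exists_gFun : ∃ c : ℝ, 0 < c ∧
    (∀ s : ℝ, (heckePair K).k < s → (heckePair K).Λ s =
      ((c * complFactor K s * zetaReal K (2 * s / Module.finrank ℚ K) : ℝ) : ℂ)) ∧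
    ∀ s : ℂ, 1 < s.re → (s - 1) * dedekindZeta K s = 4 / ((Module.finrank ℚ K) ^ 2 * c) *
      invComplFactor K s * xiFun K (Module.finrank ℚ K / 2 * s) := by
  obtain ⟨c, hc, h⟩ := exists_heckePair_Λ (K := K)
  refine ⟨c, hc, h, ?_⟩
  have hn : (0 : ℝ) < Module.finrank ℚ K := by exact_mod_cast Module.finrank_pos (R := ℚ) (M := K)
  have hk : (heckePair K).k = Module.finrank ℚ K / 2 := rfl
  set n := Module.finrank ℚ K
  have hreal : ∀ s : ℝ, 1 < s → ((s : ℂ) - 1) * dedekindZeta K s = 4 / (n ^ 2 * c) *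
      invComplFactor K s * xiFun K (n / 2 * s) := fun s hs => by
    have h2 := h (n / 2 * s) (by rw [hk]; nlinarith)
    have h3 : 2 * (n / 2 * s) / n = s := by field_simp
    have h4 : (((n / 2 * s : ℝ)) : ℂ) = n / 2 * s := by push_cast; rfl
    have hn' : (n : ℂ) ≠ 0 := by exact_mod_cast hn.ne'
    rw [h3, h4] at h2
    rw [dedekindZeta_ofReal hs, invComplFactor_ofReal (by linarith),
      show ((Module.finrank ℚ K : ℕ) : ℝ) = n from rfl, xiFun_eq, h2, hk]
    · have h5 : (complFactor K (n / 2 * s) : ℂ) ≠ 0 := by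
        exact_mod_cast (complFactor_pos (by positivity)).ne'
      have h6 : (c : ℂ) ≠ 0 := by exact_mod_cast hc.ne'
      have h7 : (s : ℂ) ≠ 0 := by exact_mod_cast (by linarith : s ≠ 0)
      generalize complFactor K (n / 2 * s) = A at h5 ⊢
      push_cast
      field_simp
      ring
    · have h7 : (s : ℂ) ≠ 0 := by exact_mod_cast (by linarith : s ≠ 0)
      exact mul_ne_zero (by simpa using hn') h7
    · rw [hk, ← h4]
      intro h8
      have : (n / 2 * s : ℝ) = n / 2 := by exact_mod_cast h8
      nlinarith
  have hopen : IsPreconnected {s : ℂ | 1 < s.re} :=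
    (convex_halfSpace_re_gt 1).isPreconnected
  have h1 : AnalyticOnNhd ℂ (fun s => (s - 1) * dedekindZeta K s) {s : ℂ | 1 < s.re} :=
    AnalyticOnNhd.mul (fun s _ => by fun_prop) analyticOnNhd_dedekindZeta
  have hd : Differentiable ℂ fun s => 4 / ((n : ℂ) ^ 2 * c) *
      invComplFactor K s * xiFun K (n / 2 * s) :=
    (differentiable_invComplFactor.const_mul _).mul
      (differentiable_xiFun.comp (by fun_prop))
  have h2 : AnalyticOnNhd ℂ (fun s => 4 / ((n : ℂ) ^ 2 * c) *
      invComplFactor K s * xiFun K (n / 2 * s)) {s : ℂ | 1 < s.re} := fun s _ => hd.analyticAt s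
  refine h1.eqOn_of_preconnected_of_frequently_eq h2 hopen (z₀ := 2) (by simp) ?_
  have ht : Tendsto (fun x : ℝ => (x : ℂ)) (𝓝[≠] 2) (𝓝[≠] 2) := by
    refine tendsto_nhdsWithin_iff.2 ⟨?_, ?_⟩
    · have := (Complex.continuous_ofReal.tendsto 2)
      exact (by simpa using this : Tendsto (fun x : ℝ => (x : ℂ)) (𝓝 2) (𝓝 2)).mono_left
        nhdsWithin_le_nhds
    · filter_upwards [self_mem_nhdsWithin] with x hx h
      have h' : (x : ℂ) = 2 := h
      exact hx (by exact_mod_cast h' : x = 2)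
  refine ht.frequently (Eventually.frequently ?_)
  filter_upwards [nhdsWithin_le_nhds (Ioi_mem_nhds (by norm_num : (1 : ℝ) < 2))] with x hx
  exact hreal x hx

lemma exists_norm_inv_Gamma_le : ∃ A : ℝ, 1 ≤ A ∧ ∀ z : ℂ, ‖z‖ ≤ 5 → ‖(Complex.Gamma z)⁻¹‖ ≤ A := by
  obtain ⟨A, hA⟩ := (isCompact_closedBall (0 : ℂ) 5).exists_bound_of_continuousOn
    Complex.differentiable_one_div_Gamma.continuous.continuousOn
  refine ⟨max 1 A, le_max_left _ _, fun z hz => (hA z (by simpa using hz)).trans (le_max_right _ _)⟩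

lemma mult_le_two {K : Type*} [Field K] (w : InfinitePlace K) : (w.mult : ℝ) ≤ 2 := by
  unfold InfinitePlace.mult
  split_ifs <;> norm_num

lemma one_le_mult {K : Type*} [Field K] (w : InfinitePlace K) : (1 : ℝ) ≤ w.mult := by
  exact_mod_cast w.mult_pos

lemma card_infinitePlace_le : Fintype.card (InfinitePlace K) ≤ Module.finrank ℚ K := by
  rw [← InfinitePlace.sum_mult_eq (K := K), Fintype.card_eq_sum_ones]
  exact Finset.sum_le_sum fun w _ => w.mult_pos

lemma one_le_abs_discr : 1 ≤ |(discr K : ℝ)| := by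
  exact_mod_cast Int.one_le_abs (discr_ne_zero K)

lemma norm_invComplFactor_le {A : ℝ} (hA : 1 ≤ A)
    (h : ∀ z : ℂ, ‖z‖ ≤ 5 → ‖(Complex.Gamma z)⁻¹‖ ≤ A) {s : ℂ} (hs : ‖s - 2‖ ≤ 3 / 2) :
    ‖invComplFactor K s‖ ≤ (A * (2 * Real.pi) ^ (4 : ℝ)) ^ Module.finrank ℚ K := by
  have hre := (abs_le.1 ((Complex.abs_re_le_norm _).trans hs))
  simp only [Complex.sub_re, Complex.re_ofNat] at hre
  have hnorm : ‖s‖ ≤ 7 / 2 := by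
    have : ‖s‖ ≤ ‖s - 2‖ + ‖(2 : ℂ)‖ := by simpa using norm_add_le (s - 2) 2
    norm_num at this
    linarith
  have hP : (1 : ℝ) ≤ 2 * Real.pi := by linarith [Real.pi_gt_three]
  set P := (2 * Real.pi) ^ (4 : ℝ)
  have hP1 : 1 ≤ P := Real.one_le_rpow hP (by norm_num)
  have hw : ∀ w : InfinitePlace K, ‖(w.mult * s / 2 : ℂ)‖ ≤ 7 / 2 := fun w => by
    rw [norm_div, norm_mul, Complex.norm_natCast, Complex.norm_ofNat]
    nlinarith [mult_le_two w, one_le_mult w, norm_nonneg s]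
  have e1 : ‖((|(discr K : ℝ)| : ℝ) : ℂ) ^ (-s / 2)‖ ≤ 1 := by
    rw [Complex.norm_cpow_eq_rpow_re_of_pos abs_discr_pos]
    refine Real.rpow_le_one_of_one_le_of_nonpos one_le_abs_discr ?_
    simp
    linarith
  have e2 : ‖((w₀ : InfinitePlace K).mult / 2 *
      (Complex.Gamma ((w₀ : InfinitePlace K).mult * s / 2 + 1))⁻¹ : ℂ)‖ ≤ A := by
    rw [norm_mul, norm_div, Complex.norm_natCast, Complex.norm_ofNat]
    have h1 := h ((w₀ : InfinitePlace K).mult * s / 2 + 1) (by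
      refine (norm_add_le _ _).trans ?_
      have := hw w₀
      rw [norm_one]
      linarith)
    have h2 : ((w₀ : InfinitePlace K).mult / 2 : ℝ) ≤ 1 := by
      linarith [mult_le_two (w₀ : InfinitePlace K)]
    calc _ ≤ 1 * A := mul_le_mul h2 h1 (norm_nonneg _) zero_le_one
      _ = A := one_mul A
  have e3 : ‖∏ w : {w : InfinitePlace K // w ≠ w₀}, (Complex.Gamma (w.1.mult * s / 2))⁻¹‖ ≤
      ∏ w : {w : InfinitePlace K // w ≠ w₀}, A := by
    rw [norm_prod]
    exact Finset.prod_le_prod (fun _ _ => norm_nonneg _) fun w _ => h _ ((hw w).trans (by norm_num))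
  have e4 : ‖∏ w : InfinitePlace K, ((Real.pi * w.mult : ℝ) : ℂ) ^ (w.mult * s / 2)‖ ≤
      ∏ w : InfinitePlace K, P := by
    rw [norm_prod]
    refine Finset.prod_le_prod (fun _ _ => norm_nonneg _) fun w _ => ?_
    have h1 := one_le_mult w
    have h2 := mult_le_two w
    rw [Complex.norm_cpow_eq_rpow_re_of_pos (by positivity)]
    have h3 : (w.mult * s / 2 : ℂ).re = w.mult * s.re / 2 := by simp
    rw [h3]
    refine (Real.rpow_le_rpow_of_exponent_le ?_ (z := (4 : ℝ)) (by nlinarith)).trans ?_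
    · nlinarith [Real.pi_gt_three]
    · exact Real.rpow_le_rpow (by positivity) (by nlinarith [Real.pi_gt_three]) (by norm_num)
  rw [invComplFactor, norm_mul, norm_mul, norm_mul]
  calc _ ≤ 1 * A * (∏ w : {w : InfinitePlace K // w ≠ w₀}, A) * ∏ w : InfinitePlace K, P := by
        gcongr
    _ = (A * P) ^ Fintype.card (InfinitePlace K) := by
        rw [one_mul, ← Fintype.prod_eq_mul_prod_subtype_ne (fun _ => A) w₀,
          ← Finset.prod_mul_distrib, Finset.prod_const, Finset.card_univ]
    _ ≤ _ := pow_le_pow_right₀ (one_le_mul_of_one_le_of_one_le hA hP1) card_infinitePlace_le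

lemma complFactor_le : complFactor K (2 * Module.finrank ℚ K) ≤
    |(discr K : ℝ)| ^ 2 * 6 ^ Module.finrank ℚ K := by
  have hn : (0 : ℝ) < Module.finrank ℚ K := by exact_mod_cast Module.finrank_pos (R := ℚ) (M := K)
  rw [complFactor, mul_div_assoc, div_self hn.ne', mul_one, Real.rpow_ofNat]
  refine mul_le_mul_of_nonneg_left ?_ (by positivity)
  calc gammaInf K (2 * Module.finrank ℚ K) ≤ ∏ w : InfinitePlace K, 6 := by
        refine Finset.prod_le_prod (fun w _ => ?_) fun w _ => ?_
        · exact mul_nonneg (by positivity) (Real.Gamma_nonneg_of_nonneg (by positivity))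
        · have h1 := one_le_mult w
          have h2 := mult_le_two w
          have h3 : (w.mult * (2 * Module.finrank ℚ K) / Module.finrank ℚ K : ℝ) = w.mult * 2 := by
            field_simp
          rw [h3]
          have h4 : (1 / (Real.pi * w.mult) : ℝ) ^ (w.mult * 2 : ℝ) ≤ 1 := by
            refine Real.rpow_le_one (by positivity) ?_ (by positivity)
            rw [div_le_one (by positivity)]
            nlinarith [Real.pi_gt_three]
          have h5 : Real.Gamma (w.mult * 2) ≤ 6 := by
            have : w.mult = 1 ∨ w.mult = 2 := by
              have := w.mult_pos
              have : w.mult ≤ 2 := by exact_mod_cast h2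
              omega
            rcases this with h | h <;> rw [h] <;> norm_num
          calc _ ≤ (1 : ℝ) * 6 := mul_le_mul h4 h5 (Real.Gamma_nonneg_of_nonneg (by positivity))
                zero_le_one
            _ = 6 := one_mul 6
    _ = 6 ^ Fintype.card (InfinitePlace K) := by rw [Finset.prod_const, Finset.card_univ]
    _ ≤ _ := pow_le_pow_right₀ (by norm_num) card_infinitePlace_le

lemma norm_xiFun_le {s : ℂ} (hs : ‖s - 2‖ ≤ 3 / 2) :
    ‖xiFun K (Module.finrank ℚ K / 2 * s)‖ ≤ 11 * (Module.finrank ℚ K : ℝ) ^ 2 *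
      ‖(heckePair K).Λ ((2 * Module.finrank ℚ K : ℝ) : ℂ)‖ := by
  have hn : (0 : ℝ) < Module.finrank ℚ K := by exact_mod_cast Module.finrank_pos (R := ℚ) (M := K)
  have hk : (heckePair K).k = Module.finrank ℚ K / 2 := rfl
  obtain ⟨hb1, hb2⟩ := heckePair_bound (K := K) (σ := 2 * Module.finrank ℚ K)
    (by rw [hk]; linarith)
  rw [hk] at hb1 hb2
  set n := Module.finrank ℚ K
  set Λ := ‖(heckePair K).Λ ((2 * n : ℝ) : ℂ)‖
  have hΛ : 0 ≤ Λ := norm_nonneg _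
  have hre := (abs_le.1 ((Complex.abs_re_le_norm _).trans hs))
  simp only [Complex.sub_re, Complex.re_ofNat] at hre
  have hnorm : ‖s‖ ≤ 7 / 2 := by
    have : ‖s‖ ≤ ‖s - 2‖ + ‖(2 : ℂ)‖ := by simpa using norm_add_le (s - 2) 2
    norm_num at this
    linarith
  have hnorm' : ‖s - 1‖ ≤ 5 / 2 := by
    have : ‖s - 1‖ ≤ ‖s - 2‖ + ‖(1 : ℂ)‖ := by
      have := norm_add_le (s - 2) 1
      rwa [show s - 2 + 1 = s - 1 by ring] at this
    norm_num at this
    linarith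
  have hre2 : ((n : ℂ) / 2 * s).re = n / 2 * s.re := by
    rw [show (n : ℂ) / 2 = ((n / 2 : ℝ) : ℂ) by push_cast; rfl, Complex.re_ofReal_mul]
  have h1 := hb1 (n / 2 * s) (by rw [hre2]; nlinarith) (by rw [hre2]; nlinarith)
  have h2 : ‖(n : ℂ) / 2 * s‖ ≤ 2 * n := by
    rw [norm_mul, norm_div, Complex.norm_natCast, Complex.norm_ofNat]
    nlinarith
  have h3 : ‖(n : ℂ) / 2 * s - (heckePair K).k‖ ≤ 2 * n := by
    rw [hk, show (n : ℂ) / 2 * s - ((n / 2 : ℝ) : ℂ) = n / 2 * (s - 1) by push_cast; ring,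
      norm_mul, norm_div, Complex.norm_natCast, Complex.norm_ofNat]
    nlinarith
  rw [xiFun]
  refine (norm_add_le _ _).trans ?_
  rw [norm_mul, norm_mul]
  have h4 : ‖((heckePair K).k : ℂ) * ((heckeConst K).toReal : ℂ)‖ =
      n / 2 * (heckeConst K).toReal := by
    rw [norm_mul, hk, Complex.norm_real, Complex.norm_real,
      Real.norm_of_nonneg ENNReal.toReal_nonneg, Real.norm_of_nonneg (by positivity)]
  have h5 : ‖(n : ℂ) / 2 * s‖ * ‖(n : ℂ) / 2 * s - (heckePair K).k‖ *
      ‖(heckePair K).Λ₀ (n / 2 * s)‖ ≤ (2 * n) * (2 * n) * (2 * Λ) := by gcongr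
  rw [h4]
  nlinarith

/-- The Dedekind zeta function extends to `ℂ ∖ {1}`, with an explicit bound near `2`. -/
lemma exists_zeta_continuation : ∃ A : ℝ, 1 ≤ A ∧ ∀ (K : Type) [Field K] [NumberField K],
    ∃ g : ℂ → ℂ, Differentiable ℂ g ∧ (∀ s : ℂ, 1 < s.re → (s - 1) * dedekindZeta K s = g s) ∧
      ∀ s : ℂ, ‖s - 2‖ ≤ 3 / 2 →
        ‖g s‖ ≤ A ^ Module.finrank ℚ K * |(discr K : ℝ)| ^ 2 * zetaReal K 4 := by
  obtain ⟨A, hA, hG⟩ := exists_norm_inv_Gamma_le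
  have hP : (1 : ℝ) ≤ 2 * Real.pi := by linarith [Real.pi_gt_three]
  have hP1 : 1 ≤ (2 * Real.pi) ^ (4 : ℝ) := Real.one_le_rpow hP (by norm_num)
  refine ⟨44 * (A * (2 * Real.pi) ^ (4 : ℝ) * 6), by nlinarith, fun K _ _ => ?_⟩
  obtain ⟨c, hc, h1, h2⟩ := exists_gFun (K := K)
  refine ⟨_, ?_, h2, fun s hs => ?_⟩
  · exact (differentiable_invComplFactor.const_mul _).mul (differentiable_xiFun.comp (by fun_prop))
  have hn0 := Module.finrank_pos (R := ℚ) (M := K)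
  have hn : (0 : ℝ) < Module.finrank ℚ K := by exact_mod_cast hn0
  have hk : (heckePair K).k = Module.finrank ℚ K / 2 := rfl
  have h3 := norm_invComplFactor_le (K := K) hA hG hs
  have h4 := norm_xiFun_le (K := K) hs
  have h5 := complFactor_le (K := K)
  have hZ := one_le_zetaReal (K := K) (s := 4) (by norm_num)
  have hcf := complFactor_pos (K := K) (s := 2 * Module.finrank ℚ K) (by positivity)
  rw [h1 (2 * Module.finrank ℚ K) (by rw [hk]; linarith), Complex.norm_real,
    Real.norm_of_nonneg] at h4
  swap
  · rw [show 2 * (2 * Module.finrank ℚ K : ℝ) / Module.finrank ℚ K = 4 by field_simp; norm_num]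
    positivity
  rw [show 2 * (2 * Module.finrank ℚ K : ℝ) / Module.finrank ℚ K = 4 by field_simp; norm_num] at h4
  set n := Module.finrank ℚ K
  set B := A * (2 * Real.pi) ^ (4 : ℝ)
  have hB : 0 ≤ B := by positivity
  have h6 : ‖(4 : ℂ) / ((n : ℂ) ^ 2 * c)‖ = 4 / (n ^ 2 * c) := by
    rw [norm_div, norm_mul, norm_pow, Complex.norm_natCast, Complex.norm_real,
      Real.norm_of_nonneg hc.le, Complex.norm_ofNat]
  rw [norm_mul, norm_mul, h6]
  calc _ ≤ 4 / (n ^ 2 * c) * B ^ n * (11 * (n : ℝ) ^ 2 *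
        (c * (|(discr K : ℝ)| ^ 2 * 6 ^ n) * zetaReal K 4)) := by
        refine mul_le_mul (mul_le_mul_of_nonneg_left h3 (by positivity)) (h4.trans ?_)
          (norm_nonneg _) (by positivity)
        gcongr
    _ = 44 * ((B * 6) ^ n * |(discr K : ℝ)| ^ 2 * zetaReal K 4) := by
        rw [mul_pow]
        field_simp
        ring
    _ ≤ 44 ^ n * ((B * 6) ^ n * |(discr K : ℝ)| ^ 2 * zetaReal K 4) := by
        refine mul_le_mul_of_nonneg_right ?_ (by positivity)
        exact le_self_pow₀ (by norm_num) hn0.ne'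
    _ = (44 * (B * 6)) ^ n * |(discr K : ℝ)| ^ 2 * zetaReal K 4 := by
        rw [mul_pow 44]
        ring

end ZetaContinuation

section EulerProduct

open Filter Topology IsDedekindDomain
open scoped Classical

variable {R : Type*} [CommRing R] [IsDedekindDomain R]

lemma heightOne_dvd_mul_iff {v w : HeightOneSpectrum R} (h : v ≠ w) (J : Ideal R) :
    v.asIdeal ∣ w.asIdeal * J ↔ v.asIdeal ∣ J := by
  refine ⟨fun hd => ?_, fun hd => hd.mul_left _⟩
  rcases v.prime.dvd_or_dvd hd with h1 | h1
  · refine absurd ?_ h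
    exact HeightOneSpectrum.ext
      (w.isMaximal.eq_of_le v.isPrime.ne_top (Ideal.le_of_dvd h1)).symm
  · exact h1

lemma prod_one_sub_mul_tsum {f : Ideal R → ℂ} (hmul : ∀ I J, f (I * J) = f I * f J)
    (hf : Summable f) (S : Finset (HeightOneSpectrum R)) :
    (∏ v ∈ S, (1 - f v.asIdeal)) * ∑' J, f J =
      ∑' J, if ∀ v ∈ S, ¬ v.asIdeal ∣ J then f J else 0 := by
  induction S using Finset.induction_on with
  | empty => simp
  | insert q S hq ih =>
    rw [Finset.prod_insert hq, mul_assoc, ih, sub_mul, one_mul, ← tsum_mul_left]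
    set F : Ideal R → ℂ := fun J => if ∀ v ∈ S, ¬ v.asIdeal ∣ J then f J else 0 with hF
    have hFs : Summable F := by
      refine Summable.of_norm_bounded hf.norm fun J => ?_
      simp only [hF]; split_ifs <;> simp
    set G : Ideal R → ℂ := fun J => if q.asIdeal ∣ J then F J else 0 with hG
    have hGs : Summable G := by
      refine Summable.of_norm_bounded hFs.norm fun J => ?_
      simp only [hG]; split_ifs <;> simp
    have hinj : Function.Injective fun J : Ideal R => q.asIdeal * J :=
      mul_right_injective₀ q.ne_bot
    have h1 : ∑' J, f q.asIdeal * F J = ∑' J, G J := by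
      rw [← hinj.tsum_eq (f := G)]
      · refine tsum_congr fun J => ?_
        simp only [hG, hF, dvd_mul_right, if_true, mul_ite, mul_zero, hmul]
        refine if_congr (forall₂_congr fun v hv => ?_) rfl rfl
        rw [heightOne_dvd_mul_iff]
        rintro rfl
        exact hq hv
      · intro J hJ
        have : q.asIdeal ∣ J := by
          by_contra h
          exact hJ (by simp [hG, h])
        obtain ⟨J', rfl⟩ := this
        exact ⟨J', rfl⟩
    rw [h1, ← hFs.tsum_sub hGs]
    refine tsum_congr fun J => ?_
    simp only [hG, hF, Finset.forall_mem_insert]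
    by_cases h : q.asIdeal ∣ J <;> simp [h]

lemma tendsto_prod_one_sub_mul_tsum {f : Ideal R → ℂ} (hmul : ∀ I J, f (I * J) = f I * f J)
    (hf : Summable f) (h0 : f ⊥ = 0) (h1 : f ⊤ = 1) :
    Tendsto (fun S : Finset (HeightOneSpectrum R) =>
      (∏ v ∈ S, (1 - f v.asIdeal)) * ∑' J, f J) atTop (𝓝 1) := by
  simp_rw [prod_one_sub_mul_tsum hmul hf]
  have h2 : ∑' J : Ideal R, (if J = ⊤ then (1 : ℂ) else 0) = 1 := tsum_ite_eq _ _
  rw [← h2]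
  refine tendsto_tsum_of_dominated_convergence hf.norm (fun J => ?_) (Eventually.of_forall
    fun S J => by split_ifs <;> simp)
  by_cases hJ : J = ⊤
  · subst hJ
    refine tendsto_const_nhds.congr fun S => ?_
    have : ∀ v ∈ S, ¬ v.asIdeal ∣ (⊤ : Ideal R) := fun v _ h =>
      v.isPrime.ne_top (top_le_iff.1 (Ideal.le_of_dvd h))
    rw [if_pos this, if_pos rfl, h1]
  · rw [if_neg hJ]
    by_cases hb : J = ⊥
    · subst hb
      refine tendsto_const_nhds.congr fun S => ?_
      simp [h0]
    · obtain ⟨M, hM, hle⟩ := Ideal.exists_le_maximal J hJ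
      have hMb : M ≠ ⊥ := fun h => hb (le_bot_iff.1 (h ▸ hle))
      refine tendsto_const_nhds.congr' ?_
      filter_upwards [eventually_ge_atTop {(⟨M, hM.isPrime, hMb⟩ : HeightOneSpectrum R)}] with S hS
      rw [if_neg]
      push Not
      exact ⟨⟨M, hM.isPrime, hMb⟩, hS (Finset.mem_singleton_self _), Ideal.dvd_iff_le.2 hle⟩

end EulerProduct

section PrimeIdeals

open Filter Topology IsDedekindDomain
open scoped Classical

variable {K : Type*} [Field K] [NumberField K]

lemma two_le_absNorm (v : HeightOneSpectrum (𝓞 K)) : 2 ≤ Ideal.absNorm v.asIdeal := by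
  have h0 : Ideal.absNorm v.asIdeal ≠ 0 := by
    rw [Ne, Ideal.absNorm_eq_zero_iff]; exact v.ne_bot
  have h1 : Ideal.absNorm v.asIdeal ≠ 1 := by
    rw [Ne, Ideal.absNorm_eq_one_iff]; exact v.isPrime.ne_top
  omega

lemma exists_charOf (v : HeightOneSpectrum (𝓞 K)) : ∃ p n : ℕ, 0 < n ∧ (p : 𝓞 K) ∈ v.asIdeal ∧
    p.Prime ∧ Ideal.absNorm v.asIdeal = p ^ n :=
  haveI := v.isMaximal
  Ideal.exists_prime_and_absNorm_eq_pow v.asIdeal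

/-- The residue characteristic of a prime ideal. -/
noncomputable def charOf (v : HeightOneSpectrum (𝓞 K)) : ℕ := (exists_charOf v).choose

lemma charOf_spec (v : HeightOneSpectrum (𝓞 K)) : ∃ n : ℕ, 0 < n ∧
    (charOf v : 𝓞 K) ∈ v.asIdeal ∧ (charOf v).Prime ∧ Ideal.absNorm v.asIdeal = charOf v ^ n :=
  (exists_charOf v).choose_spec

lemma card_charOf_le (s : Finset (HeightOneSpectrum (𝓞 K))) (p : ℕ)
    (hs : ∀ v ∈ s, charOf v = p) : s.card ≤ Module.finrank ℚ K := by
  rcases s.eq_empty_or_nonempty with rfl | ⟨v₀, hv₀⟩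
  · simp
  have hp : p.Prime := by
    obtain ⟨n, -, -, h, -⟩ := charOf_spec v₀
    rwa [hs v₀ hv₀] at h
  have hinj : Function.Injective (HeightOneSpectrum.asIdeal (R := 𝓞 K)) :=
    fun v w h => HeightOneSpectrum.ext h
  have h1 : ∏ I ∈ s.image HeightOneSpectrum.asIdeal, I ∣ Ideal.span {(p : 𝓞 K)} := by
    refine Finset.prod_primes_dvd _ (fun I hI => ?_) fun I hI => ?_
    · obtain ⟨v, -, rfl⟩ := Finset.mem_image.1 hI
      exact v.prime
    · obtain ⟨v, hv, rfl⟩ := Finset.mem_image.1 hI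
      obtain ⟨n, -, h, -, -⟩ := charOf_spec v
      rw [hs v hv] at h
      exact Ideal.dvd_span_singleton.2 h
  rw [Finset.prod_image fun _ _ _ _ h => hinj h] at h1
  have h2 := map_dvd Ideal.absNorm h1
  rw [map_prod, Ideal.absNorm_span_natCast, RingOfIntegers.rank] at h2
  have h3 : p ^ s.card ≤ ∏ v ∈ s, Ideal.absNorm v.asIdeal := by
    rw [← Finset.prod_const]
    refine Finset.prod_le_prod' fun v hv => ?_
    obtain ⟨n, hn, -, -, h⟩ := charOf_spec v
    rw [h, hs v hv]
    exact Nat.le_self_pow hn.ne' p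
  exact (Nat.pow_le_pow_iff_right hp.one_lt).1 (h3.trans (Nat.le_of_dvd (pow_pos hp.pos _) h2))

lemma sum_charOf_le {u : ℕ → ℝ} (hu : ∀ m, 0 ≤ u m) (hs : Summable u)
    (s : Finset (HeightOneSpectrum (𝓞 K))) :
    ∑ v ∈ s, u (charOf v) ≤ Module.finrank ℚ K * ∑' m, u m := by
  rw [← Finset.sum_fiberwise_of_maps_to (t := s.image charOf) (g := charOf)
    fun v hv => Finset.mem_image_of_mem _ hv]
  calc _ ≤ ∑ p ∈ s.image charOf, (Module.finrank ℚ K : ℝ) * u p := by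
        refine Finset.sum_le_sum fun p _ => ?_
        rw [Finset.sum_congr rfl (g := fun _ => u p)
          fun v hv => by rw [(Finset.mem_filter.1 hv).2], Finset.sum_const, nsmul_eq_mul]
        exact mul_le_mul_of_nonneg_right (by
          exact_mod_cast card_charOf_le _ p fun v hv => (Finset.mem_filter.1 hv).2) (hu p)
    _ ≤ _ := by
        rw [← Finset.mul_sum]
        exact mul_le_mul_of_nonneg_left (hs.sum_le_tsum _ fun _ _ => hu _) (Nat.cast_nonneg _)

lemma summable_charOf {u : ℕ → ℝ} (hu : ∀ m, 0 ≤ u m) (hs : Summable u) :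
    Summable fun v : HeightOneSpectrum (𝓞 K) => u (charOf v) :=
  summable_of_sum_le (fun _ => hu _) (sum_charOf_le hu hs)

lemma tsum_charOf_le {u : ℕ → ℝ} (hu : ∀ m, 0 ≤ u m) (hs : Summable u) :
    ∑' v : HeightOneSpectrum (𝓞 K), u (charOf v) ≤ Module.finrank ℚ K * ∑' m, u m :=
  (summable_charOf hu hs).tsum_le_of_sum_le (sum_charOf_le hu hs)

lemma charOf_le_absNorm (v : HeightOneSpectrum (𝓞 K)) : charOf v ≤ Ideal.absNorm v.asIdeal := by
  obtain ⟨n, hn, -, -, h⟩ := charOf_spec v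
  rw [h]
  exact Nat.le_self_pow hn.ne' _

lemma absNorm_rpow_le {s : ℝ} (hs : 0 ≤ s) (v : HeightOneSpectrum (𝓞 K)) :
    (Ideal.absNorm v.asIdeal : ℝ) ^ (-s) ≤ (charOf v : ℝ) ^ (-s) := by
  obtain ⟨n, hn, -, hp, h⟩ := charOf_spec v
  exact Real.rpow_le_rpow_of_nonpos (by exact_mod_cast hp.pos)
    (by exact_mod_cast charOf_le_absNorm v) (by linarith)

lemma summable_prime_rpow {s : ℝ} (hs : 1 < s) :
    Summable fun v : HeightOneSpectrum (𝓞 K) => (Ideal.absNorm v.asIdeal : ℝ) ^ (-s) :=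
  Summable.of_nonneg_of_le (fun _ => by positivity) (absNorm_rpow_le (by linarith))
    (summable_charOf (u := fun m => (m : ℝ) ^ (-s)) (fun _ => by positivity)
      (Real.summable_nat_rpow.2 (by linarith)))

lemma prime_rpow_le_half {s : ℝ} (hs : 1 ≤ s) (v : HeightOneSpectrum (𝓞 K)) :
    (Ideal.absNorm v.asIdeal : ℝ) ^ (-s) ≤ 1 / 2 := by
  have h2 : (2 : ℝ) ≤ Ideal.absNorm v.asIdeal := by exact_mod_cast two_le_absNorm v
  calc (Ideal.absNorm v.asIdeal : ℝ) ^ (-s) ≤ (2 : ℝ) ^ (-s) :=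
        Real.rpow_le_rpow_of_nonpos (by norm_num) h2 (by linarith)
    _ ≤ (2 : ℝ) ^ (-1 : ℝ) := Real.rpow_le_rpow_of_exponent_le (by norm_num) (by linarith)
    _ = 1 / 2 := by rw [Real.rpow_neg_one]; norm_num

lemma tsum_pow_succ_le {r : ℝ} (h0 : 0 ≤ r) (h : r ≤ 1 / 2) :
    Summable (fun i : ℕ => r ^ (i + 1)) ∧ ∑' i : ℕ, r ^ (i + 1) ≤ 2 * r := by
  have hs := summable_geometric_of_lt_one h0 (by linarith)
  refine ⟨(summable_nat_add_iff 1).2 hs, ?_⟩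
  simp_rw [pow_succ]
  rw [tsum_mul_right, tsum_geometric_of_lt_one h0 (by linarith)]
  refine mul_le_mul_of_nonneg_right ?_ h0
  rw [inv_le_comm₀ (by linarith) (by norm_num)]
  linarith

lemma summable_primePow {s : ℝ} (hs : 1 < s) :
    Summable fun q : HeightOneSpectrum (𝓞 K) × ℕ =>
      ((Ideal.absNorm q.1.asIdeal : ℝ) ^ (-s)) ^ (q.2 + 1) := by
  rw [summable_prod_of_nonneg fun _ => by positivity]
  have h := fun v : HeightOneSpectrum (𝓞 K) =>
    tsum_pow_succ_le (by positivity) (prime_rpow_le_half hs.le v)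
  exact ⟨fun v => (h v).1, Summable.of_nonneg_of_le (fun v => tsum_nonneg fun _ => by positivity)
    (fun v => (h v).2) ((summable_prime_rpow hs).mul_left 2)⟩

lemma norm_prime_cpow (s : ℂ) (v : HeightOneSpectrum (𝓞 K)) :
    ‖(Ideal.absNorm v.asIdeal : ℂ) ^ (-s)‖ = (Ideal.absNorm v.asIdeal : ℝ) ^ (-s.re) := by
  rw [Complex.norm_natCast_cpow_of_pos (by linarith [two_le_absNorm v]), Complex.neg_re]

variable (K) in
/-- The logarithm of the Dedekind zeta function, as a sum over prime ideal powers. -/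
noncomputable def logZeta (s : ℂ) : ℂ :=
  ∑' q : HeightOneSpectrum (𝓞 K) × ℕ,
    ((Ideal.absNorm q.1.asIdeal : ℂ) ^ (-s)) ^ (q.2 + 1) / (q.2 + 1)

lemma summable_logZeta {s : ℂ} (hs : 1 < s.re) : Summable fun q : HeightOneSpectrum (𝓞 K) × ℕ =>
    ((Ideal.absNorm q.1.asIdeal : ℂ) ^ (-s)) ^ (q.2 + 1) / (q.2 + 1) := by
  refine Summable.of_norm_bounded (summable_primePow hs) fun q => ?_
  rw [norm_div, norm_pow, norm_prime_cpow]
  refine div_le_self (by positivity) ?_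
  rw [show ((q.2 : ℂ) + 1) = ((q.2 + 1 : ℕ) : ℂ) by push_cast; rfl, Complex.norm_natCast]
  push_cast
  linarith [Nat.cast_nonneg (α := ℝ) q.2]

lemma exp_logZeta {s : ℂ} (hs : 1 < s.re) : Complex.exp (logZeta K s) = dedekindZeta K s := by
  have hlt : ∀ v : HeightOneSpectrum (𝓞 K), ‖(Ideal.absNorm v.asIdeal : ℂ) ^ (-s)‖ < 1 :=
    fun v => by
    rw [norm_prime_cpow]
    linarith [prime_rpow_le_half hs.le v]
  have h1 : HasSum (fun v : HeightOneSpectrum (𝓞 K) =>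
      -Complex.log (1 - (Ideal.absNorm v.asIdeal : ℂ) ^ (-s))) (logZeta K s) := by
    refine (summable_logZeta hs).hasSum.prod_fiberwise fun v => ?_
    have := Complex.hasSum_taylorSeries_neg_log (hlt v)
    rw [← hasSum_nat_add_iff' 1] at this
    simpa using this
  have hs0 : -s ≠ 0 := fun h => by
    rw [neg_eq_zero] at h; rw [h] at hs; simp at hs; linarith
  have h2 := tendsto_prod_one_sub_mul_tsum
    (f := fun J : Ideal (𝓞 K) => (Ideal.absNorm J : ℂ) ^ (-s))
    (fun I J => by rw [map_mul, Nat.cast_mul, Complex.natCast_mul_natCast_cpow])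
    (summable_absNorm_cpow hs) (by simp [Complex.zero_cpow hs0]) (by simp)
  simp only [tsum_absNorm_cpow hs] at h2
  have h3 : Tendsto (fun S : Finset (HeightOneSpectrum (𝓞 K)) =>
      Complex.exp (-∑ v ∈ S, -Complex.log (1 - (Ideal.absNorm v.asIdeal : ℂ) ^ (-s))) *
        dedekindZeta K s) atTop (𝓝 (Complex.exp (-logZeta K s) * dedekindZeta K s)) := by
    have h5 : Tendsto (fun S : Finset (HeightOneSpectrum (𝓞 K)) =>
      ∑ v ∈ S, -Complex.log (1 - (Ideal.absNorm v.asIdeal : ℂ) ^ (-s))) atTop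
      (𝓝 (logZeta K s)) := h1
    exact ((Complex.continuous_exp.tendsto _).comp h5.neg).mul_const _
  have h4 := tendsto_nhds_unique h3 (h2.congr fun S => by
    rw [← Finset.sum_neg_distrib, Complex.exp_sum]
    congr 1
    refine Finset.prod_congr rfl fun v _ => ?_
    rw [neg_neg, Complex.exp_log]
    intro h
    have := hlt v
    rw [← sub_eq_zero.1 h] at this
    simp at this)
  rw [Complex.exp_neg, inv_mul_eq_one₀ (Complex.exp_ne_zero _)] at h4
  exact h4

lemma dedekindZeta_ne_zero {s : ℂ} (hs : 1 < s.re) : dedekindZeta K s ≠ 0 := by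
  rw [← exp_logZeta hs]
  exact Complex.exp_ne_zero _

end PrimeIdeals

section ZetaNonvanishing

open Filter Topology IsDedekindDomain

variable {K : Type*} [Field K] [NumberField K]

lemma re_unit_comb_nonneg {w : ℂ} (hw : ‖w‖ = 1) : 0 ≤ 3 + 4 * w.re + (w ^ 2).re := by
  have h1 : w.re * w.re + w.im * w.im = 1 := by
    have := Complex.normSq_eq_norm_sq w
    rw [hw, Complex.normSq_apply] at this
    linarith
  have h2 : (w ^ 2).re = w.re * w.re - w.im * w.im := by rw [sq, Complex.mul_re]
  rw [h2]
  nlinarith [sq_nonneg (1 + w.re)]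

lemma re_logZeta_comb_nonneg {x : ℝ} (hx : 1 < x) (t : ℝ) :
    0 ≤ 3 * (logZeta K x).re + 4 * (logZeta K (x + Complex.I * t)).re +
      (logZeta K (x + 2 * (Complex.I * t))).re := by
  have hx0 : 1 < (x : ℂ).re := by simpa
  have hx1 : 1 < (x + Complex.I * t : ℂ).re := by simpa
  have hx2 : 1 < (x + 2 * (Complex.I * t) : ℂ).re := by simpa
  have h := (((Complex.hasSum_re (summable_logZeta (K := K) hx0).hasSum).mul_left 3).add
    ((Complex.hasSum_re (summable_logZeta (K := K) hx1).hasSum).mul_left 4)).add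
    (Complex.hasSum_re (summable_logZeta (K := K) hx2).hasSum)
  refine h.nonneg fun q => ?_
  set N : ℕ := Ideal.absNorm q.1.asIdeal with hN
  have hNpos : 0 < N := by have := two_le_absNorm q.1; omega
  have hN0 : (N : ℂ) ≠ 0 := by exact_mod_cast hNpos.ne'
  set u : ℂ := ((N : ℂ) ^ (-(Complex.I * t))) ^ (q.2 + 1) with hu
  have hu1 : ‖u‖ = 1 := by
    rw [hu, norm_pow, Complex.norm_natCast_cpow_of_pos hNpos]
    simp
  set a : ℝ := ((N : ℝ) ^ (-x)) ^ (q.2 + 1) / (q.2 + 1) with ha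
  have ha0 : 0 ≤ a := by positivity
  have e0 : ((N : ℂ) ^ (-(x : ℂ))) ^ (q.2 + 1) / ((q.2 : ℂ) + 1) = (a : ℂ) := by
    rw [ha]; push_cast
    rw [Complex.ofReal_cpow (by positivity)]
    push_cast; rfl
  have e1 : ((N : ℂ) ^ (-(x + Complex.I * t : ℂ))) ^ (q.2 + 1) / ((q.2 : ℂ) + 1) = (a : ℂ) * u := by
    rw [← e0, neg_add, Complex.cpow_add _ _ hN0, mul_pow, hu]
    ring
  have e2 : ((N : ℂ) ^ (-(x + 2 * (Complex.I * t) : ℂ))) ^ (q.2 + 1) / ((q.2 : ℂ) + 1) =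
      (a : ℂ) * u ^ 2 := by
    rw [← e0, neg_add, Complex.cpow_add _ _ hN0, mul_pow, hu,
      show -(2 * (Complex.I * t)) = (2 : ℕ) * -(Complex.I * t) by push_cast; ring,
      Complex.cpow_nat_mul]
    ring
  rw [e0, e1, e2, Complex.re_ofReal_mul, Complex.re_ofReal_mul, Complex.ofReal_re]
  have := mul_nonneg ha0 (re_unit_comb_nonneg hu1)
  nlinarith

lemma norm_dedekindZeta {s : ℂ} (hs : 1 < s.re) :
    ‖dedekindZeta K s‖ = Real.exp (logZeta K s).re := by
  rw [← exp_logZeta hs, Complex.norm_exp]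

lemma one_le_norm_zeta_comb {x : ℝ} (hx : 1 < x) (t : ℝ) :
    1 ≤ ‖dedekindZeta K x‖ ^ 3 * ‖dedekindZeta K (x + Complex.I * t)‖ ^ 4 *
      ‖dedekindZeta K (x + 2 * (Complex.I * t))‖ := by
  rw [norm_dedekindZeta (by simpa), norm_dedekindZeta (by simpa), norm_dedekindZeta (by simpa),
    ← Real.exp_nat_mul, ← Real.exp_nat_mul, ← Real.exp_add, ← Real.exp_add, Real.one_le_exp_iff]
  exact_mod_cast re_logZeta_comb_nonneg hx t

lemma continuation_ne_zero_of_one_le_re {g : ℂ → ℂ} (hg : Differentiable ℂ g)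
    (h : ∀ s : ℂ, 1 < s.re → (s - 1) * dedekindZeta K s = g s) {s : ℂ} (hs : 1 ≤ s.re) :
    g s ≠ 0 := by
  rcases hs.lt_or_eq with hs | hs
  · rw [← h s hs]
    refine mul_ne_zero ?_ (dedekindZeta_ne_zero hs)
    intro h0
    rw [sub_eq_zero.1 h0] at hs
    simp at hs
  rcases eq_or_ne s.im 0 with h0 | h0
  · have hs1 : s = 1 := Complex.ext (by simp [← hs]) (by simp [h0])
    have h1 := tendsto_sub_one_mul_dedekindZeta_nhdsGT K
    have h2 : Tendsto (fun x : ℝ => g x) (𝓝[>] 1) (𝓝 (g 1)) := by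
      have : Continuous fun x : ℝ => g x := hg.continuous.comp Complex.continuous_ofReal
      have h3 := (this.tendsto 1).mono_left (nhdsWithin_le_nhds (s := Set.Ioi 1))
      simpa using h3
    have h3 := tendsto_nhds_unique (h2.congr' (by
      filter_upwards [self_mem_nhdsWithin] with x hx
      exact (h x (by simpa using hx)).symm)) h1
    rw [hs1, h3]
    exact_mod_cast dedekindZeta_residue_ne_zero K
  · intro hg0
    set t := s.im with ht
    have hs1 : s = 1 + Complex.I * t := Complex.ext (by simp [← hs]) (by simp [ht])
    have key : ∀ e : ℝ, 0 < e → |t| ^ 5 ≤ ‖g (1 + e)‖ ^ 3 * ‖(e : ℂ)⁻¹ * g (s + e)‖ ^ 3 *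
        ‖g (s + e)‖ * ‖g (1 + e + 2 * (Complex.I * t))‖ := by
      intro e he
      have h1 := one_le_norm_zeta_comb (K := K) (x := 1 + e) (by linarith) t
      have e1 := h (1 + e) (by simpa using he)
      have e2 := h (1 + e + Complex.I * t) (by simpa using he)
      have e3 := h (1 + e + 2 * (Complex.I * t)) (by simpa using he)
      rw [show s + e = 1 + e + Complex.I * t by rw [hs1]; ring, ← e1, ← e2, ← e3]
      push_cast at h1
      simp only [norm_mul, norm_inv, add_sub_cancel_left]
      rw [show (1 + (e : ℂ) + Complex.I * t - 1) = e + Complex.I * t by ring,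
        show (1 + (e : ℂ) + 2 * (Complex.I * t) - 1) = e + 2 * (Complex.I * t) by ring]
      have n0 : ‖(e : ℂ)‖ = e := by rw [Complex.norm_real, Real.norm_of_nonneg he.le]
      have n1 : |t| ≤ ‖(e : ℂ) + Complex.I * t‖ := by
        have := Complex.abs_im_le_norm ((e : ℂ) + Complex.I * t)
        simpa using this
      have n2 : |t| ≤ ‖(e : ℂ) + 2 * (Complex.I * t)‖ := by
        have := Complex.abs_im_le_norm ((e : ℂ) + 2 * (Complex.I * t))
        simp only [Complex.add_im, Complex.ofReal_im, zero_add] at this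
        refine le_trans ?_ this
        simp [abs_mul]
        linarith [abs_nonneg t]
      rw [n0]
      generalize ‖(e : ℂ) + Complex.I * t‖ = A at *
      generalize ‖(e : ℂ) + 2 * (Complex.I * t)‖ = B at *
      generalize ‖dedekindZeta K (1 + e)‖ = z1 at *
      generalize ‖dedekindZeta K (1 + e + Complex.I * t)‖ = z2 at *
      generalize ‖dedekindZeta K (1 + e + 2 * (Complex.I * t))‖ = z3 at *
      have ht0 := abs_nonneg t
      calc |t| ^ 5 = |t| ^ 4 * |t| * 1 := by ring
        _ ≤ A ^ 4 * B * (z1 ^ 3 * z2 ^ 4 * z3) := by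
            have := ht0.trans n1
            have := ht0.trans n2
            gcongr
        _ = _ := by field_simp
    have c1 : Tendsto (fun e : ℝ => ‖g (1 + e)‖ ^ 3) (𝓝[>] 0) (𝓝 (‖g 1‖ ^ 3)) := by
      have : Continuous fun e : ℝ => ‖g (1 + e)‖ ^ 3 := by
        have := hg.continuous; fun_prop
      have := (this.tendsto 0).mono_left (nhdsWithin_le_nhds (s := Set.Ioi 0))
      simpa using this
    have c2 : Tendsto (fun e : ℝ => ‖g (s + e)‖) (𝓝[>] 0) (𝓝 0) := by
      have : Continuous fun e : ℝ => ‖g (s + e)‖ := by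
        have := hg.continuous; fun_prop
      have := (this.tendsto 0).mono_left (nhdsWithin_le_nhds (s := Set.Ioi 0))
      simpa [hg0] using this
    have c3 : Tendsto (fun e : ℝ => ‖g (1 + e + 2 * (Complex.I * t))‖) (𝓝[>] 0)
        (𝓝 ‖g (1 + 2 * (Complex.I * t))‖) := by
      have : Continuous fun e : ℝ => ‖g (1 + e + 2 * (Complex.I * t))‖ := by
        have := hg.continuous; fun_prop
      have := (this.tendsto 0).mono_left (nhdsWithin_le_nhds (s := Set.Ioi 0))
      simpa using this
    have c4 : Tendsto (fun e : ℝ => ‖(e : ℂ)⁻¹ * g (s + e)‖ ^ 3) (𝓝[>] 0)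
        (𝓝 (‖deriv g s‖ ^ 3)) := by
      have hd := (hg s).hasDerivAt.tendsto_slope_zero
      have h3 : Tendsto (fun e : ℝ => (e : ℂ)) (𝓝[>] 0) (𝓝[≠] 0) := by
        refine tendsto_nhdsWithin_iff.2 ⟨?_, ?_⟩
        · have := (Complex.continuous_ofReal.tendsto 0).mono_left
            (nhdsWithin_le_nhds (s := Set.Ioi 0))
          simpa using this
        · filter_upwards [self_mem_nhdsWithin] with e he
          exact Complex.ofReal_ne_zero.2 (ne_of_gt he)
      have := ((hd.comp h3).norm).pow 3
      simpa [hg0] using this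
    have c := ((c1.mul c4).mul c2).mul c3
    rw [mul_zero, zero_mul] at c
    have := ge_of_tendsto c (by
      filter_upwards [self_mem_nhdsWithin] with e he using key e he)
    have : 0 < |t| ^ 5 := by positivity
    linarith

lemma exists_zetaReal_four_le : ∃ C : ℝ, 1 ≤ C ∧ ∀ (K : Type) [Field K] [NumberField K],
    zetaReal K 4 ≤ C ^ Module.finrank ℚ K := by
  have hs : Summable fun m : ℕ => (m : ℝ) ^ (-4 : ℝ) := Real.summable_nat_rpow.2 (by norm_num)
  refine ⟨Real.exp (2 * ∑' m : ℕ, (m : ℝ) ^ (-4 : ℝ)),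
    Real.one_le_exp (mul_nonneg zero_le_two (tsum_nonneg fun _ => by positivity)), ?_⟩
  intro K _ _
  have h4 : 1 < ((4 : ℝ) : ℂ).re := by norm_num
  have h1 : zetaReal K 4 = ‖dedekindZeta K (4 : ℝ)‖ := by
    rw [dedekindZeta_ofReal (by norm_num), Complex.norm_real, Real.norm_of_nonneg]
    exact tsum_nonneg fun _ => by positivity
  rw [h1, norm_dedekindZeta h4, ← Real.exp_nat_mul, Real.exp_le_exp]
  have hsum := summable_primePow (K := K) (s := 4) (by norm_num)
  calc (logZeta K (4 : ℝ)).re ≤ ‖logZeta K (4 : ℝ)‖ := Complex.re_le_norm _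
    _ ≤ ∑' q : HeightOneSpectrum (𝓞 K) × ℕ,
        ((Ideal.absNorm q.1.asIdeal : ℝ) ^ (-4 : ℝ)) ^ (q.2 + 1) := by
        refine tsum_of_norm_bounded hsum.hasSum fun q => ?_
        rw [norm_div, norm_pow, norm_prime_cpow, Complex.ofReal_re]
        refine div_le_self (by positivity) ?_
        rw [show ((q.2 : ℂ) + 1) = ((q.2 + 1 : ℕ) : ℂ) by push_cast; rfl, Complex.norm_natCast]
        push_cast
        linarith [Nat.cast_nonneg (α := ℝ) q.2]
    _ = ∑' v : HeightOneSpectrum (𝓞 K), ∑' i : ℕ,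
        ((Ideal.absNorm v.asIdeal : ℝ) ^ (-4 : ℝ)) ^ (i + 1) := hsum.tsum_prod
    _ ≤ ∑' v : HeightOneSpectrum (𝓞 K), 2 * (charOf v : ℝ) ^ (-4 : ℝ) := by
        refine hsum.prod.tsum_le_tsum (fun v => ?_) ((summable_charOf
          (u := fun m => (m : ℝ) ^ (-4 : ℝ)) (fun _ => by positivity) hs).mul_left 2)
        refine (tsum_pow_succ_le (by positivity)
          (prime_rpow_le_half (by norm_num) v)).2.trans ?_
        exact mul_le_mul_of_nonneg_left (absNorm_rpow_le (by norm_num) v) zero_le_two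
    _ ≤ _ := by
        rw [tsum_mul_left]
        have := tsum_charOf_le (K := K) (u := fun m => (m : ℝ) ^ (-4 : ℝ))
          (fun _ => by positivity) hs
        linarith

end ZetaNonvanishing

section LogCoefficients

open Filter Topology Metric

lemma hasFPowerSeriesOnBall_ofScalars_of_hasSum {u : ℕ → ℂ} {F : ℂ → ℂ}
    (h : ∀ z : ℂ, ‖z‖ < 1 → HasSum (fun k => u k * z ^ k) (F z)) :
    HasFPowerSeriesOnBall F (FormalMultilinearSeries.ofScalars ℂ u) 0 1 where
  r_le := by
    refine ENNReal.le_of_forall_nnreal_lt fun r hr => ?_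
    refine FormalMultilinearSeries.le_radius_of_tendsto (l := 0) _ ?_
    have hn : ‖(((r : ℝ)) : ℂ)‖ = r := by
      rw [Complex.norm_real]; exact Real.norm_of_nonneg r.2
    have hr' : ‖((r : ℝ) : ℂ)‖ < 1 := by
      rw [hn]
      exact_mod_cast hr
    have := (h _ hr').summable.tendsto_atTop_zero.norm
    simp only [norm_zero] at this
    refine this.congr fun k => ?_
    rw [FormalMultilinearSeries.ofScalars_norm, norm_mul, norm_pow, hn]
  r_pos := one_pos
  hasSum := by
    intro z hz
    rw [zero_add]
    have hz' : ‖z‖ < 1 := by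
      simpa [enorm_eq_nnnorm, ← NNReal.coe_lt_coe] using hz
    have := h z hz'
    simpa [FormalMultilinearSeries.ofScalars_apply_eq, mul_comm] using this

lemma coeff_eq_zero_of_hasSum_const {u : ℕ → ℂ} {c : ℂ}
    (h : ∀ z : ℂ, ‖z‖ < 1 → HasSum (fun k => u k * z ^ k) c) {k : ℕ} (hk : 1 ≤ k) : u k = 0 := by
  have h1 := (hasFPowerSeriesOnBall_ofScalars_of_hasSum h).hasFPowerSeriesAt
  have h2 : HasFPowerSeriesAt (fun _ : ℂ => c) (constFormalMultilinearSeries ℂ ℂ c) 0 :=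
    hasFPowerSeriesAt_const
  have h3 := h1.eq_formalMultilinearSeries h2
  rw [← FormalMultilinearSeries.ofScalars_eq_zero (E := ℂ) (𝕜 := ℂ), h3]
  exact constFormalMultilinearSeries_apply_of_nonzero (by omega)

/-- If `G` is zero-free and of size at most `exp M` on the disc of radius `3 / 2`, then the
Taylor coefficients of a logarithm of `G z / (1 - z)` are close to those of `-log (1 - z)`. -/
lemma norm_log_coeff_sub_le {G F : ℂ → ℂ} {c : ℕ → ℂ} {M : ℝ} (hM : 0 < M)
    (hG : DifferentiableOn ℂ G (ball 0 (3 / 2))) (hG0 : ∀ z ∈ ball (0 : ℂ) (3 / 2), G z ≠ 0)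
    (hGM : ∀ z ∈ ball (0 : ℂ) (3 / 2), ‖G z‖ ≤ Real.exp M) (h1 : 1 ≤ ‖G 0‖)
    (hF : ∀ z : ℂ, ‖z‖ < 1 → HasSum (fun k => c k * z ^ k) (F z))
    (hFG : ∀ z : ℂ, ‖z‖ < 1 → Complex.exp (F z) * (1 - z) = G z) {k : ℕ} (hk : 1 ≤ k) :
    ‖c k - 1 / k‖ ≤ 10 * M * (4 / 5) ^ k := by
  obtain ⟨h0, hh0⟩ := ((hG.deriv isOpen_ball).div hG hG0).isExactOn_ball
  set h : ℂ → ℂ := fun z => h0 z - h0 0 with hh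
  have hd : ∀ z ∈ ball (0 : ℂ) (3 / 2), HasDerivAt h (deriv G z / G z) z := fun z hz =>
    (hh0 z hz).sub_const _
  have hdiff : DifferentiableOn ℂ h (ball 0 (3 / 2)) := fun z hz =>
    (hd z hz).differentiableAt.differentiableWithinAt
  have hGd : ∀ z ∈ ball (0 : ℂ) (3 / 2), HasDerivAt G (deriv G z) z := fun z hz =>
    (hG.differentiableAt (isOpen_ball.mem_nhds hz)).hasDerivAt
  have hGh : ∀ z ∈ ball (0 : ℂ) (3 / 2), G z = G 0 * Complex.exp (h z) := by
    intro z hz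
    have key := (convex_ball (0 : ℂ) (3 / 2)).is_const_of_fderivWithin_eq_zero (𝕜 := ℂ)
      (f := fun z => G z * Complex.exp (-h z))
      (fun w hw => (((hGd w hw).mul ((hd w hw).neg.cexp)).differentiableAt).differentiableWithinAt)
      (fun w hw => by
        rw [fderivWithin_of_isOpen isOpen_ball hw]
        have hG0w := hG0 w hw
        have e : HasDerivAt (fun z => G z * Complex.exp (-h z)) 0 w := by
          have e0 := (hGd w hw).mul ((hd w hw).neg.cexp)
          rw [show deriv G w * Complex.exp ((-h) w) + G w * (Complex.exp ((-h) w) *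
            -(deriv G w / G w)) = 0 by field_simp; ring] at e0
          exact e0
        ext
        simp [e.hasFDerivAt.fderiv]) hz (mem_ball_self (by norm_num))
    simp only [hh, sub_self, neg_zero, Complex.exp_zero, mul_one] at key
    rw [← key, mul_assoc, ← Complex.exp_add]
    simp [hh]
  have hre : ∀ z ∈ ball (0 : ℂ) (3 / 2), (h z).re ≤ M := by
    intro z hz
    have h2 := hGM z hz
    rw [hGh z hz, norm_mul, Complex.norm_exp] at h2
    rw [← Real.exp_le_exp]
    refine le_trans ?_ h2
    exact le_mul_of_one_le_left (Real.exp_pos _).le h1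
  have hbound : ∀ z ∈ sphere (0 : ℂ) (5 / 4), ‖h z‖ ≤ 10 * M := by
    intro z hz
    have hz' : ‖z‖ = 5 / 4 := by simpa using hz
    have := Complex.borelCaratheodory_zero (z := z) hM hdiff (fun z hz => hre z hz) (by norm_num)
      (by simp [hz']; norm_num) (by simp [hh])
    rw [hz'] at this
    refine this.trans (le_of_eq ?_)
    ring
  have hcauchy := Complex.norm_iteratedDeriv_le_of_forall_mem_sphere_norm_le k (by norm_num)
    (DifferentiableOn.diffContOnCl (hdiff.mono (by
      rw [closure_ball _ (by norm_num)]
      exact closedBall_subset_ball (by norm_num)))) hbound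
  have hhsum : ∀ z : ℂ, ‖z‖ < 1 →
      HasSum (fun k : ℕ => ((k.factorial : ℂ)⁻¹ * iteratedDeriv k h 0) * z ^ k) (h z) := by
    intro z hz
    have := Complex.hasSum_taylorSeries_on_ball (f := h) (c := 0) (r := 3 / 2) (z := z)
      hdiff (by simp; linarith)
    simpa [mul_assoc, mul_comm, mul_left_comm] using this
  have hFd : DifferentiableOn ℂ F (ball 0 1) := by
    have := (hasFPowerSeriesOnBall_ofScalars_of_hasSum hF).differentiableOn
    rwa [← ENNReal.ofReal_one, eball_ofReal] at this
  set D : ℂ → ℂ := fun z => F z - h z - -Complex.log (1 - z) with hD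
  have hsub : ∀ z ∈ ball (0 : ℂ) 1, z ∈ ball (0 : ℂ) (3 / 2) := fun z hz =>
    ball_subset_ball (by norm_num) hz
  have hslit : ∀ z ∈ ball (0 : ℂ) 1, 1 - z ∈ Complex.slitPlane := fun z hz => by
    have := Complex.mem_slitPlane_of_norm_lt_one (z := -z) (by simpa using hz)
    simpa [sub_eq_add_neg] using this
  have hDd : DifferentiableOn ℂ D (ball 0 1) := by
    refine (hFd.sub (hdiff.mono hsub)).sub (DifferentiableOn.neg ?_)
    exact DifferentiableOn.clog (by fun_prop) hslit
  have hDexp : ∀ z ∈ ball (0 : ℂ) 1, Complex.exp (D z) = G 0 := by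
    intro z hz
    have hz1 : ‖z‖ < 1 := by simpa using hz
    have e := hFG z hz1
    rw [hGh z (hsub z hz)] at e
    simp only [hD, sub_neg_eq_add, Complex.exp_add, Complex.exp_sub]
    rw [Complex.exp_log (Complex.slitPlane_ne_zero (hslit z hz)), div_mul_eq_mul_div, e]
    exact mul_div_cancel_right₀ _ (Complex.exp_ne_zero _)
  have hDconst : ∀ z ∈ ball (0 : ℂ) 1, D z = D 0 := by
    intro z hz
    refine (convex_ball (0 : ℂ) 1).is_const_of_fderivWithin_eq_zero (𝕜 := ℂ) hDd
      (fun w hw => ?_) hz (mem_ball_self (by norm_num))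
    rw [fderivWithin_of_isOpen isOpen_ball hw]
    have hDw := (hDd.differentiableAt (isOpen_ball.mem_nhds hw)).hasDerivAt
    have e1 := hDw.cexp
    have e2 : HasDerivAt (fun z => Complex.exp (D z)) 0 w :=
      (hasDerivAt_const w (G 0)).congr_of_eventuallyEq (by
        filter_upwards [isOpen_ball.mem_nhds hw] with z hz using hDexp z hz)
    have e3 := e1.unique e2
    have e4 : deriv D w = 0 := (mul_eq_zero.1 e3).resolve_left (Complex.exp_ne_zero _)
    ext
    simp [hDw.hasFDerivAt.fderiv, e4]
  have hzero := coeff_eq_zero_of_hasSum_const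
    (u := fun k => c k - (k.factorial : ℂ)⁻¹ * iteratedDeriv k h 0 - 1 / k) (c := D 0)
    (fun z hz => by
      rw [← hDconst z (by simpa using hz)]
      have := ((hF z hz).sub (hhsum z hz)).sub (Complex.hasSum_taylorSeries_neg_log hz)
      refine (this.congr_fun fun k => ?_)
      ring) hk
  have hfact : (0 : ℝ) < k.factorial := by exact_mod_cast k.factorial_pos
  have e5 : c k - 1 / k = (k.factorial : ℂ)⁻¹ * iteratedDeriv k h 0 := by
    linear_combination hzero
  rw [e5, norm_mul, norm_inv, Complex.norm_natCast, inv_mul_le_iff₀ hfact]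
  refine hcauchy.trans (le_of_eq ?_)
  rw [show (4 / 5 : ℝ) = (5 / 4)⁻¹ by norm_num, inv_pow]
  ring

end LogCoefficients

section LogZetaTaylor

open Filter Topology IsDedekindDomain

variable {K : Type*} [Field K] [NumberField K]

lemma pow_div_factorial_le {c y : ℝ} (hc : 0 < c) (hy : 0 ≤ y) (k : ℕ) :
    y ^ k / k.factorial ≤ (c⁻¹) ^ k * Real.exp (c * y) := by
  have h := Real.pow_div_factorial_le_exp (c * y) (by positivity) k
  rw [inv_pow, ← div_eq_inv_mul, le_div_iff₀ (by positivity)]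
  refine le_trans (le_of_eq ?_) h
  rw [mul_pow]; ring

/-- The logarithm of the norm of a prime ideal power `v ^ (i + 1)`. -/
noncomputable def logNorm (q : HeightOneSpectrum (𝓞 K) × ℕ) : ℝ :=
  (q.2 + 1) * Real.log (Ideal.absNorm q.1.asIdeal)

lemma logNorm_nonneg (q : HeightOneSpectrum (𝓞 K) × ℕ) : 0 ≤ logNorm q :=
  mul_nonneg (by positivity) (Real.log_nonneg (by
    exact_mod_cast (le_trans one_le_two (two_le_absNorm q.1))))

lemma exp_neg_mul_logNorm (s : ℝ) (q : HeightOneSpectrum (𝓞 K) × ℕ) :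
    Real.exp (-(s * logNorm q)) = ((Ideal.absNorm q.1.asIdeal : ℝ) ^ (-s)) ^ (q.2 + 1) := by
  have : (0 : ℝ) < Ideal.absNorm q.1.asIdeal := by
    exact_mod_cast (lt_of_lt_of_le two_pos (two_le_absNorm q.1))
  rw [Real.rpow_def_of_pos this, ← Real.exp_nat_mul, logNorm]
  push_cast
  ring_nf

lemma cexp_neg_mul_logNorm (s : ℂ) (q : HeightOneSpectrum (𝓞 K) × ℕ) :
    Complex.exp (-(s * logNorm q)) = ((Ideal.absNorm q.1.asIdeal : ℂ) ^ (-s)) ^ (q.2 + 1) := by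
  have : (Ideal.absNorm q.1.asIdeal : ℂ) ≠ 0 := by
    exact_mod_cast (lt_of_lt_of_le two_pos (two_le_absNorm q.1)).ne'
  rw [Complex.cpow_def_of_ne_zero this, ← Complex.exp_nat_mul, logNorm, ← Complex.natCast_log]
  push_cast
  ring_nf

lemma summable_exp_logNorm {s : ℝ} (hs : 1 < s) :
    Summable fun q : HeightOneSpectrum (𝓞 K) × ℕ => Real.exp (-(s * logNorm q)) := by
  simp_rw [exp_neg_mul_logNorm]
  exact summable_primePow hs

/-- The terms of the `k`-th Taylor coefficient of `log ζ_K` at `2`. -/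
noncomputable def logCoeffTerm (k : ℕ) (q : HeightOneSpectrum (𝓞 K) × ℕ) : ℝ :=
  Real.exp (-(2 * logNorm q)) / (q.2 + 1) * (logNorm q ^ k / k.factorial)

lemma logCoeffTerm_nonneg (k : ℕ) (q : HeightOneSpectrum (𝓞 K) × ℕ) : 0 ≤ logCoeffTerm k q :=
  mul_nonneg (by positivity) (div_nonneg (pow_nonneg (logNorm_nonneg q) k) (by positivity))

lemma logCoeffTerm_le {c : ℝ} (hc : 0 < c) (k : ℕ) (q : HeightOneSpectrum (𝓞 K) × ℕ) :
    logCoeffTerm k q ≤ (c⁻¹) ^ k * Real.exp (-((2 - c) * logNorm q)) := by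
  calc logCoeffTerm k q ≤ Real.exp (-(2 * logNorm q)) * ((c⁻¹) ^ k * Real.exp (c * logNorm q)) := by
        refine mul_le_mul (div_le_self (Real.exp_pos _).le ?_)
          (pow_div_factorial_le hc (logNorm_nonneg q) k)
          (div_nonneg (pow_nonneg (logNorm_nonneg q) k) (by positivity)) (Real.exp_pos _).le
        linarith [Nat.cast_nonneg (α := ℝ) q.2]
    _ = _ := by
        rw [mul_left_comm, ← Real.exp_add]
        ring_nf

lemma summable_logCoeffTerm (k : ℕ) :
    Summable fun q : HeightOneSpectrum (𝓞 K) × ℕ => logCoeffTerm k q :=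
  Summable.of_nonneg_of_le (logCoeffTerm_nonneg k) (logCoeffTerm_le (c := 1 / 2) (by norm_num) k)
    ((summable_exp_logNorm (by norm_num)).mul_left _)

lemma hasSum_logZeta {z : ℂ} (hz : ‖z‖ < 1) :
    HasSum (fun k : ℕ => ((∑' q : HeightOneSpectrum (𝓞 K) × ℕ, logCoeffTerm k q : ℝ) : ℂ) * z ^ k)
      (logZeta K (2 - z)) := by
  set T : (HeightOneSpectrum (𝓞 K) × ℕ) × ℕ → ℂ := fun p => (logCoeffTerm p.2 p.1 : ℂ) * z ^ p.2
    with hT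
  have hre : 1 < (2 - z).re := by
    have := Complex.re_le_norm z
    rw [Complex.sub_re, Complex.re_ofNat]
    linarith
  have hexp : ∀ (w : ℝ) (q : HeightOneSpectrum (𝓞 K) × ℕ),
      HasSum (fun k : ℕ => logCoeffTerm k q * w ^ k)
        (Real.exp (-((2 - w) * logNorm q)) / (q.2 + 1)) := fun w q => by
    have := (NormedSpace.expSeries_div_hasSum_exp (𝔸 := ℝ) (w * logNorm q)).mul_left
      (Real.exp (-(2 * logNorm q)) / (q.2 + 1))
    rw [← Real.exp_eq_exp_ℝ, div_mul_eq_mul_div, ← Real.exp_add] at this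
    convert! this using 1
    · funext k
      rw [logCoeffTerm, mul_pow]; ring
    · ring_nf
  have hTs : Summable T := by
    refine Summable.of_norm ?_
    have hnorm : ∀ p, ‖T p‖ = logCoeffTerm p.2 p.1 * ‖z‖ ^ p.2 := fun p => by
      rw [hT, norm_mul, Complex.norm_real, Real.norm_of_nonneg (logCoeffTerm_nonneg _ _), norm_pow]
    simp_rw [hnorm]
    rw [summable_prod_of_nonneg fun p => mul_nonneg (logCoeffTerm_nonneg _ _) (by positivity)]
    refine ⟨fun q => (hexp ‖z‖ q).summable, ?_⟩
    simp_rw [fun q => (hexp ‖z‖ q).tsum_eq]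
    refine Summable.of_nonneg_of_le (fun q => by positivity) (fun q => ?_)
      (summable_exp_logNorm (K := K) (s := 2 - ‖z‖) (by linarith))
    refine div_le_self (Real.exp_pos _).le ?_
    linarith [Nat.cast_nonneg (α := ℝ) q.2]
  have hexpc : ∀ q : HeightOneSpectrum (𝓞 K) × ℕ, HasSum (fun k : ℕ => T (q, k))
      (((Ideal.absNorm q.1.asIdeal : ℂ) ^ (-(2 - z))) ^ (q.2 + 1) / (q.2 + 1)) := fun q => by
    have := (NormedSpace.expSeries_div_hasSum_exp (𝔸 := ℂ) (z * logNorm q)).mul_left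
      (Complex.exp (-(2 * logNorm q)) / (q.2 + 1))
    rw [← Complex.exp_eq_exp_ℂ, div_mul_eq_mul_div, ← Complex.exp_add] at this
    convert! this using 1
    · funext k
      simp only [hT, logCoeffTerm]
      push_cast
      rw [mul_pow]; ring
    · rw [← cexp_neg_mul_logNorm]
      ring_nf
  have h1 : HasSum T (logZeta K (2 - z)) := by
    have h2 := hTs.hasSum.prod_fiberwise hexpc
    have h3 := h2.unique (summable_logZeta hre).hasSum
    rw [← logZeta] at h3
    exact h3 ▸ hTs.hasSum
  have h2 : HasSum (fun p : ℕ × (HeightOneSpectrum (𝓞 K) × ℕ) => T p.swap) (logZeta K (2 - z)) :=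
    (Equiv.prodComm _ _).hasSum_iff.2 h1
  refine h2.prod_fiberwise fun k => ?_
  exact (Complex.hasSum_ofReal.2 (summable_logCoeffTerm k).hasSum).mul_right (z ^ k)

end LogZetaTaylor

section LogZetaMain

open Filter Topology IsDedekindDomain
open scoped Classical

/-- The weight attached to a prime `x` in the smoothed prime ideal count. -/
noncomputable def primeWeight (k : ℕ) (x : ℝ) : ℝ := k * (Real.log x ^ k / k.factorial) / x ^ 2

lemma exists_norm_logCoeff_sub_le : ∃ A : ℝ, 0 ≤ A ∧ ∀ (K : Type) [Field K] [NumberField K],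
    RHFor K → ∀ k : ℕ, 1 ≤ k →
      |∑' q : HeightOneSpectrum (𝓞 K) × ℕ, logCoeffTerm k q - 1 / k| ≤
        A * (Module.finrank ℚ K + Real.log |(discr K : ℝ)|) * (4 / 5) ^ k := by
  obtain ⟨A, hA, hcont⟩ := exists_zeta_continuation
  obtain ⟨C, hC, hzeta⟩ := exists_zetaReal_four_le
  refine ⟨10 * (Real.log A + Real.log C + 2), by
    have := Real.log_nonneg hA; have := Real.log_nonneg hC; positivity, ?_⟩
  intro K _ _ hRH k hk
  obtain ⟨g, hg, hgz, hgb⟩ := hcont K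
  have hD : 1 ≤ |(discr K : ℝ)| := one_le_abs_discr
  have hn : (1 : ℝ) ≤ Module.finrank ℚ K := by exact_mod_cast Module.finrank_pos
  set n := Module.finrank ℚ K
  set D := |(discr K : ℝ)|
  have hlA := Real.log_nonneg hA
  have hlC := Real.log_nonneg hC
  have hlD := Real.log_nonneg hD
  set M : ℝ := n * Real.log A + 2 * Real.log D + n * Real.log C + 1 with hM
  have hMexp : A ^ n * D ^ 2 * C ^ n ≤ Real.exp M := by
    rw [hM, Real.exp_add, Real.exp_add, Real.exp_add, Real.exp_nat_mul, Real.exp_nat_mul,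
      Real.exp_log (by linarith), Real.exp_log (by linarith),
      show (2 : ℝ) * Real.log D = (2 : ℕ) * Real.log D by norm_num, Real.exp_nat_mul,
      Real.exp_log (by linarith)]
    exact le_mul_of_one_le_right (by positivity) (Real.one_le_exp zero_le_one)
  have hzero : ∀ s : ℂ, ‖s - 2‖ < 3 / 2 → g s ≠ 0 := by
    intro s hs h0
    have hre : 1 / 2 < s.re := by
      have := (Complex.abs_re_le_norm (s - 2)).trans_lt hs
      rw [Complex.sub_re, Complex.re_ofNat] at this
      have := (abs_lt.1 this).1
      linarith
    rcases le_or_gt 1 s.re with h1 | h1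
    · exact continuation_ne_zero_of_one_le_re hg hgz h1 h0
    · have hDed : isDedekindZeta K fun s => g s / (s - 1) := by
        rw [isDedekindZeta_iff]
        refine ⟨fun w hw => (hg w).div (by fun_prop) (sub_ne_zero.2 hw), fun w hw => ?_⟩
        have hw1 : w - 1 ≠ 0 := by
          intro h
          rw [sub_eq_zero.1 h] at hw
          simp at hw
        rw [← hgz w hw, mul_div_cancel_left₀ _ hw1]
      have := hRH _ hDed s (by simp [h0]) (by linarith) h1
      linarith
  have hball : ∀ z ∈ Metric.ball (0 : ℂ) (3 / 2), ‖(2 - z) - 2‖ < 3 / 2 := fun z hz => by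
    simpa using hz
  have h2 : (1 : ℝ) < (2 : ℂ).re := by norm_num
  have key := norm_log_coeff_sub_le (G := fun z => g (2 - z)) (F := fun z => logZeta K (2 - z))
    (c := fun k => ((∑' q : HeightOneSpectrum (𝓞 K) × ℕ, logCoeffTerm k q : ℝ) : ℂ)) (M := M)
    (by positivity) (by have := hg.differentiableOn (s := Set.univ); fun_prop)
    (fun z hz => hzero _ (hball z hz))
    (fun z hz => (hgb _ (hball z hz).le).trans (le_trans (by gcongr; exact hzeta K) hMexp))
    (by
      have := hgz 2 h2
      simp only [sub_zero]
      rw [← this]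
      have h3 := dedekindZeta_ofReal (K := K) (s := 2) (by norm_num)
      have h4 := one_le_zetaReal (K := K) (s := 2) (by norm_num)
      norm_num at h3 ⊢
      rw [h3, Complex.norm_real]
      exact h4.trans (le_abs_self _))
    (fun z hz => hasSum_logZeta hz)
    (fun z hz => by
      have hre : 1 < (2 - z).re := by
        have := Complex.re_le_norm z
        rw [Complex.sub_re, Complex.re_ofNat]
        linarith
      rw [exp_logZeta hre, ← hgz _ hre]
      ring) hk
  have e : |∑' q : HeightOneSpectrum (𝓞 K) × ℕ, logCoeffTerm k q - 1 / k| =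
      ‖((∑' q : HeightOneSpectrum (𝓞 K) × ℕ, logCoeffTerm k q : ℝ) : ℂ) - 1 / k‖ := by
    rw [← Real.norm_eq_abs, ← Complex.norm_real]
    push_cast
    rfl
  rw [e]
  refine key.trans (mul_le_mul_of_nonneg_right ?_ (by positivity))
  rw [hM]
  nlinarith [mul_nonneg hlA hlD, mul_nonneg hlC hlD, mul_nonneg hlA (by linarith : (0:ℝ) ≤ n)]

variable {K : Type*} [Field K] [NumberField K]

lemma finite_absNorm_eq (m : ℕ) :
    {v : HeightOneSpectrum (𝓞 K) | Ideal.absNorm v.asIdeal = m}.Finite :=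
  Set.Finite.of_finite_image ((Ideal.finite_setOfPred_absNorm_eq (S := 𝓞 K) m).subset (by
    rintro _ ⟨v, hv, rfl⟩; exact hv)) fun v _ w _ h => HeightOneSpectrum.ext h

lemma mul_logCoeffTerm_zero (k : ℕ) (v : HeightOneSpectrum (𝓞 K)) :
    k * logCoeffTerm k (v, 0) = primeWeight k (Ideal.absNorm v.asIdeal) := by
  have : (0 : ℝ) < Ideal.absNorm v.asIdeal := by
    exact_mod_cast (lt_of_lt_of_le two_pos (two_le_absNorm v))
  rw [logCoeffTerm, exp_neg_mul_logNorm, primeWeight, logNorm, Real.rpow_neg this.le,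
    Real.rpow_two]
  simp
  ring

/-- Prime ideal powers other than the prime ideals of small prime norm contribute little. -/
lemma logCoeffTerm_le_of_not_small {k : ℕ} {q : HeightOneSpectrum (𝓞 K) × ℕ}
    (hq : ¬ (q.2 = 0 ∧ Ideal.absNorm q.1.asIdeal ∈ Nat.primesBelow (2 ^ (8 * k)))) :
    logCoeffTerm k q ≤
      (4 / 5) ^ k * ((charOf q.1 : ℝ) ^ (-(5 / 4) : ℝ) * ((2 : ℝ) ^ (-(1 / 4) : ℝ)) ^ q.2) := by
  obtain ⟨f, hf, -, hp, hN⟩ := charOf_spec q.1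
  set p := charOf q.1
  have hp2 : (2 : ℝ) ≤ p := by exact_mod_cast hp.two_le
  have hp0 : (0 : ℝ) < p := by linarith
  have hlN : logNorm q = (f * (q.2 + 1) : ℕ) * Real.log p := by
    rw [logNorm, hN]
    push_cast
    rw [Real.log_pow]; ring
  have hexp : ∀ s : ℝ, Real.exp (-(s * logNorm q)) = (p : ℝ) ^ (-(s * (f * (q.2 + 1) : ℕ))) := by
    intro s
    rw [hlN, Real.rpow_def_of_pos hp0]
    ring_nf
  by_cases h2 : 2 ≤ f * (q.2 + 1)
  · refine (logCoeffTerm_le (c := 5 / 4) (by norm_num) k q).trans ?_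
    rw [show ((5 / 4 : ℝ))⁻¹ = 4 / 5 by norm_num, hexp]
    refine mul_le_mul_of_nonneg_left ?_ (by positivity)
    have h3 : q.2 + 1 ≤ f * (q.2 + 1) := Nat.le_mul_of_pos_left _ hf
    set e := f * (q.2 + 1)
    have h2' : (2 : ℝ) ≤ e := by exact_mod_cast h2
    have h3' : (q.2 + 1 : ℝ) ≤ e := by exact_mod_cast h3
    calc (p : ℝ) ^ (-((2 - 5 / 4) * e) : ℝ) ≤ (p : ℝ) ^ (-(5 / 4) + -(1 / 4) * q.2 : ℝ) := by
          refine Real.rpow_le_rpow_of_exponent_le (by linarith) ?_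
          rcases Nat.lt_or_ge q.2 2 with h | h
          · have : (q.2 : ℝ) ≤ 1 := by exact_mod_cast Nat.le_of_lt_succ h
            linarith
          · have : (2 : ℝ) ≤ q.2 := by exact_mod_cast h
            linarith
      _ = (p : ℝ) ^ (-(5 / 4) : ℝ) * ((p : ℝ) ^ (-(1 / 4) : ℝ)) ^ q.2 := by
          rw [Real.rpow_add hp0, Real.rpow_mul hp0.le, Real.rpow_natCast]
      _ ≤ _ := by
          refine mul_le_mul_of_nonneg_left ?_ (by positivity)
          exact pow_le_pow_left₀ (by positivity)
            (Real.rpow_le_rpow_of_nonpos (by norm_num) hp2 (by norm_num)) _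
  · have hf1 : f = 1 := by nlinarith
    have hq0 : q.2 = 0 := by subst hf1; omega
    rw [hf1, pow_one] at hN
    have hY : 2 ^ (8 * k) ≤ p := by
      by_contra h
      refine hq ⟨hq0, ?_⟩
      rw [hN, Nat.mem_primesBelow]
      exact ⟨not_le.1 h, hp⟩
    have hY' : (2 : ℝ) ^ (8 * k) ≤ p := by exact_mod_cast hY
    refine (logCoeffTerm_le (c := 1 / 2) (by norm_num) k q).trans ?_
    rw [hexp, hf1, hq0, pow_zero, mul_one, show (-((2 - 1 / 2) * (1 * (0 + 1) : ℕ)) : ℝ) =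
      -(1 / 4) + -(5 / 4) by norm_num, Real.rpow_add hp0, ← mul_assoc]
    refine mul_le_mul_of_nonneg_right ?_ (by positivity)
    calc ((1 / 2 : ℝ)⁻¹) ^ k * (p : ℝ) ^ (-(1 / 4) : ℝ)
        ≤ ((1 / 2 : ℝ)⁻¹) ^ k * ((2 : ℝ) ^ (8 * k)) ^ (-(1 / 4) : ℝ) := by
          refine mul_le_mul_of_nonneg_left ?_ (by positivity)
          exact Real.rpow_le_rpow_of_nonpos (by positivity) hY' (by norm_num)
      _ = (1 / 2) ^ k := by
          rw [← Real.rpow_natCast 2 (8 * k), ← Real.rpow_mul (by norm_num)]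
          rw [show (((8 * k : ℕ) : ℝ) * -(1 / 4)) = -((2 * k : ℕ) : ℝ) by push_cast; ring,
            Real.rpow_neg (by norm_num), Real.rpow_natCast, pow_mul, ← inv_pow, ← mul_pow]
          norm_num
      _ ≤ (4 / 5) ^ k := pow_le_pow_left₀ (by norm_num) (by norm_num) k

lemma exists_tsum_sub_sum_le : ∃ A : ℝ, 0 ≤ A ∧ ∀ (K : Type) [Field K] [NumberField K] (k : ℕ),
    |k * ∑' q : HeightOneSpectrum (𝓞 K) × ℕ, logCoeffTerm k q -
      ∑ p ∈ Nat.primesBelow (2 ^ (8 * k)), primeWeight k p *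
        Nat.card {v : HeightOneSpectrum (𝓞 K) // Ideal.absNorm v.asIdeal = p}| ≤
      A * Module.finrank ℚ K * k * (4 / 5) ^ k := by
  have hr : (2 : ℝ) ^ (-(1 / 4) : ℝ) < 1 := Real.rpow_lt_one_of_one_lt_of_neg (by norm_num)
    (by norm_num)
  have hr0 : (0 : ℝ) ≤ (2 : ℝ) ^ (-(1 / 4) : ℝ) := by positivity
  set r : ℝ := (2 : ℝ) ^ (-(1 / 4) : ℝ) with hrdef
  have hs : Summable fun m : ℕ => (m : ℝ) ^ (-(5 / 4) : ℝ) := Real.summable_nat_rpow.2 (by norm_num)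
  have hgeo := summable_geometric_of_lt_one hr0 hr
  have hS0 : 0 ≤ ∑' m : ℕ, (m : ℝ) ^ (-(5 / 4) : ℝ) := tsum_nonneg fun _ => by positivity
  refine ⟨(∑' m : ℕ, (m : ℝ) ^ (-(5 / 4) : ℝ)) * (1 - r)⁻¹, mul_nonneg hS0 (by
    rw [inv_nonneg]; linarith), ?_⟩
  intro K _ _ k
  have hfin : {v : HeightOneSpectrum (𝓞 K) |
      Ideal.absNorm v.asIdeal ∈ Nat.primesBelow (2 ^ (8 * k))}.Finite := by
    refine ((Nat.primesBelow (2 ^ (8 * k))).finite_toSet.biUnion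
      fun p _ => finite_absNorm_eq (K := K) p).subset fun v hv => ?_
    simpa using hv
  set s : Finset (HeightOneSpectrum (𝓞 K) × ℕ) := hfin.toFinset.map
    ⟨fun v => (v, 0), Prod.mk_left_injective 0⟩ with hsdef
  have hsmem : ∀ q, q ∈ s ↔
      (q.2 = 0 ∧ Ideal.absNorm q.1.asIdeal ∈ Nat.primesBelow (2 ^ (8 * k))) := by
    rintro ⟨v, i⟩
    simp only [hsdef, Finset.mem_map, Set.Finite.mem_toFinset, Set.mem_ofPred_eq,
      Function.Embedding.coeFn_mk, Prod.mk.injEq]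
    constructor
    · rintro ⟨w, hw, h1, h2⟩; exact ⟨h2.symm, h1 ▸ hw⟩
    · rintro ⟨h0, hv⟩; exact ⟨v, hv, rfl, h0.symm⟩
  have hsum : k * ∑ q ∈ s, logCoeffTerm k q =
      ∑ p ∈ Nat.primesBelow (2 ^ (8 * k)), primeWeight k p *
        Nat.card {v : HeightOneSpectrum (𝓞 K) // Ideal.absNorm v.asIdeal = p} := by
    rw [hsdef, Finset.sum_map, Finset.mul_sum]
    simp only [Function.Embedding.coeFn_mk, mul_logCoeffTerm_zero]
    rw [← Finset.sum_fiberwise_of_maps_to (t := Nat.primesBelow (2 ^ (8 * k)))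
      (g := fun v : HeightOneSpectrum (𝓞 K) => Ideal.absNorm v.asIdeal)
      (fun v hv => by simpa using hv)]
    refine Finset.sum_congr rfl fun p hp => ?_
    rw [Finset.sum_congr rfl (g := fun _ => primeWeight k p)
      fun v hv => by rw [(Finset.mem_filter.1 hv).2], Finset.sum_const, nsmul_eq_mul, mul_comm]
    congr 2
    rw [Nat.subtype_card]
    intro v
    simp only [Finset.mem_filter, Set.Finite.mem_toFinset, Set.mem_ofPred_eq]
    exact ⟨fun h => h.2, fun h => ⟨h ▸ hp, h⟩⟩
  rw [← hsum, ← (summable_logCoeffTerm k).sum_add_tsum_compl (s := s), ← mul_sub,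
    add_sub_cancel_left, abs_mul, Nat.abs_cast, abs_of_nonneg (tsum_nonneg fun _ =>
    logCoeffTerm_nonneg _ _)]
  have hE0 : ∀ v : HeightOneSpectrum (𝓞 K), Summable fun i : ℕ =>
    (charOf v : ℝ) ^ (-(5 / 4) : ℝ) * r ^ i := fun v => hgeo.mul_left _
  have hcs := summable_charOf (K := K) (u := fun m => (m : ℝ) ^ (-(5 / 4) : ℝ))
          (fun _ => by positivity) hs
  have hE : Summable fun q : HeightOneSpectrum (𝓞 K) × ℕ =>
      (charOf q.1 : ℝ) ^ (-(5 / 4) : ℝ) * r ^ q.2 := by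
    rw [summable_prod_of_nonneg fun _ => by positivity]
    refine ⟨hE0, ?_⟩
    simp_rw [tsum_mul_left]
    exact hcs.mul_right _
  have hEsum : ∑' q : HeightOneSpectrum (𝓞 K) × ℕ, (charOf q.1 : ℝ) ^ (-(5 / 4) : ℝ) * r ^ q.2 ≤
      Module.finrank ℚ K * (∑' m : ℕ, (m : ℝ) ^ (-(5 / 4) : ℝ)) * (1 - r)⁻¹ := by
    rw [hE.tsum_prod]
    simp_rw [tsum_mul_left]
    rw [tsum_mul_right, tsum_geometric_of_lt_one hr0 hr]
    refine mul_le_mul_of_nonneg_right (tsum_charOf_le (K := K)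
      (u := fun m => (m : ℝ) ^ (-(5 / 4) : ℝ)) (fun _ => by positivity) hs) ?_
    rw [inv_nonneg]; linarith
  have hcompl : ∑' q : ↑((s : Set (HeightOneSpectrum (𝓞 K) × ℕ))ᶜ), logCoeffTerm k q.1 ≤
      (4 / 5) ^ k * ∑' q : HeightOneSpectrum (𝓞 K) × ℕ,
        (charOf q.1 : ℝ) ^ (-(5 / 4) : ℝ) * r ^ q.2 := by
    rw [← tsum_mul_left]
    have hE' := hE.mul_left ((4 / 5 : ℝ) ^ k)
    calc _ ≤ ∑' q : ↑((s : Set (HeightOneSpectrum (𝓞 K) × ℕ))ᶜ), (4 / 5 : ℝ) ^ k *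
        ((charOf (q : HeightOneSpectrum (𝓞 K) × ℕ).1 : ℝ) ^ (-(5 / 4) : ℝ) *
          r ^ (q : HeightOneSpectrum (𝓞 K) × ℕ).2) :=
          ((summable_logCoeffTerm k).subtype _).tsum_le_tsum (fun q =>
            logCoeffTerm_le_of_not_small fun h => q.2 ((hsmem q).2 h)) (hE'.subtype _)
      _ ≤ _ := hE'.tsum_subtype_le _ _ fun q => by positivity
  calc _ ≤ (k : ℝ) * ((4 / 5) ^ k *
        (Module.finrank ℚ K * (∑' m : ℕ, (m : ℝ) ^ (-(5 / 4) : ℝ)) * (1 - r)⁻¹)) := by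
        refine mul_le_mul_of_nonneg_left (hcompl.trans ?_) (Nat.cast_nonneg _)
        exact mul_le_mul_of_nonneg_left hEsum (by positivity)
    _ = _ := by ring

/-- An effective smoothed prime ideal theorem for prime ideals of prime norm. -/
theorem exists_weighted_prime_ideal_count : ∃ A : ℝ, 0 ≤ A ∧
    ∀ (K : Type) [Field K] [NumberField K], RHFor K → ∀ k : ℕ, 1 ≤ k →
      |∑ p ∈ Nat.primesBelow (2 ^ (8 * k)), primeWeight k p *
        Nat.card {v : HeightOneSpectrum (𝓞 K) // Ideal.absNorm v.asIdeal = p} - 1| ≤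
      A * (Module.finrank ℚ K + Real.log |(discr K : ℝ)|) * k * (4 / 5) ^ k := by
  obtain ⟨A, hA, h1⟩ := exists_norm_logCoeff_sub_le
  obtain ⟨B, hB, h2⟩ := exists_tsum_sub_sum_le
  refine ⟨A + B, by positivity, fun K _ _ hRH k hk => ?_⟩
  have e1 := h1 K hRH k hk
  have e2 := h2 K k
  have hk0 : (0 : ℝ) < k := by exact_mod_cast hk
  have hlD := Real.log_nonneg (one_le_abs_discr (K := K))
  generalize Real.log |(discr K : ℝ)| = D at *
  generalize (Module.finrank ℚ K : ℝ) = n at *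
  generalize ∑' q : HeightOneSpectrum (𝓞 K) × ℕ, logCoeffTerm k q = S at *
  generalize ∑ p ∈ Nat.primesBelow (2 ^ (8 * k)), primeWeight k p *
        (Nat.card {v : HeightOneSpectrum (𝓞 K) // Ideal.absNorm v.asIdeal = p} : ℝ) = W at *
  have e3 : |k * S - 1| ≤ k * (A * (n + D) * (4 / 5) ^ k) := by
    rw [show (k : ℝ) * S - 1 = k * (S - 1 / k) by field_simp, abs_mul, Nat.abs_cast]
    exact mul_le_mul_of_nonneg_left e1 hk0.le
  have e4 := abs_sub_le W (k * S) 1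
  rw [abs_sub_comm W (k * S)] at e4
  have : 0 ≤ B * D * k * (4 / 5) ^ k := by positivity
  calc |W - 1| ≤ B * n * k * (4 / 5) ^ k + k * (A * (n + D) * (4 / 5) ^ k) := by linarith
    _ ≤ _ := by linarith

end LogZetaMain

section Window

/-- The shift operator on integer sequences. -/
def seqShift : Module.End ℤ (ℕ → ℤ) where
  toFun y j := y (j + 1)
  map_add' _ _ := rfl
  map_smul' _ _ := rfl

theorem seqShift_pow_apply (n : ℕ) (y : ℕ → ℤ) (j : ℕ) : (seqShift ^ n) y j = y (j + n) := by
  induction n generalizing j with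
  | zero => simp
  | succ n ih =>
    rw [pow_succ', Module.End.mul_apply]
    show ((seqShift ^ n) y) (j + 1) = _
    rw [ih]
    congr 1
    ring

theorem aeval_seqShift_apply (T : ℤ[X]) (y : ℕ → ℤ) (j : ℕ) :
    aeval seqShift T y j = ∑ i ∈ T.support, T.coeff i * y (j + i) := by
  rw [aeval_eq_sum_range, LinearMap.sum_apply, Finset.sum_apply]
  simp only [LinearMap.smul_apply, Pi.smul_apply, seqShift_pow_apply, smul_eq_mul]
  symm
  refine Finset.sum_subset (fun i hi => ?_) fun i _ hi => ?_
  · exact Finset.mem_range_succ_iff.2 (le_natDegree_of_mem_supp i hi)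
  · rw [notMem_support_iff.1 hi, zero_mul]

/-- There is a nonzero polynomial with coefficients in `{-1, 0, 1}` vanishing at `a` mod `p`. -/
theorem exists_small_annihilator {p : ℕ} [Fact p.Prime] {l : ℕ} (hp : p < 2 ^ l) (a : ZMod p) :
    ∃ Q : ℤ[X], Q ≠ 0 ∧ (∀ i, |Q.coeff i| ≤ 1) ∧ (∀ i, l ≤ i → Q.coeff i = 0) ∧
      aeval a Q = 0 := by
  let F : (Fin l → Bool) → ℤ[X] := fun v => ∑ i : Fin l, C (if v i then 1 else 0) * X ^ (i : ℕ)
  have hF : ∀ v (i : ℕ), (F v).coeff i = if h : i < l then (if v ⟨i, h⟩ then 1 else 0) else 0 := by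
    intro v i
    simp only [F, finsetSum_coeff, coeff_C_mul, coeff_X_pow, mul_ite, mul_one, mul_zero]
    split_ifs with h hv
    · rw [Finset.sum_eq_single ⟨i, h⟩] <;> simp +contextual [Fin.ext_iff, hv, eq_comm]
    · rw [Finset.sum_eq_single ⟨i, h⟩] <;> simp +contextual [Fin.ext_iff, hv, eq_comm]
    · refine Finset.sum_eq_zero fun j _ => if_neg ?_
      have := j.2
      omega
  obtain ⟨v, w, hvw, h⟩ := Fintype.exists_ne_map_eq_of_card_lt (fun v => aeval a (F v))
    (by simpa [ZMod.card] using hp)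
  refine ⟨F v - F w, ?_, fun i => ?_, fun i hi => ?_, by rw [map_sub, sub_eq_zero]; exact h⟩
  · contrapose! hvw
    funext i
    have := congrArg (fun T => T.coeff (i : ℕ)) hvw
    simp only [coeff_sub, hF, i.2, dif_pos, coeff_zero] at this
    revert this
    cases v i <;> cases w i <;> simp
  · rw [coeff_sub, hF, hF]
    split_ifs <;> simp
  · rw [coeff_sub, hF, hF, dif_neg (by omega), dif_neg (by omega), sub_zero]

theorem exists_expand_eq_pow_add (Q : ℤ[X]) {q : ℕ} (hq : q.Prime) :
    ∃ R : ℤ[X], expand ℤ q Q = Q ^ q + C (q : ℤ) * R := by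
  have := Fact.mk hq
  have h : C (q : ℤ) ∣ expand ℤ q Q - Q ^ q := by
    rw [C_dvd_iff_dvd_coeff]
    intro i
    rw [← ZMod.intCast_zmod_eq_zero_iff_dvd, ← eq_intCast (Int.castRingHom (ZMod q)), ← coeff_map,
      Polynomial.map_sub, Polynomial.map_pow, map_expand, ZMod.expand_card, sub_self, coeff_zero]
  obtain ⟨R, hR⟩ := h
  exact ⟨R, by rw [← hR]; ring⟩

theorem exists_le_mul_valMinAbs {p : ℕ} [Fact p.Prime] {l B : ℕ} (hl : 1 ≤ l) (hp : p < 2 ^ l)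
    (hB : l ≤ ((Finset.range (B + 1)).filter fun q => q.Prime ∧ 2 * l ≤ q).card)
    {a ξ : ZMod p} (ha : a ≠ 0) (har : ∀ r, 1 ≤ r → r ≤ B → a ^ r ≠ 1) (hξ : ξ ≠ 0) :
    ∃ j < l * (l * B) + 1, (p : ℤ) ≤ l * |(ξ * a ^ j).valMinAbs| := by
  by_contra! hcon
  obtain ⟨Q, hQ0, hQ1, hQl, hQa⟩ := exists_small_annihilator hp a
  have hdeg : Q.natDegree < l := by
    by_contra! h
    exact hQ0 (leadingCoeff_eq_zero.1 (hQl _ h))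
  -- some Frobenius conjugate of `a` is not a root
  have hex : ∃ q, q.Prime ∧ 2 * l ≤ q ∧ q ≤ B ∧ aeval (a ^ q) Q ≠ 0 := by
    by_contra! hno
    have hQp : Q.map (Int.castRingHom (ZMod p)) ≠ 0 := by
      intro h
      apply hQ0
      ext i
      have h1 := congrArg (fun T => T.coeff i) h
      simp only [coeff_map, coeff_zero, Int.coe_castRingHom,
        ZMod.intCast_zmod_eq_zero_iff_dvd] at h1
      rw [coeff_zero]
      refine Int.eq_zero_of_abs_lt_dvd h1 ((hQ1 i).trans_lt ?_)
      exact_mod_cast (Fact.out : p.Prime).one_lt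
    have h2 := (Finset.card_le_card_of_injOn (s := (Finset.range (B + 1)).filter
      fun q => q.Prime ∧ 2 * l ≤ q) (t := (Q.map (Int.castRingHom (ZMod p))).roots.toFinset)
      (fun q => a ^ q) (fun q hq => ?_) ?_).trans
        ((Multiset.toFinset_card_le _).trans ((card_roots' _).trans natDegree_map_le))
    · omega
    · simp only [Finset.coe_filter, Finset.mem_range, Set.mem_ofPred_eq] at hq
      simp only [Finset.mem_coe, Multiset.mem_toFinset, mem_roots hQp, IsRoot.def, eval_map]
      have := hno q hq.2.1 hq.2.2 (by omega)
      rwa [aeval_def] at this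
    · have key : ∀ q r : ℕ, r ≤ B → q < r → a ^ q ≠ a ^ r := by
        intro q r hr hqr h
        refine har (r - q) (by omega) (by omega) ?_
        have : a ^ q * a ^ (r - q) = a ^ q * 1 := by
          rw [← pow_add, mul_one, Nat.add_sub_cancel' hqr.le, h]
        exact mul_left_cancel₀ (pow_ne_zero _ ha) this
      intro q hq r hr h
      simp only [Finset.coe_filter, Finset.mem_range, Set.mem_ofPred_eq] at hq hr
      rcases lt_trichotomy q r with h1 | h1 | h1
      · exact (key q r (by omega) h1 h).elim
      · exact h1
      · exact (key r q (by omega) h1 h.symm).elim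
  obtain ⟨q, hq, hlq, hqB, hQq⟩ := hex
  obtain ⟨R, hR⟩ := exists_expand_eq_pow_add Q hq
  have hq0 : 0 < q := hq.pos
  have hRa : (q : ZMod p) * aeval a R = aeval (a ^ q) Q := by
    have h1 : aeval a (expand ℤ q Q) = aeval (a ^ q) Q := expand_aeval q Q a
    rw [← h1, hR]
    simp [hQa, hq0.ne']
  have hRa0 : aeval a R ≠ 0 := by
    intro h
    rw [h, mul_zero] at hRa
    exact hQq hRa.symm
  have hRdeg : R.natDegree ≤ q * (l - 1) := by
    have h1 : C (q : ℤ) * R = expand ℤ q Q - Q ^ q := by rw [hR]; ring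
    rw [← natDegree_C_mul (a := (q : ℤ)) (by exact_mod_cast hq0.ne'), h1]
    refine (natDegree_sub_le _ _).trans (max_le ?_ ?_)
    · rw [natDegree_expand, mul_comm]; exact Nat.mul_le_mul_left _ (by omega)
    · exact natDegree_pow_le.trans (Nat.mul_le_mul_left _ (by omega))
  have hlq' : q * (l - 1) + l ≤ l * B := by
    obtain ⟨m, rfl⟩ : ∃ m, l = m + 1 := ⟨l - 1, by omega⟩
    simp only [Nat.add_sub_cancel]
    nlinarith
  have hcast : ∀ (y : ℕ → ℤ) (η : ZMod p) (T : ℤ[X]) (j : ℕ),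
      (∀ i ∈ T.support, (y (j + i) : ZMod p) = η * a ^ (j + i)) →
      ((aeval seqShift T y j : ℤ) : ZMod p) = η * aeval a T * a ^ j := by
    intro y η T j h
    rw [aeval_seqShift_apply, aeval_eq_sum_range, Int.cast_sum]
    rw [← Finset.sum_subset (s₁ := T.support) (s₂ := Finset.range (T.natDegree + 1))
      (fun i hi => Finset.mem_range_succ_iff.2 (le_natDegree_of_mem_supp i hi))
      (fun i _ hi => by rw [notMem_support_iff.1 hi, zero_smul]), Finset.mul_sum, Finset.sum_mul]
    refine Finset.sum_congr rfl fun i hi => ?_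
    rw [Int.cast_mul, h i hi, pow_add, zsmul_eq_mul]
    ring
  have hcardQ : Q.support.card ≤ l := by
    refine (Finset.card_le_card (t := Finset.range l) fun i hi => ?_).trans_eq (Finset.card_range l)
    rw [Finset.mem_range]
    by_contra! h
    exact mem_support_iff.1 hi (hQl i h)
  have hlpos : (0 : ℤ) < l := by exact_mod_cast hl
  have key : ∀ n ≤ l, ∃ (η : ZMod p) (y : ℕ → ℤ), η ≠ 0 ∧ ∀ j < (l - n) * (l * B) + 1,
      (y j : ZMod p) = η * a ^ j ∧ (l : ℤ) * 2 ^ n * |y j| < p := by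
    intro n
    induction n with
    | zero =>
      intro _
      exact ⟨ξ, fun j => (ξ * a ^ j).valMinAbs, hξ, fun j hj =>
        ⟨ZMod.coe_valMinAbs _, by simpa using hcon j (by simpa using hj)⟩⟩
    | succ n ih =>
      intro hn
      obtain ⟨η, y, hη, hy⟩ := ih (by omega)
      have hwin : (l - (n + 1)) * (l * B) + 1 + l * B = (l - n) * (l * B) + 1 := by
        obtain ⟨m, hm⟩ : ∃ m, l - n = m + 1 := ⟨l - n - 1, by omega⟩
        rw [hm, show l - (n + 1) = m by omega]
        ring
      have hsmall : ∀ (S : Finset ℕ) (c : ℕ → ℤ) (m : ℕ → ℕ), S.card ≤ l → (∀ i ∈ S, |c i| ≤ 1) →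
          (∀ i ∈ S, m i < (l - n) * (l * B) + 1) → 2 ^ n * |∑ i ∈ S, c i * y (m i)| < p := by
        intro S c m hS hc hm
        have hb : ∀ i ∈ S, (l : ℤ) * (2 ^ n * |c i * y (m i)|) ≤ p - 1 := by
          intro i hi
          rw [abs_mul]
          have := (hy (m i) (hm i hi)).2
          have h3 : |c i| * |y (m i)| ≤ |y (m i)| := mul_le_of_le_one_left (abs_nonneg _) (hc i hi)
          have h4 : (l : ℤ) * (2 ^ n * (|c i| * |y (m i)|)) ≤ l * (2 ^ n * |y (m i)|) := by gcongr
          linarith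
        have h5 := Finset.sum_le_sum hb
        rw [← Finset.mul_sum, ← Finset.mul_sum, Finset.sum_const, nsmul_eq_mul] at h5
        have h6 := Finset.abs_sum_le_sum_abs (fun i => c i * y (m i)) S
        have h7 : (l : ℤ) * (2 ^ n * |∑ i ∈ S, c i * y (m i)|) ≤ l * (p - 1) := by
          refine le_trans (b := (l : ℤ) * (2 ^ n * ∑ i ∈ S,
            |c i * y (m i)|)) (by gcongr) (h5.trans ?_)
          have : (1 : ℤ) ≤ p := by exact_mod_cast (Fact.out : p.Prime).one_lt.le
          exact mul_le_mul_of_nonneg_right (by exact_mod_cast hS) (by linarith)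
        have := le_of_mul_le_mul_left h7 hlpos
        linarith
      -- the sequence satisfies an exact linear recurrence
      have hrec : ∀ j, j + l ≤ (l - n) * (l * B) + 1 → aeval seqShift Q y j = 0 := by
        intro j hj
        have hi : ∀ i ∈ Q.support, j + i < (l - n) * (l * B) + 1 := fun i hi => by
          have := le_natDegree_of_mem_supp i hi
          omega
        have h1 := hcast y η Q j fun i h => (hy _ (hi i h)).1
        rw [hQa, mul_zero, zero_mul, ZMod.intCast_zmod_eq_zero_iff_dvd] at h1
        refine Int.eq_zero_of_abs_lt_dvd h1 ?_
        rw [aeval_seqShift_apply]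
        have h2 := hsmall Q.support Q.coeff (fun i => j + i) hcardQ (fun i _ => hQ1 i) hi
        refine lt_of_le_of_lt (le_mul_of_one_le_left (abs_nonneg _) ?_) h2
        exact one_le_pow₀ (by norm_num)
      refine ⟨η * aeval a R, aeval seqShift R y, mul_ne_zero hη hRa0, fun j hj => ⟨?_, ?_⟩⟩
      · refine hcast y η R j fun i hi => (hy _ ?_).1
        have := le_natDegree_of_mem_supp i hi
        omega
      · have h1 : aeval seqShift (Q ^ q) y j = 0 := by
          rw [← pow_sub_one_mul hq0.ne' Q, map_mul, Module.End.mul_apply,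
            aeval_seqShift_apply]
          refine Finset.sum_eq_zero fun i hi => ?_
          have h2 := le_natDegree_of_mem_supp i hi
          have h3 : (Q ^ (q - 1)).natDegree ≤ (q - 1) * (l - 1) :=
            natDegree_pow_le.trans (Nat.mul_le_mul_left _ (by omega))
          have h4 : (q - 1) * (l - 1) ≤ q * (l - 1) := Nat.mul_le_mul_right _ (by omega)
          rw [hrec _ (by omega), mul_zero]
        have h2 : aeval seqShift (expand ℤ q Q) y j = q * aeval seqShift R y j := by
          rw [hR, map_add, map_mul, LinearMap.add_apply, Pi.add_apply, h1, zero_add, aeval_C]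
          simp [Module.End.mul_apply]
        have h3 : aeval seqShift (expand ℤ q Q) y j =
          ∑ i ∈ Q.support, Q.coeff i * y (j + i * q) := by
          rw [expand_eq_sum, Polynomial.sum_def, map_sum, LinearMap.sum_apply, Finset.sum_apply]
          refine Finset.sum_congr rfl fun i _ => ?_
          rw [map_mul, aeval_C, ← pow_mul, map_pow, aeval_X]
          simp [Module.End.mul_apply, seqShift_pow_apply, mul_comm]
        have h4 := hsmall Q.support Q.coeff (fun i => j + i * q) hcardQ (fun i _ => hQ1 i)
          fun i hi => by
            have h5 : i ≤ l - 1 := by have := le_natDegree_of_mem_supp i hi; omega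
            have h6 : i * q ≤ q * (l - 1) := by rw [mul_comm]; exact Nat.mul_le_mul_left _ h5
            omega
        rw [← h3, h2, abs_mul, Nat.abs_cast] at h4
        refine lt_of_le_of_lt ?_ h4
        have h7 : ((2 * l : ℕ) : ℤ) ≤ q := by exact_mod_cast hlq
        push_cast at h7
        calc (l : ℤ) * 2 ^ (n + 1) * |aeval seqShift R y j|
            = 2 ^ n * (2 * l * |aeval seqShift R y j|) := by ring
          _ ≤ _ := by gcongr
  obtain ⟨η, y, hη, hy⟩ := key l le_rfl
  obtain ⟨h1, h2⟩ := hy 0 (by simp)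
  have h3 : |y 0| = 0 := by
    by_contra h
    have h4 : 1 ≤ |y 0| := by have := abs_nonneg (y 0); omega
    have h5 : (p : ℤ) < 2 ^ l := by exact_mod_cast hp
    have h6 : (2 : ℤ) ^ l ≤ l * 2 ^ l * |y 0| := by
      have : (1 : ℤ) ≤ l * |y 0| := by nlinarith
      nlinarith [pow_pos (show (0:ℤ) < 2 by norm_num) l]
    linarith
  rw [abs_eq_zero.1 h3] at h1
  simp at h1
  exact hη h1.symm

end Window

section Fourier

theorem addChar_map_sum {ι A M : Type*} [AddCommMonoid A] [CommMonoid M] (ψ : AddChar A M)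
    (s : Finset ι) (f : ι → A) : ψ (∑ i ∈ s, f i) = ∏ i ∈ s, ψ (f i) := by
  classical
  induction s using Finset.induction_on with
  | empty => simp
  | insert i s hi ih => rw [Finset.sum_insert hi, Finset.prod_insert hi, AddChar.map_add_eq_mul, ih]

theorem norm_one_add_exp_mul_I_le {θ δ : ℝ} (hδ : 0 ≤ δ) (h1 : 2 * Real.pi * δ ≤ |θ|)
    (h2 : |θ| ≤ Real.pi) :
    ‖1 + Complex.exp (θ * Complex.I)‖ ≤ 2 * Real.exp (-2 * δ ^ 2) := by
  have hsq : ‖1 + Complex.exp (θ * Complex.I)‖ ^ 2 = 2 + 2 * Real.cos θ := by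
    rw [← Complex.normSq_eq_norm_sq, Complex.exp_mul_I, Complex.normSq_apply]
    simp only [Complex.add_re, Complex.one_re, Complex.mul_re, Complex.I_re, Complex.I_im,
      Complex.add_im, Complex.one_im, Complex.mul_im, Complex.cos_ofReal_re,
      Complex.sin_ofReal_re, Complex.cos_ofReal_im, Complex.sin_ofReal_im]
    nlinarith [Real.sin_sq_add_cos_sq θ]
  have hcos := Real.cos_le_one_sub_mul_cos_sq h2
  have hpi := Real.pi_pos
  have h3 : 8 * δ ^ 2 ≤ 2 / Real.pi ^ 2 * θ ^ 2 := by
    rw [div_mul_eq_mul_div, le_div_iff₀ (by positivity), ← sq_abs θ]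
    calc 8 * δ ^ 2 * Real.pi ^ 2 = 2 * (2 * Real.pi * δ) ^ 2 := by ring
      _ ≤ 2 * |θ| ^ 2 := by gcongr
  have h4 : 1 - 4 * δ ^ 2 ≤ Real.exp (-4 * δ ^ 2) := by
    have := Real.add_one_le_exp (-4 * δ ^ 2)
    linarith
  have h5 : Real.exp (-2 * δ ^ 2) ^ 2 = Real.exp (-4 * δ ^ 2) := by
    rw [← Real.exp_nat_mul]
    congr 1
    push_cast
    ring
  refine le_of_sq_le_sq ?_ (by positivity)
  rw [hsq, mul_pow, h5]
  linarith

theorem norm_one_add_stdAddChar_le {p : ℕ} [NeZero p] (x : ZMod p) {δ : ℝ} (hδ : 0 ≤ δ)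
    (h : δ * p ≤ |(x.valMinAbs : ℝ)|) :
    ‖1 + ZMod.stdAddChar x‖ ≤ 2 * Real.exp (-2 * δ ^ 2) := by
  have hp : (0 : ℝ) < p := by exact_mod_cast NeZero.pos p
  have hpi := Real.pi_pos
  have hx : ZMod.stdAddChar x =
      Complex.exp ((2 * Real.pi * x.valMinAbs / p : ℝ) * Complex.I) := by
    conv_lhs => rw [← ZMod.coe_valMinAbs x]
    rw [ZMod.stdAddChar_coe]
    congr 1
    push_cast
    ring
  have habs : |2 * Real.pi * x.valMinAbs / p| = 2 * Real.pi * (|(x.valMinAbs : ℝ)| / p) := by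
    rw [abs_div, abs_mul, abs_mul, abs_two, abs_of_pos hpi, abs_of_pos hp]
    ring
  rw [hx]
  refine norm_one_add_exp_mul_I_le hδ ?_ ?_
  · rw [habs]
    have : δ ≤ |(x.valMinAbs : ℝ)| / p := (le_div_iff₀ hp).2 h
    gcongr
  · rw [habs]
    have h1 := ZMod.natAbs_valMinAbs_le x
    have h2 : |(x.valMinAbs : ℝ)| ≤ p / 2 := by
      rw [← Int.cast_abs, Int.abs_eq_natAbs, Int.cast_natCast, le_div_iff₀ two_pos]
      exact_mod_cast (by omega : x.valMinAbs.natAbs * 2 ≤ p)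
    have h3 : |(x.valMinAbs : ℝ)| / p ≤ 1 / 2 := by
      rw [div_le_iff₀ hp]; linarith
    nlinarith

theorem norm_prod_one_add_stdAddChar_le {p : ℕ} [Fact p.Prime] {a : ZMod p} (ha : a ≠ 0) {δ : ℝ}
    (hδ : 0 ≤ δ) {L : ℕ}
    (hwin : ∀ ξ : ZMod p, ξ ≠ 0 → ∃ j < L, δ * p ≤ |((ξ * a ^ j).valMinAbs : ℝ)|) (W : ℕ) :
    ∀ ξ : ZMod p, ξ ≠ 0 → ∀ n, W * L ≤ n →
      ∏ i ∈ Finset.range n, ‖1 + ZMod.stdAddChar (ξ * a ^ i)‖ ≤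
        2 ^ n * Real.exp (-2 * δ ^ 2) ^ W := by
  have htriv : ∀ x : ZMod p, ‖1 + ZMod.stdAddChar x‖ ≤ 2 := fun x =>
    (norm_add_le _ _).trans (by simp; norm_num)
  have htriv' : ∀ (s : Finset ℕ) (ξ : ZMod p),
      ∏ i ∈ s, ‖1 + ZMod.stdAddChar (ξ * a ^ i)‖ ≤ 2 ^ s.card := fun s ξ =>
    (Finset.prod_le_prod (fun _ _ => norm_nonneg _) fun _ _ => htriv _).trans
      (by rw [Finset.prod_const])
  induction W with
  | zero =>
    intro ξ _ n _
    rw [pow_zero, mul_one]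
    exact (htriv' _ _).trans (by simp)
  | succ W ih =>
    intro ξ hξ n hn
    obtain ⟨m, rfl⟩ : ∃ m, n = L + m := ⟨n - L, by rw [add_mul] at hn; omega⟩
    rw [Finset.prod_range_add]
    have h1 : ∏ i ∈ Finset.range L, ‖1 + ZMod.stdAddChar (ξ * a ^ i)‖ ≤
        2 ^ L * Real.exp (-2 * δ ^ 2) := by
      obtain ⟨j, hj, hjp⟩ := hwin ξ hξ
      rw [← Finset.mul_prod_erase _ _ (Finset.mem_range.2 hj)]
      have h2 := norm_one_add_stdAddChar_le _ hδ hjp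
      have h3 : ∏ i ∈ (Finset.range L).erase j, ‖1 + ZMod.stdAddChar (ξ * a ^ i)‖ ≤ 2 ^ (L - 1) :=
        (htriv' _ _).trans
          (by rw [Finset.card_erase_of_mem (Finset.mem_range.2 hj), Finset.card_range])
      calc _ ≤ (2 * Real.exp (-2 * δ ^ 2)) * 2 ^ (L - 1) := by gcongr
        _ = 2 ^ (L - 1 + 1) * Real.exp (-2 * δ ^ 2) := by ring
        _ = _ := by rw [Nat.sub_add_cancel (by omega)]
    have h2 := ih (ξ * a ^ L) (mul_ne_zero hξ (pow_ne_zero _ ha)) m (by rw [add_mul] at hn; omega)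
    simp_rw [mul_assoc, ← pow_add] at h2
    calc _ ≤ (2 ^ L * Real.exp (-2 * δ ^ 2)) * (2 ^ m * Real.exp (-2 * δ ^ 2) ^ W) := by gcongr
      _ = _ := by ring

theorem card_root_zeroOnePoly_le {p : ℕ} [Fact p.Prime] {a : ZMod p} (ha : a ≠ 0) {δ : ℝ}
    (hδ : 0 ≤ δ) {L W d : ℕ}
    (hwin : ∀ ξ : ZMod p, ξ ≠ 0 → ∃ j < L, δ * p ≤ |((ξ * a ^ j).valMinAbs : ℝ)|)
    (hWL : W * L ≤ d - 1) :
    (Nat.card {v : Fin (d - 1) → Bool // aeval a (zeroOnePoly d v) = 0} : ℝ) ≤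
      2 ^ (d - 1) * (1 / p + Real.exp (-2 * δ ^ 2) ^ W) := by
  classical
  have hp : (0 : ℝ) < p := by exact_mod_cast (Fact.out : p.Prime).pos
  set ψ : AddChar (ZMod p) ℂ := ZMod.stdAddChar with hψ
  have hval : ∀ v : Fin (d - 1) → Bool, aeval a (zeroOnePoly d v) =
      a ^ d + 1 + ∑ i : Fin (d - 1), (if v i then a ^ ((i : ℕ) + 1) else 0) := by
    intro v
    simp only [zeroOnePoly, map_add, map_sum, map_mul, map_pow, aeval_X, map_one, aeval_C]
    congr 1
    refine Finset.sum_congr rfl fun i _ => ?_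
    split_ifs <;> simp
  have hchar : ∀ x : ZMod p, ∑ ξ : ZMod p, ψ (ξ * x) = if x = 0 then (p : ℂ) else 0 := by
    intro x
    have := AddChar.sum_mulShift x (ZMod.isPrimitive_stdAddChar p)
    rw [ZMod.card] at this
    rw [hψ, this]
    split_ifs <;> simp
  have hprod : ∀ ξ : ZMod p, ∑ v : Fin (d - 1) → Bool, ψ (ξ * aeval a (zeroOnePoly d v)) =
      ψ (ξ * (a ^ d + 1)) * ∏ i : Fin (d - 1), (1 + ψ (ξ * a * a ^ (i : ℕ))) := by
    intro ξ
    have h1 : ∀ i : Fin (d - 1), 1 + ψ (ξ * a * a ^ (i : ℕ)) =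
        ∑ b : Bool, if b then ψ (ξ * a * a ^ (i : ℕ)) else 1 := by
      intro i; simp [add_comm]
    simp_rw [h1]
    rw [Finset.prod_univ_sum, Finset.mul_sum, Fintype.piFinset_univ]
    refine Finset.sum_congr rfl fun v _ => ?_
    rw [hval, mul_add, AddChar.map_add_eq_mul, Finset.mul_sum, addChar_map_sum]
    congr 1
    refine Finset.prod_congr rfl fun i _ => ?_
    split_ifs
    · rw [pow_succ']; ring_nf
    · simp
  have htot : ((p : ℂ) * Nat.card {v : Fin (d - 1) → Bool // aeval a (zeroOnePoly d v) = 0}) =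
      ∑ ξ : ZMod p, ψ (ξ * (a ^ d + 1)) * ∏ i : Fin (d - 1), (1 + ψ (ξ * a * a ^ (i : ℕ))) := by
    simp_rw [← hprod]
    rw [Finset.sum_comm]
    simp_rw [hchar]
    rw [← Finset.sum_filter, Finset.sum_const, nsmul_eq_mul, mul_comm, Nat.card_eq_fintype_card,
      Fintype.card_subtype]
  have hnorm : ∀ ξ : ZMod p, ‖ψ (ξ * (a ^ d + 1)) *
      ∏ i : Fin (d - 1), (1 + ψ (ξ * a * a ^ (i : ℕ)))‖ ≤
      (if ξ = 0 then 2 ^ (d - 1) else 0) + 2 ^ (d - 1) * Real.exp (-2 * δ ^ 2) ^ W := by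
    intro ξ
    rw [norm_mul, AddChar.norm_apply, one_mul, norm_prod,
      Fin.prod_univ_eq_prod_range (fun i => ‖1 + ψ (ξ * a * a ^ i)‖)]
    split_ifs with h
    · subst h
      simp only [zero_mul, AddChar.map_zero_eq_one, Finset.prod_const, Finset.card_range]
      norm_num
      positivity
    · rw [zero_add]
      exact norm_prod_one_add_stdAddChar_le ha hδ hwin W _ (mul_ne_zero h ha) _ hWL
  have hfin := (norm_sum_le Finset.univ _).trans (Finset.sum_le_sum fun ξ _ => hnorm ξ)
  rw [← htot, Finset.sum_add_distrib, Finset.sum_ite_eq' Finset.univ, if_pos (Finset.mem_univ _),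
    Finset.sum_const, Finset.card_univ, ZMod.card, nsmul_eq_mul, norm_mul, Complex.norm_natCast,
    Complex.norm_natCast] at hfin
  rw [← mul_le_mul_iff_right₀ hp]
  refine hfin.trans_eq ?_
  field_simp

end Fourier

section PowerBasisDiscr

open IsDedekindDomain

variable {K : Type} [Field K] [NumberField K]

theorem discr_powerBasis_eq_sq_mul (B : PowerBasis ℚ K) (hB : IsIntegral ℤ B.gen) :
    ∃ r : ℤ, r ≠ 0 ∧ Algebra.discr ℚ B.basis = ((r ^ 2 * discr K : ℤ) : ℚ) := by
  classical
  set ib := integralBasis K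
  set b := B.basis.reindex (B.basis.indexEquiv ib) with hb
  have hbd : Algebra.discr ℚ b = Algebra.discr ℚ B.basis := by
    rw [hb, Module.Basis.coe_reindex, Algebra.discr_reindex]
  have hent : ∀ i j, IsIntegral ℤ (ib.toMatrix b i j) := by
    intro i j
    have hinteg : IsIntegral ℤ (b j) := by
      rw [hb, Module.Basis.reindex_apply, PowerBasis.basis_eq_pow]
      exact hB.pow _
    rw [Module.Basis.toMatrix_apply]
    have := integralBasis_repr_apply K (⟨b j, hinteg⟩ : 𝓞 K) i
    rw [show (algebraMap (𝓞 K) K) ⟨b j, hinteg⟩ = b j from rfl] at this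
    rw [this]
    exact isIntegral_algebraMap
  obtain ⟨r, hr⟩ := IsIntegrallyClosed.isIntegral_iff.1
    (IsIntegral.det (M := ib.toMatrix b) hent)
  have hD : Algebra.discr ℚ B.basis = ((r ^ 2 * discr K : ℤ) : ℚ) := by
    rw [← hbd, ← ib.toMatrix_map_vecMul b, Algebra.discr_of_matrix_vecMul, ← hr, ← coe_discr]
    push_cast
    rfl
  refine ⟨r, ?_, hD⟩
  rintro rfl
  exact Algebra.discr_not_zero_of_basis ℚ B.basis (by rw [hD]; simp)

theorem norm_discr_powerBasis_le (B : PowerBasis ℚ K) (h2 : ∀ σ : K →ₐ[ℚ] ℂ, ‖σ B.gen‖ ≤ 2) :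
    |(Algebra.discr ℚ B.basis : ℝ)| ≤ 16 ^ (B.dim ^ 2) := by
  classical
  have hcard : Fintype.card (Fin B.dim) = Fintype.card (K →ₐ[ℚ] ℂ) := by
    rw [Fintype.card_fin, AlgHom.card, B.finrank]
  have h := Algebra.discr_powerBasis_eq_prod ℚ ℂ B (Fintype.equivOfCardEq hcard)
  have h3 : |(Algebra.discr ℚ B.basis : ℝ)| = ‖algebraMap ℚ ℂ (Algebra.discr ℚ B.basis)‖ := by
    rw [eq_ratCast, Complex.norm_ratCast]
  rw [h3, h, norm_prod]
  calc _ ≤ ∏ i : Fin B.dim, (16 : ℝ) ^ B.dim := by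
        refine Finset.prod_le_prod (fun _ _ => norm_nonneg _) fun i _ => ?_
        rw [norm_prod]
        calc _ ≤ ∏ j ∈ Finset.Ioi i, (16 : ℝ) := by
              refine Finset.prod_le_prod (fun _ _ => norm_nonneg _) fun j _ => ?_
              rw [norm_pow]
              have := norm_sub_le (Fintype.equivOfCardEq hcard j B.gen)
                (Fintype.equivOfCardEq hcard i B.gen)
              have h4 := h2 (Fintype.equivOfCardEq hcard j)
              have h5 := h2 (Fintype.equivOfCardEq hcard i)
              calc _ ≤ (4 : ℝ) ^ 2 := by gcongr; linarith
                _ = 16 := by norm_num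
          _ = 16 ^ (Finset.Ioi i).card := by rw [Finset.prod_const]
          _ ≤ _ := pow_le_pow_right₀ (by norm_num)
            ((Finset.card_le_univ _).trans_eq (Fintype.card_fin _))
    _ = _ := by rw [Finset.prod_const, Finset.card_univ, Fintype.card_fin, ← pow_mul, sq]

theorem exists_residueHom (v : HeightOneSpectrum (𝓞 K)) {p : ℕ} (hp : p.Prime)
    (hv : Ideal.absNorm v.asIdeal = p) :
    ∃ φ : 𝓞 K →+* ZMod p, RingHom.ker φ = v.asIdeal := by
  have hcard : Nat.card (𝓞 K ⧸ v.asIdeal) = p := by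
    rw [← hv, Ideal.absNorm_apply, Submodule.cardQuot_apply]
  have : Finite (𝓞 K ⧸ v.asIdeal) := Nat.finite_of_card_ne_zero (by rw [hcard]; exact hp.ne_zero)
  have := Fintype.ofFinite (𝓞 K ⧸ v.asIdeal)
  rw [Nat.card_eq_fintype_card] at hcard
  refine ⟨((ZMod.ringEquivOfPrime _ hp hcard).symm : _ →+* ZMod p).comp
    (Ideal.Quotient.mk v.asIdeal), ?_⟩
  ext x
  simp [RingHom.mem_ker, Ideal.Quotient.eq_zero_iff_mem]

theorem card_absNorm_eq_prime_le_roots (B : PowerBasis ℚ K) (hB : IsIntegral ℤ B.gen) {D : ℤ}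
    (hD : Algebra.discr ℚ B.basis = D) {p : ℕ} (hp : p.Prime) (hpD : ¬ (p : ℤ) ∣ D) :
    Nat.card {v : HeightOneSpectrum (𝓞 K) // Ideal.absNorm v.asIdeal = p} ≤
      Nat.card {a : ZMod p // aeval a (minpoly ℤ B.gen) = 0} := by
  have := Fact.mk hp
  choose φ hφ using fun v : {v : HeightOneSpectrum (𝓞 K) // Ideal.absNorm v.asIdeal = p} =>
    exists_residueHom v.1 hp v.2
  set θ : 𝓞 K := ⟨B.gen, hB⟩ with hθ
  have hroot : ∀ v, aeval (φ v θ) (minpoly ℤ B.gen) = 0 := by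
    intro v
    have h1 : aeval θ (minpoly ℤ B.gen) = 0 := by
      apply RingOfIntegers.coe_injective
      rw [← aeval_algebraMap_apply, map_zero]
      exact minpoly.aeval ℤ B.gen
    have h2 := congrArg (φ v) h1
    rw [map_zero, aeval_def, hom_eval₂] at h2
    rw [aeval_def]
    convert h2
    exact RingHom.ext_int _ _
  refine Nat.card_le_card_of_injective (fun v => ⟨φ v θ, hroot v⟩) fun v w h => ?_
  have h0 : φ v θ = φ w θ := congrArg Subtype.val h
  have heq : φ v = φ w := by
    ext z
    have hz := Algebra.discr_mul_isIntegral_mem_adjoin ℚ hB (z := (z : K)) z.2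
    rw [hD, Algebra.adjoin_singleton_eq_range_aeval] at hz
    obtain ⟨g, hg⟩ := hz
    have h1 : aeval θ g = (D : 𝓞 K) * z := by
      apply RingOfIntegers.coe_injective
      rw [← aeval_algebraMap_apply, map_mul, map_intCast]
      refine hg.trans ?_
      rw [Algebra.smul_def]
      simp
    have h2 : ∀ u, aeval (φ u θ) g = (D : ZMod p) * φ u z := by
      intro u
      rw [← map_intCast (φ u), ← map_mul, ← h1, aeval_def, aeval_def, hom_eval₂]
      congr 1
      exact RingHom.ext_int _ _
    have hD0 : (D : ZMod p) ≠ 0 := by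
      rwa [Ne, ZMod.intCast_zmod_eq_zero_iff_dvd]
    apply mul_left_cancel₀ hD0
    rw [← h2, ← h2, h0]
  ext1
  apply HeightOneSpectrum.ext
  rw [← hφ v, ← hφ w, heq]

theorem card_absNorm_eq_prime_le_finrank {p : ℕ} (hp : p.Prime) :
    Nat.card {v : HeightOneSpectrum (𝓞 K) // Ideal.absNorm v.asIdeal = p} ≤
      Module.finrank ℚ K := by
  classical
  have hfin := finite_absNorm_eq (K := K) p
  rw [Nat.subtype_card hfin.toFinset (by simp)]
  refine card_charOf_le _ p fun v hv => ?_
  rw [Set.Finite.mem_toFinset, Set.mem_ofPred_eq] at hv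
  obtain ⟨n, hn, -, hc, h⟩ := charOf_spec v
  rw [hv] at h
  exact ((Nat.prime_dvd_prime_iff_eq hc hp).1 (h ▸ dvd_pow_self _ hn.ne'))

theorem card_primes_dvd_le {D : ℤ} (hD : D ≠ 0) {N : ℕ} (hN : |(D : ℝ)| ≤ 2 ^ N) (s : Finset ℕ)
    (hs : ∀ p ∈ s, p.Prime ∧ (p : ℤ) ∣ D) : s.card ≤ N := by
  have h1 : ∏ p ∈ s, p ∣ D.natAbs := by
    refine Finset.prod_primes_dvd _ (fun p hp => (hs p hp).1.prime)
      fun p hp => Int.natCast_dvd.1 (hs p hp).2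
  have h2 : 2 ^ s.card ≤ ∏ p ∈ s, p := by
    rw [← Finset.prod_const]
    exact Finset.prod_le_prod' fun p hp => (hs p hp).1.two_le
  have h3 := Nat.le_of_dvd (Int.natAbs_pos.2 hD) h1
  have h4 : D.natAbs ≤ 2 ^ N := by
    rw [← Int.cast_abs, Int.abs_eq_natAbs] at hN
    exact_mod_cast hN
  exact (Nat.pow_le_pow_iff_right (by norm_num : 1 < 2)).1 (h2.trans (h3.trans h4))

end PowerBasisDiscr

section Resultants

open IsDedekindDomain

theorem not_dvd_map_rat {f g : ℤ[X]} (hf : f.Monic) (h : ¬ f ∣ g) :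
    ¬ f.map (algebraMap ℤ ℚ) ∣ g.map (algebraMap ℤ ℚ) := by
  rwa [map_dvd_map _ (algebraMap ℤ ℚ).injective_int hf]

theorem exists_resultant_bound {f g : ℤ[X]} (hf : f.Monic) (hg : g.Monic) (hfi : Irreducible f)
    (hfg : ¬ f ∣ g) (hf2 : ∀ z : ℂ, aeval z f = 0 → ‖z‖ ≤ 2)
    (hg2 : ∀ z : ℂ, aeval z g = 0 → ‖z‖ ≤ 2) :
    ∃ D : ℤ, D ≠ 0 ∧ |(D : ℝ)| ≤ 2 ^ (2 * (f.natDegree * g.natDegree)) ∧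
      ∀ (p : ℕ) [Fact p.Prime] (a : ZMod p), ¬ (p : ℤ) ∣ D → aeval a f = 0 → aeval a g ≠ 0 := by
  have hdeg : ∀ {R : Type} [Field R] [CharZero R] (h : ℤ[X]),
      (h.map (algebraMap ℤ R)).natDegree = h.natDegree := fun {R} _ _ h =>
    natDegree_map_eq_of_injective (RingHom.injective_int (algebraMap ℤ R)) h
  refine ⟨resultant f g, ?_, ?_, ?_⟩
  · intro h0
    have h1 := resultant_map_map f g f.natDegree g.natDegree (algebraMap ℤ ℚ)
    rw [h0, map_zero] at h1
    have h2 : resultant (f.map (algebraMap ℤ ℚ)) (g.map (algebraMap ℤ ℚ)) = 0 := by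
      rw [hdeg, hdeg]; exact h1
    rw [resultant_eq_zero_iff] at h2
    refine h2.2 ?_
    rw [Irreducible.coprime_iff_not_dvd (hf.irreducible_iff_irreducible_map_fraction_map.1 hfi)]
    exact not_dvd_map_rat hf hfg
  · have h1 := resultant_map_map f g f.natDegree g.natDegree (algebraMap ℤ ℂ)
    have h2 : resultant (f.map (algebraMap ℤ ℂ)) (g.map (algebraMap ℤ ℂ)) =
        algebraMap ℤ ℂ (resultant f g) := by
      rw [← h1]
      congr 1 <;> exact hdeg _
    rw [resultant_eq_prod_roots_sub _ _ (hf.map _) (hg.map _) (IsAlgClosed.splits _)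
      (IsAlgClosed.splits _)] at h2
    have h3 : |((resultant f g : ℤ) : ℝ)| = ‖algebraMap ℤ ℂ (resultant f g)‖ := by
      rw [eq_intCast, Complex.norm_intCast]
    rw [h3, ← h2]
    have h4 : ∀ s : Multiset (ℂ × ℂ), (∀ x ∈ s, ‖x.1‖ ≤ 2 ∧ ‖x.2‖ ≤ 2) →
        ‖(s.map fun ij => ij.1 - ij.2).prod‖ ≤ 4 ^ s.card := by
      intro s
      induction s using Multiset.induction_on with
      | empty => intro _; simp
      | cons x s ih =>
        intro h
        rw [Multiset.map_cons, Multiset.prod_cons, norm_mul, Multiset.card_cons, pow_succ']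
        have h5 := h x (Multiset.mem_cons_self _ _)
        have h6 := norm_sub_le x.1 x.2
        have h7 := ih fun y hy => h y (Multiset.mem_cons_of_mem hy)
        have h8 : ‖x.1 - x.2‖ ≤ 4 := by linarith
        gcongr
    refine (h4 _ ?_).trans ?_
    · rintro ⟨x, y⟩ hxy
      rw [Multiset.mem_product, mem_roots (hf.map _).ne_zero, mem_roots (hg.map _).ne_zero,
        IsRoot.def, IsRoot.def, eval_map, eval_map] at hxy
      exact ⟨hf2 _ hxy.1, hg2 _ hxy.2⟩
    · rw [Multiset.card_product, pow_mul 2 2, show (2 : ℝ) ^ 2 = 4 by norm_num]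
      refine pow_le_pow_right₀ (by norm_num) (Nat.mul_le_mul ?_ ?_)
      · exact (card_roots' _).trans natDegree_map_le
      · exact (card_roots' _).trans natDegree_map_le
  · intro p _ a hpD hfa hga
    obtain ⟨u, w, -, -, h⟩ := exists_mul_add_mul_eq_C_resultant f g (m := f.natDegree)
      (n := g.natDegree) le_rfl le_rfl (Or.inl (hf.natDegree_pos_of_not_isUnit hfi.not_isUnit).ne')
    have h1 := congrArg (aeval a) h
    rw [map_add, map_mul, map_mul, hfa, hga, zero_mul, zero_mul, add_zero, aeval_C,
      eq_intCast] at h1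
    exact hpD ((ZMod.intCast_zmod_eq_zero_iff_dvd _ _).1 h1.symm)

theorem exists_rootField_data {f : ℤ[X]} (hf : f.Monic) (hfi : Irreducible f)
    (hf2 : ∀ z : ℂ, aeval z f = 0 → ‖z‖ ≤ 2) {α : ℂ} (hα : aeval α f = 0) :
    ∃ _ : NumberField ℚ⟮α⟯, Module.finrank ℚ ℚ⟮α⟯ = f.natDegree ∧
      Real.log |(discr ℚ⟮α⟯ : ℝ)| ≤ f.natDegree ^ 2 * Real.log 16 ∧
      ∃ D : ℤ, D ≠ 0 ∧ |(D : ℝ)| ≤ 2 ^ (4 * f.natDegree ^ 2) ∧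
        ∀ p : ℕ, p.Prime → ¬ (p : ℤ) ∣ D →
          Nat.card {v : HeightOneSpectrum (𝓞 ℚ⟮α⟯) // Ideal.absNorm v.asIdeal = p} ≤
            Nat.card {a : ZMod p // aeval a f = 0} := by
  have hintZ : IsIntegral ℤ α := ⟨f, hf, by rwa [← aeval_def]⟩
  have hintQ : IsIntegral ℚ α := hintZ.tower_top
  have : FiniteDimensional ℚ ℚ⟮α⟯ := adjoin.finiteDimensional hintQ
  have hNF : NumberField ℚ⟮α⟯ := { to_charZero := inferInstance, to_finiteDimensional := this }
  set B : PowerBasis ℚ ℚ⟮α⟯ := adjoin.powerBasis hintQ with hBdef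
  have hgen : B.gen = AdjoinSimple.gen ℚ α := adjoin.powerBasis_gen hintQ
  have hfgen : aeval B.gen f = 0 := by
    apply (algebraMap ℚ⟮α⟯ ℂ).injective
    rw [map_zero, ← aeval_algebraMap_apply, hgen, AdjoinSimple.algebraMap_gen, hα]
  have hB : IsIntegral ℤ B.gen := ⟨f, hf, by rwa [← aeval_def]⟩
  have hmin : minpoly ℤ B.gen = f := by
    refine eq_of_monic_of_associated (minpoly.monic hB) hf ?_
    have hdvd := minpoly.isIntegrallyClosed_dvd hB hfgen
    exact ((hfi.dvd_iff.1 hdvd).resolve_left (minpoly.not_isUnit ℤ B.gen)).symm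
  have hdim : B.dim = f.natDegree := by
    rw [← B.natDegree_minpoly, minpoly.isIntegrallyClosed_eq_field_fractions' ℚ hB, hmin,
      natDegree_map_eq_of_injective (algebraMap ℤ ℚ).injective_int]
  have hσ : ∀ σ : ℚ⟮α⟯ →ₐ[ℚ] ℂ, ‖σ B.gen‖ ≤ 2 := by
    intro σ
    refine hf2 _ ?_
    have := congrArg σ hfgen
    rw [map_zero, aeval_def, ← AlgHom.coe_toRingHom, hom_eval₂] at this
    rw [aeval_def]
    convert this using 2
    · exact RingHom.ext_int _ _
    · rfl
  obtain ⟨r, hr, hD⟩ := discr_powerBasis_eq_sq_mul B hB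
  have hbd := norm_discr_powerBasis_le B hσ
  rw [hD, hdim] at hbd
  have hd0 := discr_ne_zero ℚ⟮α⟯
  refine ⟨hNF, by rw [← hdim, B.finrank], ?_, r ^ 2 * discr ℚ⟮α⟯,
    mul_ne_zero (pow_ne_zero _ hr) hd0, ?_, fun p hp hpD => ?_⟩
  · rw [← Nat.cast_pow, ← Real.log_pow]
    refine Real.log_le_log (by positivity) (le_trans ?_ hbd)
    push_cast
    rw [abs_mul]
    refine le_mul_of_one_le_left (abs_nonneg _) ?_
    rw [abs_pow]
    refine one_le_pow₀ ?_
    have : 1 ≤ |r| := Int.one_le_abs hr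
    exact_mod_cast this
  · rw [pow_mul]
    norm_num only
    push_cast at hbd ⊢
    exact hbd
  · have := card_absNorm_eq_prime_le_roots B hB hD hp hpD
    rwa [hmin] at this

theorem primeWeight_nonneg (k n : ℕ) : 0 ≤ primeWeight k n := by
  unfold primeWeight
  have := Real.log_natCast_nonneg n
  positivity

theorem primeWeight_le (k : ℕ) {n : ℕ} (hn : 1 ≤ n) : primeWeight k n ≤ k * (1 / 2) ^ k := by
  have hn0 : (0 : ℝ) < n := by exact_mod_cast hn
  unfold primeWeight
  rw [mul_div_assoc]
  refine mul_le_mul_of_nonneg_left ?_ (Nat.cast_nonneg _)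
  rw [div_le_iff₀ (by positivity)]
  refine (pow_div_factorial_le (c := 2) two_pos (Real.log_natCast_nonneg n) k).trans_eq ?_
  rw [mul_comm 2, Real.exp_mul, Real.exp_log hn0]
  norm_num

end Resultants

section Combination

open IsDedekindDomain

noncomputable def nonTorsionRootCount (P : ℤ[X]) (B p : ℕ) : ℕ :=
  Nat.card {a : ZMod p // aeval a P = 0 ∧ ∀ r, 1 ≤ r → r ≤ B → a ^ r ≠ 1}

theorem exists_factor_count : ∃ A : ℝ, 0 ≤ A ∧ ∀ {f H : ℤ[X]}, f.Monic → Irreducible f → H.Monic →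
    ¬ f ∣ H → (∀ z : ℂ, aeval z f = 0 → ‖z‖ ≤ 2) → (∀ z : ℂ, aeval z H = 0 → ‖z‖ ≤ 2) →
    (∀ z : ℂ, aeval z f = 0 → RHFor ℚ⟮z⟯) → ∀ {d m : ℕ}, f.natDegree ≤ d → H.natDegree ≤ m →
    ∀ {k : ℕ}, 1 ≤ k → ∃ c : ℕ → ℕ, (∀ p, p.Prime → c p ≤ d) ∧
      |∑ p ∈ Nat.primesBelow (2 ^ (8 * k)), primeWeight k p * c p - 1| ≤
        A * d ^ 2 * k * (4 / 5) ^ k ∧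
      ∃ E : ℤ, E ≠ 0 ∧ |(E : ℝ)| ≤ 2 ^ (4 * d ^ 2 + 2 * (d * m)) ∧
        ∀ (p : ℕ) [Fact p.Prime], ¬ (p : ℤ) ∣ E →
          c p ≤ Nat.card {a : ZMod p // aeval a f = 0 ∧ aeval a H ≠ 0} := by
  obtain ⟨A, hA, hcount⟩ := exists_weighted_prime_ideal_count
  refine ⟨A * (1 + Real.log 16), by have := Real.log_nonneg (x := 16) (by norm_num); positivity, ?_⟩
  intro f H hf hfi hH hfH hf2 hH2 hRH d m hd hm k hk
  have hfd : 1 ≤ f.natDegree := hf.natDegree_pos_of_not_isUnit hfi.not_isUnit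
  obtain ⟨α, hα⟩ : ∃ α : ℂ, aeval α f = 0 := by
    refine IsAlgClosed.exists_aeval_eq_zero ℂ f ?_
    rw [degree_eq_natDegree hf.ne_zero]
    exact_mod_cast (Nat.pos_of_ne_zero (by omega)).ne'
  obtain ⟨hNF, hfin, hdisc, D, hD0, hDle, hD⟩ := exists_rootField_data hf hfi hf2 hα
  obtain ⟨R, hR0, hRle, hR⟩ := exists_resultant_bound hf hH hfi hfH hf2 hH2
  refine ⟨fun p => Nat.card {v : HeightOneSpectrum (𝓞 ℚ⟮α⟯) // Ideal.absNorm v.asIdeal = p},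
    fun p hp => (card_absNorm_eq_prime_le_finrank hp).trans (hfin.le.trans hd), ?_, D * R,
    mul_ne_zero hD0 hR0, ?_, fun p hp hpE => ?_⟩
  · refine (hcount ℚ⟮α⟯ (hRH α hα) k hk).trans ?_
    have h1 : (Module.finrank ℚ ℚ⟮α⟯ : ℝ) + Real.log |(discr ℚ⟮α⟯ : ℝ)| ≤
        (1 + Real.log 16) * d ^ 2 := by
      have h2 : (f.natDegree : ℝ) ≤ d := by exact_mod_cast hd
      have h3 : (1 : ℝ) ≤ f.natDegree := by exact_mod_cast hfd
      have h4 : (f.natDegree : ℝ) ^ 2 ≤ d ^ 2 := by gcongr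
      have h5 := Real.log_nonneg (x := 16) (by norm_num)
      rw [hfin]
      nlinarith [mul_le_mul_of_nonneg_right h4 h5]
    calc _ ≤ A * ((1 + Real.log 16) * d ^ 2) * k * (4 / 5) ^ k := by gcongr
      _ = _ := by ring
  · push_cast
    rw [abs_mul, pow_add]
    refine mul_le_mul (hDle.trans ?_) (hRle.trans ?_) (abs_nonneg _) (by positivity)
    · exact pow_le_pow_right₀ (by norm_num) (by gcongr)
    · exact pow_le_pow_right₀ (by norm_num) (by gcongr)
  · refine (hD p hp.out fun h => hpE (h.mul_right _)).trans (Nat.card_le_card_of_injective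
      (fun a => ⟨a.1, a.2, hR p a.1 (fun h => hpE (h.mul_left _)) a.2⟩) fun a b hab => ?_)
    exact Subtype.ext (congrArg (fun x => x.1) hab)

theorem exists_combined_count : ∃ A : ℝ, 0 ≤ A ∧ ∀ {P : ℤ[X]}, P.Monic →
    (∀ z : ℂ, aeval z P = 0 → ‖z‖ ≤ 2) → (∀ z : ℂ, aeval z P = 0 → RHFor ℚ⟮z⟯) →
    ∀ {k : ℕ}, 1 ≤ k → ∀ (B : ℕ) (S : Finset ℤ[X]), S.card ≤ 2 →
    (∀ f ∈ S, f.Monic ∧ Irreducible f ∧ f ∣ P ∧ ∀ r, 1 ≤ r → r ≤ B → ¬ f ∣ X ^ r - 1) →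
    S.card * (1 - A * P.natDegree ^ 2 * k * (4 / 5) ^ k) ≤
      ∑ p ∈ Nat.primesBelow (2 ^ (8 * k)), primeWeight k p * nonTorsionRootCount P B p +
      2 * P.natDegree * (12 * P.natDegree ^ 2 + 4 * P.natDegree * B ^ 2) * (k * (1 / 2) ^ k) := by
  classical
  obtain ⟨A, hA, hcount⟩ := exists_factor_count
  refine ⟨A, hA, ?_⟩
  intro P hP hP2 hRH k hk B S hS2 hS
  set d := P.natDegree with hd
  set G : ℤ[X] := ∏ r ∈ Finset.Icc 1 B, (X ^ r - 1) with hG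
  have hGm : G.Monic := monic_prod_of_monic _ _ fun r hr => by
    have := monic_X_pow_sub_C (1 : ℤ) (n := r) (by have := Finset.mem_Icc.1 hr; omega)
    simpa using this
  have hGd : G.natDegree ≤ B ^ 2 := by
    refine (natDegree_prod_le _ _).trans ((Finset.sum_le_card_nsmul _ _ B fun r hr => ?_).trans ?_)
    · have h := natDegree_X_pow_sub_C (n := r) (r := (1 : ℤ))
      rw [C_1] at h
      exact h.le.trans (Finset.mem_Icc.1 hr).2
    · simp [sq]
  have hG2 : ∀ z : ℂ, aeval z G = 0 → ‖z‖ ≤ 2 := by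
    intro z hz
    rw [hG, map_prod, Finset.prod_eq_zero_iff] at hz
    obtain ⟨r, hr, hz⟩ := hz
    have hz1 : z ^ r = 1 := by
      rw [map_sub, map_pow, aeval_X, map_one, sub_eq_zero] at hz; exact hz
    have := Complex.norm_eq_one_of_pow_eq_one hz1 (by have := Finset.mem_Icc.1 hr; omega)
    linarith
  set H : ℤ[X] → ℤ[X] := fun f => G * ∏ g ∈ S.erase f, g with hH
  have hdeg : ∀ f ∈ S, f.natDegree ≤ d := fun f hf =>
    natDegree_le_of_dvd (hS f hf).2.2.1 hP.ne_zero
  have hroot : ∀ f ∈ S, ∀ {R : Type} [CommRing R] (z : R), aeval z f = 0 → aeval z P = 0 := by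
    intro f hf R _ z hz
    obtain ⟨q, hq⟩ := (hS f hf).2.2.1
    rw [hq, map_mul, hz, zero_mul]
  have key : ∀ f ∈ S, ∃ c : ℕ → ℕ, (∀ p, p.Prime → c p ≤ d) ∧
      |∑ p ∈ Nat.primesBelow (2 ^ (8 * k)), primeWeight k p * c p - 1| ≤
        A * d ^ 2 * k * (4 / 5) ^ k ∧
      ∃ E : ℤ, E ≠ 0 ∧ |(E : ℝ)| ≤ 2 ^ (4 * d ^ 2 + 2 * (d * (B ^ 2 + d))) ∧
        ∀ (p : ℕ) [Fact p.Prime], ¬ (p : ℤ) ∣ E →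
          c p ≤ Nat.card {a : ZMod p // aeval a f = 0 ∧ aeval a (H f) ≠ 0} := by
    intro f hf
    obtain ⟨hfm, hfi, hfP, hfr⟩ := hS f hf
    have hfp : Prime f := hfi.prime
    refine hcount hfm hfi (hGm.mul (monic_prod_of_monic _ _ fun g hg =>
      (hS g (Finset.mem_of_mem_erase hg)).1)) ?_ (fun z hz => hP2 z (hroot f hf z hz)) ?_
      (fun z hz => hRH z (hroot f hf z hz)) (hdeg f hf) ?_ hk
    · intro h
      rcases hfp.dvd_or_dvd h with h | h
      · obtain ⟨r, hr, h⟩ := (hfp.dvd_finsetProd_iff _).1 h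
        exact hfr r (Finset.mem_Icc.1 hr).1 (Finset.mem_Icc.1 hr).2 h
      · obtain ⟨g, hg, h⟩ := (hfp.dvd_finsetProd_iff _).1 h
        have hg' := hS g (Finset.mem_of_mem_erase hg)
        refine (Finset.ne_of_mem_erase hg).symm (eq_of_monic_of_associated hfm hg'.1 ?_)
        exact hfi.associated_of_dvd hg'.2.1 h
    · intro z hz
      rw [map_mul, mul_eq_zero] at hz
      rcases hz with hz | hz
      · exact hG2 z hz
      · rw [map_prod, Finset.prod_eq_zero_iff] at hz
        obtain ⟨g, hg, hz⟩ := hz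
        exact hP2 z (hroot g (Finset.mem_of_mem_erase hg) z hz)
    · refine natDegree_mul_le.trans (add_le_add hGd ?_)
      refine (natDegree_prod_le _ _).trans ((Finset.sum_le_card_nsmul _ _ d fun g hg =>
        hdeg g (Finset.mem_of_mem_erase hg)).trans ?_)
      rw [Finset.card_erase_of_mem hf, smul_eq_mul]
      exact (Nat.mul_le_mul_right _ (by omega : S.card - 1 ≤ 1)).trans (by simp)
  choose! c hcd hcs E hE0 hEle hE using key
  set M := 4 * d ^ 2 + 2 * (d * (B ^ 2 + d))
  set D : ℤ := ∏ f ∈ S, E f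
  have hD0 : D ≠ 0 := Finset.prod_ne_zero_iff.2 hE0
  have hDle : |(D : ℝ)| ≤ 2 ^ (M * 2) := by
    simp only [D]
    push_cast
    rw [Finset.abs_prod]
    refine (Finset.prod_le_prod (fun _ _ => abs_nonneg _) hEle).trans ?_
    rw [Finset.prod_const, ← pow_mul]
    exact pow_le_pow_right₀ (by norm_num) (by gcongr)
  set T := Nat.primesBelow (2 ^ (8 * k))
  have hTp : ∀ p ∈ T, p.Prime := fun p hp => (Nat.mem_primesBelow.1 hp).2
  have hgood : ∀ p ∈ T, ¬ (p : ℤ) ∣ D → ∑ f ∈ S, c f p ≤ nonTorsionRootCount P B p := by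
    intro p hp hpD
    have : Fact p.Prime := ⟨hTp p hp⟩
    have h1 : ∀ f ∈ S, c f p ≤
        (Finset.univ.filter fun a : ZMod p => aeval a f = 0 ∧ aeval a (H f) ≠ 0).card := by
      intro f hf
      have := hE f hf p fun h => hpD (h.trans (Finset.dvd_prod_of_mem _ hf))
      rwa [Nat.card_eq_fintype_card, Fintype.card_subtype] at this
    refine (Finset.sum_le_sum h1).trans ?_
    rw [← Finset.card_biUnion, nonTorsionRootCount, Nat.card_eq_fintype_card, Fintype.card_subtype]
    · refine Finset.card_le_card fun a ha => ?_
      obtain ⟨f, hf, ha⟩ := Finset.mem_biUnion.1 ha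
      obtain ⟨-, ha0, haH⟩ := Finset.mem_filter.1 ha
      refine Finset.mem_filter.2 ⟨Finset.mem_univ _, hroot f hf a ha0, fun r hr1 hrB har => haH ?_⟩
      rw [map_mul, hG, map_prod, Finset.prod_eq_zero (Finset.mem_Icc.2 ⟨hr1, hrB⟩), zero_mul]
      rw [map_sub, map_pow, aeval_X, map_one, har, sub_self]
    · intro f hf g hg hfg
      refine Finset.disjoint_left.2 fun a ha hb => ?_
      obtain ⟨-, ha0, haH⟩ := Finset.mem_filter.1 ha
      obtain ⟨-, hb0, hbH⟩ := Finset.mem_filter.1 hb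
      refine haH ?_
      rw [map_mul, map_prod (aeval (R := ℤ) a) _ (S.erase f),
        Finset.prod_eq_zero (Finset.mem_erase.2 ⟨hfg.symm, hg⟩) hb0, mul_zero]
  have hall : ∀ p ∈ T, ∑ f ∈ S, c f p ≤ 2 * d := fun p hp =>
    (Finset.sum_le_card_nsmul _ _ d fun f hf => hcd f hf p (hTp p hp)).trans
      (by rw [smul_eq_mul]; gcongr)
  have hbadcard : ((T.filter fun p : ℕ => (p : ℤ) ∣ D).card : ℝ) ≤ M * 2 := by
    have := card_primes_dvd_le hD0 hDle (T.filter fun p : ℕ => (p : ℤ) ∣ D) fun p hp =>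
      ⟨hTp p (Finset.mem_filter.1 hp).1, (Finset.mem_filter.1 hp).2⟩
    exact_mod_cast this
  have hsum1 : (S.card : ℝ) * (1 - A * d ^ 2 * k * (4 / 5) ^ k) ≤
      ∑ f ∈ S, ∑ p ∈ T, primeWeight k p * c f p := by
    rw [← nsmul_eq_mul]
    refine Finset.card_nsmul_le_sum _ _ _ fun f hf => ?_
    have := (abs_le.1 (hcs f hf)).1
    linarith
  refine hsum1.trans ?_
  rw [Finset.sum_comm]
  have hterm : ∀ p ∈ T, ∑ f ∈ S, primeWeight k p * c f p ≤
      primeWeight k p * nonTorsionRootCount P B p +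
        if (p : ℤ) ∣ D then 2 * d * (k * (1 / 2) ^ k : ℝ) else 0 := by
    intro p hp
    have hw := primeWeight_nonneg k p
    rw [← Finset.mul_sum, ← Nat.cast_sum]
    split_ifs with h
    · have h1 : ((∑ f ∈ S, c f p : ℕ) : ℝ) ≤ 2 * d := by exact_mod_cast hall p hp
      have h2 := primeWeight_le k (hTp p hp).one_le
      have h3 : primeWeight k p * ((∑ f ∈ S, c f p : ℕ) : ℝ) ≤ k * (1 / 2) ^ k * (2 * d) := by
        gcongr
      have h4 : 0 ≤ primeWeight k p * nonTorsionRootCount P B p := by positivity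
      linarith
    · rw [add_zero]
      have h1 : ((∑ f ∈ S, c f p : ℕ) : ℝ) ≤ nonTorsionRootCount P B p := by
        exact_mod_cast hgood p hp h
      gcongr
  refine (Finset.sum_le_sum hterm).trans ?_
  rw [Finset.sum_add_distrib, ← Finset.sum_filter, Finset.sum_const, nsmul_eq_mul]
  refine add_le_add le_rfl ?_
  have h5 : (0 : ℝ) ≤ 2 * d * (k * (1 / 2) ^ k : ℝ) := by positivity
  refine (mul_le_mul_of_nonneg_right hbadcard h5).trans_eq ?_
  simp only [M]
  push_cast
  ring

end Combination

section ZeroOnePoly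

variable {d : ℕ} (v : Fin (d - 1) → Bool)

theorem zeroOnePoly_coeff_zero (hd : 2 ≤ d) : (zeroOnePoly d v).coeff 0 = 1 := by
  have : (0 : ℕ) ≠ d := by omega
  simp only [zeroOnePoly, finsetSum_coeff, coeff_X_pow, coeff_one, coeff_add, coeff_C_mul,
    if_neg this]
  simp

theorem zeroOnePoly_coeff_self (hd : 2 ≤ d) : (zeroOnePoly d v).coeff d = 1 := by
  have : ∀ i : Fin (d - 1), d ≠ (i : ℕ) + 1 := fun i => by omega
  have h0 : d ≠ 0 := by omega
  simp only [zeroOnePoly, finsetSum_coeff, coeff_X_pow, coeff_one, coeff_add, coeff_C_mul,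
    if_neg h0,
    if_neg (this _)]
  simp

theorem zeroOnePoly_coeff_succ (hd : 2 ≤ d) (i : Fin (d - 1)) :
    (zeroOnePoly d v).coeff (i + 1) = if v i then 1 else 0 := by
  have : (i : ℕ) + 1 ≠ d := by omega
  have h : ∀ j : Fin (d - 1), (i : ℕ) = j ↔ j = i := fun j => by rw [Fin.ext_iff]; exact eq_comm
  simp only [zeroOnePoly, finsetSum_coeff, coeff_X_pow, coeff_one, coeff_add, coeff_C_mul,
    if_neg this,
    add_left_inj, h]
  simp

theorem zeroOnePoly_natDegree_le (hd : 2 ≤ d) : (zeroOnePoly d v).natDegree ≤ d := by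
  unfold zeroOnePoly
  refine natDegree_add_le_of_degree_le (natDegree_add_le_of_degree_le (by simp) (by simp)) ?_
  refine natDegree_sum_le_of_forall_le _ _ fun i _ =>
    (natDegree_C_mul_X_pow_le _ _).trans (by omega)

theorem zeroOnePoly_monic (hd : 2 ≤ d) : (zeroOnePoly d v).Monic :=
  monic_of_natDegree_le_of_coeff_eq_one d (zeroOnePoly_natDegree_le v hd)
    (zeroOnePoly_coeff_self v hd)

theorem zeroOnePoly_natDegree (hd : 2 ≤ d) : (zeroOnePoly d v).natDegree = d :=
  natDegree_eq_of_le_of_coeff_ne_zero (zeroOnePoly_natDegree_le v hd)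
    (by rw [zeroOnePoly_coeff_self v hd]; exact one_ne_zero)

theorem zeroOnePoly_coeff_eq (hd : 2 ≤ d) (i : ℕ) :
    (zeroOnePoly d v).coeff i = 0 ∨ (zeroOnePoly d v).coeff i = 1 := by
  rcases Nat.eq_zero_or_pos i with rfl | hi
  · exact Or.inr (zeroOnePoly_coeff_zero v hd)
  rcases lt_trichotomy i d with h | rfl | h
  · have := zeroOnePoly_coeff_succ v hd ⟨i - 1, by omega⟩
    rw [show ((⟨i - 1, by omega⟩ : Fin (d - 1)) : ℕ) + 1 = i by simp; omega] at this
    rw [this]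
    split_ifs <;> simp
  · exact Or.inr (zeroOnePoly_coeff_self v hd)
  · exact Or.inl (coeff_eq_zero_of_natDegree_lt ((zeroOnePoly_natDegree_le v hd).trans_lt h))

theorem norm_le_two_of_aeval_zeroOnePoly_eq_zero (hd : 2 ≤ d) {z : ℂ}
    (hz : aeval z (zeroOnePoly d v) = 0) : ‖z‖ ≤ 2 := by
  set p := (zeroOnePoly d v).map (algebraMap ℤ ℂ) with hp
  have hm : p.Monic := (zeroOnePoly_monic v hd).map _
  have hr : p.IsRoot z := by rwa [IsRoot.def, hp, eval_map, ← aeval_def]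
  have h := hr.norm_lt_cauchyBound hm.ne_zero
  have h2 : p.cauchyBound ≤ 2 := by
    rw [cauchyBound, ← one_add_one_eq_two]
    rw [hm.leadingCoeff, nnnorm_one, div_one]
    refine add_le_add (Finset.sup_le fun i _ => ?_) le_rfl
    rw [hp, coeff_map]
    rcases zeroOnePoly_coeff_eq v hd i with h | h <;> simp [h]
  have h3 : (p.cauchyBound : ℝ) ≤ 2 := by exact_mod_cast h2
  linarith

theorem eval_one_zeroOnePoly_ne_zero : (zeroOnePoly d v).eval 1 ≠ 0 := by
  have : 0 ≤ ∑ i : Fin (d - 1), (if v i then (1 : ℤ) else 0) :=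
    Finset.sum_nonneg fun i _ => by split_ifs <;> simp
  have h : (zeroOnePoly d v).eval 1 = 1 + 1 + ∑ i : Fin (d - 1), (if v i then (1 : ℤ) else 0) := by
    simp only [zeroOnePoly, eval_add, eval_pow, eval_X, eval_one, eval_finsetSum, eval_mul, eval_C,
      one_pow, mul_one]
  omega

end ZeroOnePoly

section MonicFactors

theorem exists_monic_irreducible_dvd {P : ℤ[X]} (hP : P.Monic) (h : P.natDegree ≠ 0) :
    ∃ f : ℤ[X], f.Monic ∧ Irreducible f ∧ f ∣ P := by
  have hu : ¬ IsUnit P := fun hu => h (natDegree_eq_zero_of_isUnit hu)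
  obtain ⟨f, hf, q, hq⟩ := WfDvdMonoid.exists_irreducible_factor hu hP.ne_zero
  have hl : f.leadingCoeff * q.leadingCoeff = 1 := by
    rw [← leadingCoeff_mul, ← hq, hP.leadingCoeff]
  rcases Int.isUnit_iff.1 (IsUnit.of_mul_eq_one _ hl) with h | h
  · exact ⟨f, h, hf, q, hq⟩
  · exact ⟨-f, by rw [Monic, leadingCoeff_neg, h, neg_neg],
      (Associated.refl f).neg_right.irreducible hf, -q, by rw [hq]; ring⟩

theorem eq_pow_of_forall_factor_eq {f : ℤ[X]} : ∀ (n : ℕ) {P : ℤ[X]}, P.Monic → P.natDegree ≤ n →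
    (∀ g : ℤ[X], g.Monic → Irreducible g → g ∣ P → g = f) → ∃ j, P = f ^ j := by
  intro n
  induction n with
  | zero =>
    intro P hP h0 _
    exact ⟨0, by rw [pow_zero, hP.natDegree_eq_zero.1 (by omega)]⟩
  | succ n ih =>
    intro P hP hn h
    by_cases h0 : P.natDegree = 0
    · exact ⟨0, by rw [pow_zero, hP.natDegree_eq_zero.1 h0]⟩
    obtain ⟨g, hg, hgi, q, hq⟩ := exists_monic_irreducible_dvd hP h0
    have hgf := h g hg hgi ⟨q, hq⟩
    subst hgf
    have hqm : q.Monic := hg.of_mul_monic_left (hq ▸ hP)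
    have hdeg : P.natDegree = g.natDegree + q.natDegree := by rw [hq, hg.natDegree_mul hqm]
    have hg1 : 0 < g.natDegree := hg.natDegree_pos_of_not_isUnit hgi.not_isUnit
    obtain ⟨j, hj⟩ := ih hqm (by omega) fun g' h1 h2 h3 => h g' h1 h2 (h3.trans
      ⟨g, by rw [hq, mul_comm]⟩)
    exact ⟨j + 1, by rw [hq, hj, pow_succ']⟩

theorem exists_eq_cyclotomic {f : ℤ[X]} (hf : f.Monic) (hfi : Irreducible f) {r : ℕ} (hr : 1 ≤ r)
    (h : f ∣ X ^ r - 1) : ∃ m, 1 ≤ m ∧ m ≤ r ∧ f = cyclotomic m ℤ := by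
  rw [← prod_cyclotomic_eq_X_pow_sub_one hr] at h
  obtain ⟨m, hm, h⟩ := (hfi.prime.dvd_finsetProd_iff _).1 h
  have hm0 : 0 < m := Nat.pos_of_mem_divisors hm
  exact ⟨m, hm0, Nat.divisor_le hm, eq_of_monic_of_associated hf (cyclotomic.monic m ℤ)
    (hfi.associated_of_dvd (cyclotomic.irreducible hm0) h)⟩

theorem exists_nonCyclotomic_factors {P : ℤ[X]} (hP : P.Monic) (hd : 2 ≤ P.natDegree)
    (h1 : P.eval 1 ≠ 0) {B : ℕ} (hB : ∀ r, 3 ≤ r → r ≤ B → ¬ cyclotomic r ℤ ∣ P)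
    (hpow : ∀ (f : ℤ[X]) (j : ℕ), 2 ≤ j → P ≠ f ^ j) :
    ∃ S : Finset ℤ[X], 1 ≤ S.card ∧ S.card ≤ 2 ∧
      (∀ f ∈ S, f.Monic ∧ Irreducible f ∧ f ∣ P ∧ ∀ r, 1 ≤ r → r ≤ B → ¬ f ∣ X ^ r - 1) ∧
      (¬ Irreducible P → P.eval (-1) ≠ 0 → S.card = 2) := by
  classical
  have key : ∀ f : ℤ[X], f.Monic → Irreducible f → f ∣ P → f ≠ X + 1 →
      ∀ r, 1 ≤ r → r ≤ B → ¬ f ∣ X ^ r - 1 := by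
    intro f hf hfi hfP hf2 r hr hrB h
    obtain ⟨m, hm1, hmr, rfl⟩ := exists_eq_cyclotomic hf hfi hr h
    rcases (by omega : m = 1 ∨ m = 2 ∨ 3 ≤ m) with rfl | rfl | hm
    · rw [cyclotomic_one] at hfP
      refine h1 ((IsRoot.def).1 (dvd_iff_isRoot.1 ?_))
      simpa using hfP
    · exact hf2 (cyclotomic_two ℤ)
    · exact hB m hm (hmr.trans hrB) hfP
  by_cases hirr : Irreducible P
  · refine ⟨{P}, by simp, by simp, ?_, fun h => absurd hirr h⟩
    intro f hf
    rw [Finset.mem_singleton.1 hf]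
    refine ⟨hP, hirr, dvd_rfl, key P hP hirr dvd_rfl fun h => ?_⟩
    have h2 := natDegree_X_add_C (1 : ℤ)
    rw [C_1, ← h] at h2
    omega
  obtain ⟨f, hf, hfi, hfP⟩ := exists_monic_irreducible_dvd hP (by omega)
  obtain ⟨g, hg, hgi, hgP, hgf⟩ : ∃ g : ℤ[X], g.Monic ∧ Irreducible g ∧ g ∣ P ∧ g ≠ f := by
    by_contra! hcon
    obtain ⟨j, hj⟩ := eq_pow_of_forall_factor_eq _ hP le_rfl hcon
    rcases (by omega : j = 0 ∨ j = 1 ∨ 2 ≤ j) with rfl | rfl | hj2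
    · rw [pow_zero] at hj; rw [hj, natDegree_one] at hd; omega
    · rw [pow_one] at hj; exact hirr (hj ▸ hfi)
    · exact hpow f j hj2 hj
  by_cases hm1 : P.eval (-1) = 0
  · obtain ⟨e, he, hei, heP, he2⟩ : ∃ e : ℤ[X], e.Monic ∧ Irreducible e ∧ e ∣ P ∧ e ≠ X + 1 := by
      by_cases hf2 : f = X + 1
      · exact ⟨g, hg, hgi, hgP, hf2 ▸ hgf⟩
      · exact ⟨f, hf, hfi, hfP, hf2⟩
    refine ⟨{e}, by simp, by simp, ?_, fun _ h => absurd hm1 h⟩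
    intro f hf
    rw [Finset.mem_singleton.1 hf]
    exact ⟨he, hei, heP, key e he hei heP he2⟩
  · have hne : ∀ e : ℤ[X], e ∣ P → e ≠ X + 1 := by
      rintro e he rfl
      refine hm1 ((IsRoot.def).1 (dvd_iff_isRoot.1 ?_))
      simpa using he
    refine ⟨{g, f}, by simp [Finset.card_pair hgf], Finset.card_le_two, ?_,
      fun _ _ => Finset.card_pair hgf⟩
    intro e he
    rcases Finset.mem_insert.1 he with rfl | he
    · exact ⟨hg, hgi, hgP, key _ hg hgi hgP (hne _ hgP)⟩
    · rw [Finset.mem_singleton.1 he]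
      exact ⟨hf, hfi, hfP, key _ hf hfi hfP (hne _ hfP)⟩

end MonicFactors

section Expectation

open IsDedekindDomain

theorem exists_sum_primeWeight_le : ∃ A : ℝ, 0 ≤ A ∧ (RHFor ℚ⟮(0 : ℂ)⟯ → ∀ k : ℕ, 1 ≤ k →
    ∑ p ∈ Nat.primesBelow (2 ^ (8 * k)), primeWeight k p ≤ 1 + A * k * (4 / 5) ^ k) := by
  obtain ⟨A, hA, hcount⟩ := exists_weighted_prime_ideal_count
  have hinteg : IsIntegral ℚ (0 : ℂ) := isIntegral_zero
  have : FiniteDimensional ℚ ℚ⟮(0 : ℂ)⟯ := adjoin.finiteDimensional hinteg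
  have hNF : NumberField ℚ⟮(0 : ℂ)⟯ :=
    { to_charZero := inferInstance, to_finiteDimensional := this }
  set c := (Module.finrank ℚ ℚ⟮(0 : ℂ)⟯ : ℝ) + Real.log |(discr ℚ⟮(0 : ℂ)⟯ : ℝ)| with hc
  have hfin : Module.finrank ℚ ℚ⟮(0 : ℂ)⟯ = 1 := by
    rw [IntermediateField.adjoin_zero, IntermediateField.finrank_bot]
  refine ⟨A * |c|, by positivity, fun hRH k hk => ?_⟩
  have h1 := (abs_le.1 (hcount _ hRH k hk)).2
  have h2 : ∑ p ∈ Nat.primesBelow (2 ^ (8 * k)), primeWeight k p ≤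
      ∑ p ∈ Nat.primesBelow (2 ^ (8 * k)), primeWeight k p *
        Nat.card {v : HeightOneSpectrum (𝓞 ℚ⟮(0 : ℂ)⟯) // Ideal.absNorm v.asIdeal = p} := by
    refine Finset.sum_le_sum fun p hp => le_mul_of_one_le_right (primeWeight_nonneg k p) ?_
    have hpp := (Nat.mem_primesBelow.1 hp).2
    have hN : Ideal.absNorm (Ideal.span {(p : 𝓞 ℚ⟮(0 : ℂ)⟯)}) = p := by
      rw [Ideal.absNorm_span_natCast, RingOfIntegers.rank, hfin, pow_one]
    have hprime : (Ideal.span {(p : 𝓞 ℚ⟮(0 : ℂ)⟯)}).IsPrime :=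
      Ideal.isPrime_of_irreducible_absNorm (hN.symm ▸ hpp)
    have : Nonempty {v : HeightOneSpectrum (𝓞 ℚ⟮(0 : ℂ)⟯) // Ideal.absNorm v.asIdeal = p} :=
      ⟨⟨⟨_, hprime, by
        rw [Ne, Ideal.span_singleton_eq_bot]
        exact_mod_cast hpp.ne_zero⟩, hN⟩⟩
    have : Finite {v : HeightOneSpectrum (𝓞 ℚ⟮(0 : ℂ)⟯) // Ideal.absNorm v.asIdeal = p} :=
      (finite_absNorm_eq (K := ℚ⟮(0 : ℂ)⟯) p).to_subtype
    exact_mod_cast Nat.card_pos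
  have h3 : A * c * k * (4 / 5) ^ k ≤ A * |c| * k * (4 / 5) ^ k := by
    have := le_abs_self c
    gcongr
  linarith

theorem sum_nonTorsionRootCount_le {k B W d : ℕ} (hk : 1 ≤ k) (hd : 2 ≤ d)
    (hB : 8 * k ≤ ((Finset.range (B + 1)).filter fun q => q.Prime ∧ 2 * (8 * k) ≤ q).card)
    (hW : W * (8 * k * (8 * k * B) + 1) ≤ d - 1) {p : ℕ} (hp : p.Prime) (hp2 : p < 2 ^ (8 * k)) :
    (∑ v : Fin (d - 1) → Bool, (nonTorsionRootCount (zeroOnePoly d v) B p : ℝ)) ≤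
      2 ^ (d - 1) * (1 + 2 ^ (8 * k) * Real.exp (-2 * (1 / (8 * k : ℕ)) ^ 2) ^ W) := by
  classical
  have : Fact p.Prime := ⟨hp⟩
  have hp0 : (0 : ℝ) < p := by exact_mod_cast hp.pos
  set l := 8 * k with hl
  have hl1 : 1 ≤ l := by omega
  have hl0 : (0 : ℝ) < l := by exact_mod_cast hl1
  set q := Real.exp (-2 * (1 / (l : ℝ)) ^ 2) ^ W with hq
  have hq0 : 0 ≤ q := by positivity
  have hcount : ∀ a : ZMod p, (∀ r, 1 ≤ r → r ≤ B → a ^ r ≠ 1) →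
      (Nat.card {v : Fin (d - 1) → Bool // aeval a (zeroOnePoly d v) = 0} : ℝ) ≤
        2 ^ (d - 1) * (1 / p + q) := by
    intro a ha
    by_cases ha0 : a = 0
    · have : IsEmpty {v : Fin (d - 1) → Bool // aeval a (zeroOnePoly d v) = 0} := by
        refine ⟨fun ⟨v, hv⟩ => ?_⟩
        rw [ha0, aeval_def, eval₂_at_zero, zeroOnePoly_coeff_zero _ hd, map_one] at hv
        exact one_ne_zero hv
      rw [Nat.card_of_isEmpty, Nat.cast_zero]
      positivity
    · refine card_root_zeroOnePoly_le ha0 (by positivity) (fun ξ hξ => ?_) hW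
      obtain ⟨j, hj, h⟩ := exists_le_mul_valMinAbs hl1 hp2 hB ha0 ha hξ
      refine ⟨j, hj, ?_⟩
      rw [one_div_mul_eq_div, div_le_iff₀ hl0, mul_comm]
      exact_mod_cast h
  set F : Finset (ZMod p) := Finset.univ.filter fun a : ZMod p =>
    ∀ r, 1 ≤ r → r ≤ B → a ^ r ≠ 1 with hF
  have hswap : (∑ v : Fin (d - 1) → Bool, (nonTorsionRootCount (zeroOnePoly d v) B p : ℝ)) =
      ∑ a ∈ F,
        (Nat.card {v : Fin (d - 1) → Bool // aeval a (zeroOnePoly d v) = 0} : ℝ) := by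
    have h1 : ∀ v : Fin (d - 1) → Bool, (nonTorsionRootCount (zeroOnePoly d v) B p : ℝ) =
        ∑ a ∈ F,
          if aeval a (zeroOnePoly d v) = 0 then (1 : ℝ) else 0 := by
      intro v
      rw [nonTorsionRootCount, Nat.card_eq_fintype_card, Fintype.card_subtype, Finset.sum_boole, hF,
        Finset.filter_filter]
      simp only [and_comm]
    simp_rw [h1]
    rw [Finset.sum_comm]
    refine Finset.sum_congr rfl fun a _ => ?_
    rw [Finset.sum_boole, Nat.card_eq_fintype_card, Fintype.card_subtype]
  rw [hswap]
  refine (Finset.sum_le_card_nsmul _ _ _ fun a ha => hcount a (by simpa [hF] using ha)).trans ?_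
  rw [nsmul_eq_mul]
  have hcard : (F.card : ℝ) ≤
      p := by
    have := Finset.card_le_univ F
    rw [ZMod.card] at this
    exact_mod_cast this
  have hp3 : (p : ℝ) ≤ 2 ^ l := by exact_mod_cast hp2.le
  calc _ ≤ (p : ℝ) * (2 ^ (d - 1) * (1 / p + q)) := by gcongr
    _ = 2 ^ (d - 1) * (1 + p * q) := by field_simp
    _ ≤ _ := by gcongr

def IsExceptional (P : ℤ[X]) (B : ℕ) : Prop :=
  (∃ r, 3 ≤ r ∧ r ≤ B ∧ cyclotomic r ℤ ∣ P) ∨ ∃ (f : ℤ[X]) (j : ℕ), 2 ≤ j ∧ P = f ^ j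

theorem exists_card_reducible_le : ∃ A : ℝ, 0 ≤ A ∧ ∀ d : ℕ, 2 ≤ d →
    (∀ a : ℂ, (∃ Q : Polynomial ℤ, Q ≠ 0 ∧ (∀ i, Q.coeff i = 0 ∨ Q.coeff i = 1) ∧ aeval a Q = 0) →
      RHFor ℚ⟮a⟯) →
    ∀ k B W : ℕ, 1 ≤ k →
    8 * k ≤ ((Finset.range (B + 1)).filter fun q => q.Prime ∧ 2 * (8 * k) ≤ q).card →
    W * (8 * k * (8 * k * B) + 1) ≤ d - 1 → A * d ^ 2 * k * (4 / 5) ^ k ≤ 1 / 2 →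
    (Nat.card {v : Fin (d - 1) → Bool // ¬ Irreducible (zeroOnePoly d v) ∧
      (zeroOnePoly d v).eval (-1) ≠ 0 ∧ ¬ IsExceptional (zeroOnePoly d v) B} : ℝ) ≤
    2 * Nat.card {v : Fin (d - 1) → Bool // IsExceptional (zeroOnePoly d v) B} +
    2 ^ (d - 1) * (2 * (A * d ^ 2 * k * (4 / 5) ^ k +
      ((1 + A * k * (4 / 5) ^ k) *
        (1 + 2 ^ (8 * k) * Real.exp (-2 * (1 / (8 * k : ℕ)) ^ 2) ^ W) - 1 +
      2 * d * (12 * d ^ 2 + 4 * d * B ^ 2) * (k * (1 / 2) ^ k)))) := by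
  classical
  obtain ⟨A₁, hA₁, hcomb⟩ := exists_combined_count
  obtain ⟨A₂, hA₂, hsum⟩ := exists_sum_primeWeight_le
  refine ⟨A₁ + A₂, by positivity, ?_⟩
  intro d hd hRH k B W hk hB hW hε
  set Q := 2 ^ (8 * k) * Real.exp (-2 * (1 / (8 * k : ℕ)) ^ 2) ^ W with hQ
  have hQ0 : 0 ≤ Q := by positivity
  set β : ℝ := 2 * d * (12 * d ^ 2 + 4 * d * B ^ 2) * (k * (1 / 2) ^ k) with hβ
  set ε : ℝ := (A₁ + A₂) * d ^ 2 * k * (4 / 5) ^ k with hεdef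
  set E : Finset (Fin (d - 1) → Bool) :=
    Finset.univ.filter fun v => IsExceptional (zeroOnePoly d v) B with hE
  set R : Finset (Fin (d - 1) → Bool) := Finset.univ.filter fun v =>
    ¬ Irreducible (zeroOnePoly d v) ∧ (zeroOnePoly d v).eval (-1) ≠ 0 ∧
      ¬ IsExceptional (zeroOnePoly d v) B with hR
  have hcE : Nat.card {v : Fin (d - 1) → Bool // IsExceptional (zeroOnePoly d v) B} = E.card := by
    rw [Nat.card_eq_fintype_card, Fintype.card_subtype]
  have hcR : Nat.card {v : Fin (d - 1) → Bool // ¬ Irreducible (zeroOnePoly d v) ∧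
      (zeroOnePoly d v).eval (-1) ≠ 0 ∧ ¬ IsExceptional (zeroOnePoly d v) B} = R.card := by
    rw [Nat.card_eq_fintype_card, Fintype.card_subtype]
  rw [hcE, hcR]
  set T := Nat.primesBelow (2 ^ (8 * k)) with hT
  have hpt : ∀ v : Fin (d - 1) → Bool,
      ((1 : ℝ) - (if v ∈ E then 1 else 0) + if v ∈ R then 1 else 0) * (1 - ε) ≤
        ∑ p ∈ T, primeWeight k p * nonTorsionRootCount (zeroOnePoly d v) B p + β := by
    intro v
    have hm := zeroOnePoly_monic v hd
    have hdeg := zeroOnePoly_natDegree v hd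
    by_cases hvE : v ∈ E
    · have hvR : v ∉ R := fun h => (Finset.mem_filter.1 h).2.2.2 (Finset.mem_filter.1 hvE).2
      rw [if_pos hvE, if_neg hvR]
      have : 0 ≤ ∑ p ∈ T, primeWeight k p * nonTorsionRootCount (zeroOnePoly d v) B p :=
        Finset.sum_nonneg fun p _ => mul_nonneg (primeWeight_nonneg k p) (Nat.cast_nonneg _)
      have : 0 ≤ β := by positivity
      linarith
    · have hvE' : ¬ IsExceptional (zeroOnePoly d v) B := fun h =>
        hvE (Finset.mem_filter.2 ⟨Finset.mem_univ _, h⟩)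
      unfold IsExceptional at hvE'
      push Not at hvE'
      obtain ⟨S, hS1, hS2, hS, hSR⟩ := exists_nonCyclotomic_factors hm (hdeg.symm ▸ hd)
        (eval_one_zeroOnePoly_ne_zero v) hvE'.1 (fun f j hj => hvE'.2 f j hj)
      have h := hcomb hm (fun z hz => norm_le_two_of_aeval_zeroOnePoly_eq_zero v hd hz)
        (fun z hz => hRH z ⟨_, hm.ne_zero, zeroOnePoly_coeff_eq v hd, hz⟩) hk B S hS2 hS
      rw [hdeg] at h
      refine le_trans ?_ h
      have hcard : ((1 : ℝ) - (if v ∈ E then 1 else 0) + if v ∈ R then 1 else 0) ≤ S.card := by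
        rw [if_neg hvE]
        by_cases hvR : v ∈ R
        · rw [if_pos hvR, hSR (Finset.mem_filter.1 hvR).2.1 (Finset.mem_filter.1 hvR).2.2.1]
          norm_num
        · rw [if_neg hvR]
          have : (1 : ℝ) ≤ S.card := by exact_mod_cast hS1
          linarith
      have h3 : A₁ * d ^ 2 * k * (4 / 5) ^ k ≤ ε := by
        rw [hεdef]
        have : A₁ ≤ A₁ + A₂ := by linarith
        gcongr
      refine mul_le_mul hcard (by linarith) (by linarith) (Nat.cast_nonneg _)
  have hsumv := Finset.sum_le_sum fun v
    (_ : v ∈ (Finset.univ : Finset (Fin (d - 1) → Bool))) => hpt v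
  have hΩ : ((Finset.univ : Finset (Fin (d - 1) → Bool)).card : ℝ) = 2 ^ (d - 1) := by
    simp
  rw [← Finset.sum_mul, Finset.sum_add_distrib, Finset.sum_sub_distrib, Finset.sum_boole,
    Finset.sum_boole, Finset.filter_univ_mem, Finset.filter_univ_mem, Finset.sum_const,
    Finset.sum_add_distrib, Finset.sum_const, nsmul_eq_mul, nsmul_eq_mul, hΩ, mul_one,
    Finset.sum_comm] at hsumv
  have hright : ∑ p ∈ T, ∑ v : Fin (d - 1) → Bool,
      primeWeight k p * (nonTorsionRootCount (zeroOnePoly d v) B p : ℝ) ≤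
        (1 + (A₁ + A₂) * k * (4 / 5) ^ k) * (2 ^ (d - 1) * (1 + Q)) := by
    calc _ ≤ ∑ p ∈ T, primeWeight k p * (2 ^ (d - 1) * (1 + Q)) := by
          refine Finset.sum_le_sum fun p hp => ?_
          rw [← Finset.mul_sum]
          exact mul_le_mul_of_nonneg_left (sum_nonTorsionRootCount_le hk hd hB hW
            (Nat.mem_primesBelow.1 hp).2 (Nat.mem_primesBelow.1 hp).1) (primeWeight_nonneg k p)
      _ ≤ _ := by
          rw [← Finset.sum_mul]
          refine mul_le_mul_of_nonneg_right ((hsum (hRH 0 ⟨X, X_ne_zero, fun i => ?_, by simp⟩) k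
            hk).trans ?_) (by positivity)
          · rw [coeff_X]; split_ifs <;> simp
          · have : A₂ ≤ A₁ + A₂ := by linarith
            gcongr
  have hRnn : (0 : ℝ) ≤ R.card := Nat.cast_nonneg _
  have hEnn : (0 : ℝ) ≤ E.card := Nat.cast_nonneg _
  have hε0 : 0 ≤ ε := by positivity
  have h5 := hsumv.trans (add_le_add hright le_rfl)
  have h6 : (R.card : ℝ) * (1 / 2) ≤ R.card * (1 - ε) :=
    mul_le_mul_of_nonneg_left (by linarith) hRnn
  have h7 : 0 ≤ (E.card : ℝ) * ε := by positivity
  nlinarith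

end Expectation

section Binomials

theorem centralBinom_sq_mul_le (n : ℕ) : n.centralBinom ^ 2 * (3 * n + 1) ≤ 16 ^ n := by
  induction n with
  | zero => simp
  | succ n ih =>
    have h := Nat.succ_mul_centralBinom_succ n
    have h2 : (n + 1) ^ 2 * ((n + 1).centralBinom ^ 2 * (3 * (n + 1) + 1)) ≤
        (n + 1) ^ 2 * 16 ^ (n + 1) := by
      calc (n + 1) ^ 2 * ((n + 1).centralBinom ^ 2 * (3 * (n + 1) + 1))
          = ((n + 1) * (n + 1).centralBinom) ^ 2 * (3 * (n + 1) + 1) := by ring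
        _ = n.centralBinom ^ 2 * (4 * (2 * n + 1) ^ 2 * (3 * n + 4)) := by rw [h]; ring
        _ ≤ n.centralBinom ^ 2 * (16 * (n + 1) ^ 2 * (3 * n + 1)) := by
            gcongr 1
            ring_nf
            gcongr <;> norm_num
        _ = 16 * (n + 1) ^ 2 * (n.centralBinom ^ 2 * (3 * n + 1)) := by ring
        _ ≤ 16 * (n + 1) ^ 2 * 16 ^ n := by gcongr
        _ = _ := by ring
    exact Nat.le_of_mul_le_mul_left h2 (by positivity)

theorem two_mul_choose_two_mul_add_one (n : ℕ) :
    2 * (2 * n + 1).choose n = (n + 1).centralBinom := by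
  rw [Nat.centralBinom_eq_two_mul_choose, show 2 * (n + 1) = 2 * n + 1 + 1 by ring,
    Nat.choose_succ_succ, ← Nat.choose_symm_half, two_mul]

theorem choose_half_sq_mul_le (m : ℕ) : m.choose (m / 2) ^ 2 * m ≤ 4 ^ m := by
  rcases Nat.even_or_odd' m with ⟨n, rfl | rfl⟩
  · rw [Nat.mul_div_cancel_left _ two_pos, ← Nat.centralBinom_eq_two_mul_choose, pow_mul]
    exact (Nat.mul_le_mul_left _ (by omega)).trans (centralBinom_sq_mul_le n)
  · rw [show (2 * n + 1) / 2 = n by omega]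
    have h := centralBinom_sq_mul_le (n + 1)
    rw [← two_mul_choose_two_mul_add_one] at h
    have h2 : 4 * ((2 * n + 1).choose n ^ 2 * (2 * n + 1)) ≤ 4 * 4 ^ (2 * n + 1) := by
      calc _ = (2 * (2 * n + 1).choose n) ^ 2 * (2 * n + 1) := by ring
        _ ≤ (2 * (2 * n + 1).choose n) ^ 2 * (3 * (n + 1) + 1) := by gcongr 2 <;> omega
        _ ≤ _ := h
        _ = _ := by rw [show 16 = 4 ^ 2 by norm_num, ← pow_mul, ← pow_succ']; congr 1
    omega

theorem sq_centralBinom_div (n : ℕ) :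
    ((n.centralBinom : ℝ) / 4 ^ n) ^ 2 = 1 / (Real.Wallis.W n * (2 * n + 1)) := by
  rw [Real.Wallis.W_eq_factorial_ratio]
  have h : (n.centralBinom : ℝ) * (n.factorial * n.factorial) = (2 * n).factorial := by
    have := Nat.choose_mul_factorial_mul_factorial (n := 2 * n) (k := n) (by omega)
    rw [show 2 * n - n = n by omega] at this
    rw [Nat.centralBinom_eq_two_mul_choose, ← mul_assoc]
    exact_mod_cast this
  rw [← h]
  have h1 : (n.factorial : ℝ) ≠ 0 := by exact_mod_cast n.factorial_ne_zero
  have h2 : (n.centralBinom : ℝ) ≠ 0 := by exact_mod_cast n.centralBinom_ne_zero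
  have h3 : (2 : ℝ) ^ (4 * n) = (4 ^ n) ^ 2 := by
    rw [← pow_mul, mul_comm n 2, pow_mul, pow_mul]; norm_num
  have h4 : (2 * n + 1 : ℝ) ≠ 0 := by positivity
  rw [h3]
  field_simp

theorem centralBinom_div_bounds (n : ℕ) :
    2 / (Real.pi * (2 * n + 1)) ≤ ((n.centralBinom : ℝ) / 4 ^ n) ^ 2 ∧
    ((n.centralBinom : ℝ) / 4 ^ n) ^ 2 ≤ 2 * (2 * n + 2) / (Real.pi * (2 * n + 1) ^ 2) := by
  rw [sq_centralBinom_div]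
  have hπ := Real.pi_pos
  have h1 := Real.Wallis.W_le n
  have h2 := Real.Wallis.le_W n
  have h3 := Real.Wallis.W_pos n
  constructor
  · rw [div_le_div_iff₀ (by positivity) (by positivity)]
    nlinarith [mul_le_mul_of_nonneg_right h1 (by positivity : (0 : ℝ) ≤ 2 * n + 1)]
  · have h4 : (2 * n + 1 : ℝ) / (2 * n + 2) * (Real.pi / 2) * (2 * n + 1) ≤
        Real.Wallis.W n * (2 * n + 1) := by gcongr
    refine (one_div_le_one_div_of_le (by positivity) h4).trans_eq ?_
    field_simp

theorem abs_centralBinom_div_sub_le {d k : ℕ} (hd : 2 ≤ d) (h : d = 2 * k ∨ d = 2 * k + 1) :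
    |(k.centralBinom : ℝ) / 4 ^ k - √(2 / (Real.pi * d))| ≤ 1 / d := by
  have hd0 : (2 : ℝ) ≤ d := by exact_mod_cast hd
  have hπ := Real.pi_gt_three
  set b := (k.centralBinom : ℝ) / 4 ^ k with hb
  have hb0 : 0 ≤ b := by positivity
  set s := √(2 / (Real.pi * d)) with hs
  have hs0 : 0 ≤ s := Real.sqrt_nonneg _
  have hs2 : s ^ 2 = 2 / (Real.pi * d) := Real.sq_sqrt (by positivity)
  have hs1 : s ≤ 1 := by
    refine Real.sqrt_le_one.2 ?_ 
    rw [div_le_one (by positivity)]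
    nlinarith
  obtain ⟨h1, h2⟩ := centralBinom_div_bounds k
  rw [← hb] at h1 h2
  have hlow : s * (1 - 1 / d) ≤ b := by
    have h3 : 0 ≤ 1 - 1 / (d : ℝ) := by
      rw [sub_nonneg, div_le_one (by linarith)]; linarith
    refine abs_le_of_sq_le_sq' ?_ hb0 |>.2
    refine le_trans ?_ h1
    rw [mul_pow, hs2]
    have h4 : (1 - 1 / (d : ℝ)) ^ 2 ≤ d / (d + 1) := by
      rw [show (1 - 1 / (d : ℝ)) = (d - 1) / d by field_simp, div_pow,
        div_le_div_iff₀ (by positivity) (by positivity)]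
      nlinarith
    refine (mul_le_mul_of_nonneg_left h4 (by positivity)).trans ?_
    rw [show 2 / (Real.pi * d) * (d / (d + 1)) = 2 / (Real.pi * (d + 1 : ℝ)) by field_simp]
    have h5 : (2 * k : ℝ) ≤ d := by
      have : 2 * k ≤ d := by omega
      exact_mod_cast this
    gcongr
  have hhigh : b ≤ s * (1 + 1 / d) := by
    refine abs_le_of_sq_le_sq' ?_ (by positivity) |>.2
    refine h2.trans ?_
    rw [mul_pow, hs2]
    have h5 : (d : ℝ) ≤ 2 * k + 1 := by
      have : d ≤ 2 * k + 1 := by omega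
      exact_mod_cast this
    have h6 : (2 * k + 2 : ℝ) / (2 * k + 1) ^ 2 ≤ (d + 1) / d ^ 2 := by
      rw [div_le_div_iff₀ (by positivity) (by positivity)]
      nlinarith [mul_nonneg (sub_nonneg.2 h5) (by positivity : (0:ℝ) ≤ d), 
        mul_nonneg (mul_nonneg (sub_nonneg.2 h5) (by positivity : (0:ℝ) ≤ d)) 
          (by positivity : (0:ℝ) ≤ 2 * k + 1)]
    calc 2 * (2 * k + 2 : ℝ) / (Real.pi * (2 * k + 1) ^ 2)
        = 2 / Real.pi * ((2 * k + 2 : ℝ) / (2 * k + 1) ^ 2) := by field_simp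
      _ ≤ 2 / Real.pi * ((d + 1) / d ^ 2) := by gcongr
      _ = 2 / (Real.pi * d) * (1 + 1 / d) := by field_simp
      _ ≤ 2 / (Real.pi * d) * (1 + 1 / d) ^ 2 := by
          refine mul_le_mul_of_nonneg_left ?_ (by positivity)
          refine le_self_pow₀ ?_ two_ne_zero
          have : 0 ≤ 1 / (d : ℝ) := by positivity
          linarith
  have h7 : s * (1 / d) ≤ 1 / d := mul_le_of_le_one_left (by positivity) hs1
  rw [abs_le]
  constructor <;> linarith

theorem card_boolVec_count_eq {ι : Type*} [Fintype ι] [DecidableEq ι] (s : ℕ) :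
    (Finset.univ.filter fun x : ι → Bool =>
      (Finset.univ.filter fun i => x i = true).card = s).card = (Fintype.card ι).choose s := by
  rw [← Finset.card_univ, ← Finset.card_powersetCard]
  refine Finset.card_bij (fun x _ => Finset.univ.filter fun i => x i = true) ?_ ?_ ?_
  · intro x hx
    exact Finset.mem_powersetCard.2 ⟨Finset.subset_univ _, (Finset.mem_filter.1 hx).2⟩
  · intro x _ y _ h
    funext i
    have := congrArg (i ∈ ·) h
    simp only [Finset.mem_filter, Finset.mem_univ, true_and, eq_iff_iff] at this
    exact Bool.eq_iff_iff.2 this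
  · intro t ht
    have h : (Finset.univ.filter fun i => (decide (i ∈ t)) = true) = t := by ext; simp
    exact ⟨fun i => decide (i ∈ t), Finset.mem_filter.2 ⟨Finset.mem_univ _, by
      rw [h]; exact (Finset.mem_powersetCard.1 ht).2⟩, h⟩

end Binomials

section MinusOne

theorem sum_range_mod_two (n : ℕ) : ∑ i ∈ Finset.range n, (i % 2 : ℤ) = (n / 2 : ℕ) := by
  induction n with
  | zero => simp
  | succ n ih => rw [Finset.sum_range_succ, ih]; push_cast; omega

theorem eval_neg_one_zeroOnePoly (d : ℕ) (v : Fin (d - 1) → Bool) :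
    (zeroOnePoly d v).eval (-1) = (-1) ^ d + 1 + ((d - 1) / 2 : ℕ) -
      (Finset.univ.filter fun i : Fin (d - 1) => (xor (v i) (decide ((i : ℕ) % 2 = 1)))
        = true).card := by
  have h1 : ∀ i : Fin (d - 1), (if v i then (1 : ℤ) else 0) * (-1) ^ ((i : ℕ) + 1) =
      ((i : ℕ) % 2 : ℤ) - if (xor (v i) (decide ((i : ℕ) % 2 = 1))) = true then 1 else 0 := by
    intro i
    rcases Nat.even_or_odd (i : ℕ) with h | h
    · have h2 := Nat.even_iff.1 h
      have h3 : ((i : ℕ) : ℤ) % 2 = 0 := by omega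
      rw [h.add_one.neg_one_pow, h3, h2]
      cases v i <;> simp
    · have h2 := Nat.odd_iff.1 h
      have h3 : ((i : ℕ) : ℤ) % 2 = 1 := by omega
      rw [h.add_one.neg_one_pow, h3, h2]
      cases v i <;> simp
  have h2 : (zeroOnePoly d v).eval (-1) = (-1) ^ d + 1 +
      ∑ i : Fin (d - 1), (if v i then (1 : ℤ) else 0) * (-1) ^ ((i : ℕ) + 1) := by
    simp only [zeroOnePoly, eval_add, eval_pow, eval_X, eval_one, eval_finsetSum, eval_mul, eval_C]
  rw [h2, Finset.sum_congr rfl fun i _ => h1 i, Finset.sum_sub_distrib, Finset.sum_boole,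
    Fin.sum_univ_eq_sum_range (fun i => (i % 2 : ℤ)), sum_range_mod_two]
  ring

theorem card_eval_neg_one_eq_zero (d s : ℕ) (hs : (s : ℤ) = (-1) ^ d + 1 + ((d - 1) / 2 : ℕ)) :
    Nat.card {v : Fin (d - 1) → Bool // (zeroOnePoly d v).eval (-1) = 0} = (d - 1).choose s := by
  have h := card_boolVec_count_eq (ι := Fin (d - 1)) s
  rw [Fintype.card_fin] at h
  rw [← h, Nat.card_eq_fintype_card, Fintype.card_subtype]
  refine Finset.card_bij (fun v _ i => xor (v i) (decide ((i : ℕ) % 2 = 1))) ?_ ?_ ?_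
  · intro v hv
    have h1 := (Finset.mem_filter.1 hv).2
    rw [eval_neg_one_zeroOnePoly, ← hs] at h1
    exact Finset.mem_filter.2 ⟨Finset.mem_univ _, by beta_reduce; omega⟩
  · intro v _ w _ h
    funext i
    simpa using congrFun h i
  · intro u hu
    have h1 := (Finset.mem_filter.1 hu).2
    have h2 : (fun i => xor (xor (u i) (decide ((i : ℕ) % 2 = 1)))
      (decide ((i : ℕ) % 2 = 1))) = u := by
      funext i; simp
    refine ⟨fun i => xor (u i) (decide ((i : ℕ) % 2 = 1)), Finset.mem_filter.2
      ⟨Finset.mem_univ _, ?_⟩, h2⟩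
    rw [eval_neg_one_zeroOnePoly, ← hs]
    simp only [Bool.xor_assoc, Bool.xor_self, Bool.xor_false]
    omega

theorem abs_card_eval_neg_one_sub_le {d : ℕ} (hd : 2 ≤ d) :
    |(Nat.card {v : Fin (d - 1) → Bool // (zeroOnePoly d v).eval (-1) = 0} : ℝ) / 2 ^ (d - 1) -
      √(2 / (Real.pi * d))| ≤ 5 / d := by
  have hd0 : (0 : ℝ) < d := by positivity
  rcases Nat.even_or_odd' d with ⟨k, hk | hk⟩
  · have h := abs_centralBinom_div_sub_le hd (Or.inl hk)
    have hk1 : 1 ≤ k := by omega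
    rw [card_eval_neg_one_eq_zero d (k + 1) (by
      rw [hk, (even_two_mul k).neg_one_pow]; push_cast; omega)]
    have h1 := Nat.choose_succ_right_eq (d - 1) k
    have h2 : 2 * (d - 1).choose k = k.centralBinom := by
      obtain ⟨j, rfl⟩ : ∃ j, k = j + 1 := ⟨k - 1, by omega⟩
      rw [← two_mul_choose_two_mul_add_one, show d - 1 = 2 * j + 1 by omega,
        Nat.choose_symm_half]
    have h3 : (2 : ℝ) * 2 ^ (d - 1) = 4 ^ k := by
      rw [← pow_succ', show d - 1 + 1 = 2 * k by omega, pow_mul]; norm_num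
    have h4 : ((d - 1).choose (k + 1) : ℝ) / 2 ^ (d - 1) =
        (k.centralBinom : ℝ) / 4 ^ k * (1 - 2 / (k + 1)) := by
      have h1' : ((d - 1).choose (k + 1) : ℝ) * (k + 1) = (d - 1).choose k * (k - 1) := by
        rw [show d - 1 - k = k - 1 by omega] at h1
        have := congrArg (Nat.cast : ℕ → ℝ) h1
        push_cast [Nat.cast_sub hk1] at this
        exact this
      rw [← h2, ← h3]
      push_cast
      rw [mul_div_mul_left _ _ two_ne_zero]
      field_simp
      linarith
    rw [h4]
    set b := (k.centralBinom : ℝ) / 4 ^ k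
    have hb0 : 0 ≤ b := by positivity
    have hb1 : b ≤ 1 := by
      refine (div_le_one (by positivity)).2 ?_
      have := centralBinom_sq_mul_le k
      have h16 : k.centralBinom ^ 2 ≤ (4 ^ k) ^ 2 := by
        rw [← pow_mul, mul_comm k, pow_mul]
        exact (Nat.le_mul_of_pos_right _ (by omega)).trans this
      exact_mod_cast (Nat.pow_le_pow_iff_left two_ne_zero).1 h16
    have h5 : b * (2 / (k + 1)) ≤ 4 / d := by
      have h6 : (2 : ℝ) / (k + 1) ≤ 4 / d := by
        rw [div_le_div_iff₀ (by positivity) hd0, hk]; push_cast; linarith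
      exact (mul_le_of_le_one_left (by positivity) hb1).trans h6
    have h6 : 0 ≤ b * (2 / (k + 1)) := by positivity
    rw [abs_le] at h ⊢
    have h7 : (5 : ℝ) / d = 1 / d + 4 / d := by rw [← add_div]; norm_num
    constructor <;> linarith
  · rw [card_eval_neg_one_eq_zero d k (by
      rw [hk, (odd_two_mul_add_one k).neg_one_pow]; push_cast; omega)]
    have h := abs_centralBinom_div_sub_le hd (Or.inr hk)
    have h1 : ((d - 1).choose k : ℝ) / 2 ^ (d - 1) = (k.centralBinom : ℝ) / 4 ^ k := by
      rw [show d - 1 = 2 * k by omega, ← Nat.centralBinom_eq_two_mul_choose, pow_mul]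
      norm_num
    rw [h1]
    refine h.trans ?_
    gcongr
    norm_num

end MinusOne

section SmallFactors

theorem card_le_of_determined_counts {ι : Type*} [Fintype ι] [DecidableEq ι] {t m : ℕ}
    {e : Fin t × Fin m → ι} (he : Function.Injective e) (E : Finset (ι → Bool))
    (h : ∀ v ∈ E, ∀ w ∈ E, (∀ i, i ∉ Finset.univ.image e → v i = w i) → ∀ i,
      (Finset.univ.filter fun q => v (e (i, q)) = true).card =
        (Finset.univ.filter fun q => w (e (i, q)) = true).card) :
    E.card ≤ m.choose (m / 2) ^ t * 2 ^ (Fintype.card ι - t * m) := by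
  set S : Finset ι := Finset.univ.image e with hS
  have hScard : S.card = t * m := by
    rw [hS, Finset.card_image_of_injective _ he, Finset.card_univ, Fintype.card_prod,
      Fintype.card_fin, Fintype.card_fin]
  let f : (ι → Bool) → ({i // i ∉ S} → Bool) := fun v i => v i
  refine (Finset.card_le_mul_card_image (f := f) E (m.choose (m / 2) ^ t) fun b hb => ?_).trans ?_
  · obtain ⟨v, hv, rfl⟩ := Finset.mem_image.1 hb
    have hagree : ∀ x, f x = f v → ∀ i, i ∉ S → x i = v i := fun x hx i hi =>
      congrFun hx ⟨i, hi⟩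
    calc (E.filter fun x => f x = f v).card
        ≤ (Fintype.piFinset fun i : Fin t => Finset.univ.filter fun y : Fin m → Bool =>
            (Finset.univ.filter fun q => y q = true).card =
              (Finset.univ.filter fun q => v (e (i, q)) = true).card).card := by
          refine Finset.card_le_card_of_injOn (fun x i q => x (e (i, q))) ?_ ?_
          · intro x hx
            obtain ⟨hxE, hxv⟩ := Finset.mem_filter.1 hx
            refine Finset.mem_coe.2 (Fintype.mem_piFinset.2 fun i => Finset.mem_filter.2
              ⟨Finset.mem_univ _, h x hxE v hv (hagree x hxv) i⟩)
          · intro x hx y hy hxy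
            have hx' := hagree x (Finset.mem_filter.1 hx).2
            have hy' := hagree y (Finset.mem_filter.1 hy).2
            funext i
            by_cases hi : i ∈ S
            · obtain ⟨⟨j, q⟩, -, rfl⟩ := Finset.mem_image.1 hi
              exact congrFun (congrFun hxy j) q
            · rw [hx' i hi, hy' i hi]
      _ ≤ m.choose (m / 2) ^ t := by
          rw [Fintype.card_piFinset]
          refine (Finset.prod_le_pow_card _ _ (m.choose (m / 2)) fun i _ => ?_).trans (by simp)
          rw [card_boolVec_count_eq, Fintype.card_fin]
          exact Nat.choose_le_middle _ _
  · refine Nat.mul_le_mul_left _ ((Finset.card_le_univ _).trans_eq ?_)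
    rw [Fintype.card_fun, Fintype.card_bool, Fintype.card_subtype_compl, Fintype.card_coe, hScard]

theorem card_cyclotomic_dvd_le {d r t : ℕ} (hr : 2 ≤ r) (ht : t ≤ r.totient) :
    Nat.card {v : Fin (d - 1) → Bool // cyclotomic r ℤ ∣ zeroOnePoly d v} ≤
      ((d - 1) / r).choose ((d - 1) / r / 2) ^ t * 2 ^ (d - 1 - t * ((d - 1) / r)) := by
  classical
  set m := (d - 1) / r with hm
  have hmr : r * m ≤ d - 1 := Nat.mul_div_le _ _
  have htr : t < r := ht.trans_lt (Nat.totient_lt r hr)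
  have hidx : ∀ x : Fin t × Fin m, (x.1 : ℕ) + r * x.2 < d - 1 := by
    rintro ⟨⟨i, hi⟩, ⟨q, hq⟩⟩
    have : r * (q + 1) ≤ r * m := Nat.mul_le_mul_left _ hq
    simp only
    rw [mul_add, mul_one] at this
    omega
  let e : Fin t × Fin m → Fin (d - 1) := fun x => ⟨(x.1 : ℕ) + r * x.2, hidx x⟩
  have he : Function.Injective e := by
    rintro ⟨⟨i, hi⟩, ⟨q, hq⟩⟩ ⟨⟨i', hi'⟩, ⟨q', hq'⟩⟩ h
    have h1 : i + r * q = i' + r * q' := congrArg Fin.val h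
    have h2 := congrArg (· % r) h1
    simp only [Nat.add_mul_mod_self_left] at h2
    rw [Nat.mod_eq_of_lt (hi.trans htr), Nat.mod_eq_of_lt (hi'.trans htr)] at h2
    subst h2
    have h3 : q = q' := Nat.eq_of_mul_eq_mul_left (by omega : 0 < r) (by omega)
    subst h3
    rfl
  have key := card_le_of_determined_counts he
    (Finset.univ.filter fun v => cyclotomic r ℤ ∣ zeroOnePoly d v) ?_
  · rwa [Fintype.card_fin, ← Fintype.card_subtype, ← Nat.card_eq_fintype_card] at key
  intro v hv w hw hvw
  replace hv := (Finset.mem_filter.1 hv).2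
  replace hw := (Finset.mem_filter.1 hw).2
  set ζ := Complex.exp (2 * Real.pi * Complex.I / r) with hζdef
  have hζ : IsPrimitiveRoot ζ r := Complex.isPrimitiveRoot_exp r (by omega)
  have hζr : ζ ^ r = 1 := hζ.pow_eq_one
  have hζ0 : ζ ≠ 0 := hζ.ne_zero (by omega)
  have hΦ : aeval ζ (cyclotomic r ℤ) = 0 := by
    have := hζ.isRoot_cyclotomic (by omega : 0 < r)
    rwa [IsRoot.def, ← map_cyclotomic_int, eval_map] at this
  have hroot : ∀ u : Fin (d - 1) → Bool, cyclotomic r ℤ ∣ zeroOnePoly d u →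
      ζ ^ d + 1 + ∑ i : Fin (d - 1), (if u i then (1 : ℂ) else 0) * ζ ^ ((i : ℕ) + 1) = 0 := by
    rintro u ⟨q, hq⟩
    have h1 : aeval ζ (zeroOnePoly d u) = 0 := by rw [hq, map_mul, hΦ, zero_mul]
    refine Eq.trans ?_ h1
    simp [zeroOnePoly, apply_ite]
  have h1 : ∑ i : Fin (d - 1), ((if v i then (1 : ℂ) else 0) - if w i then 1 else 0) *
      ζ ^ ((i : ℕ) + 1) = 0 := by
    simp_rw [sub_mul]
    rw [Finset.sum_sub_distrib]
    linear_combination hroot v hv - hroot w hw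
  have h2 : ∑ i ∈ Finset.univ.image e, ((if v i then (1 : ℂ) else 0) - if w i then 1 else 0) *
      ζ ^ ((i : ℕ) + 1) = 0 := by
    refine (Finset.sum_subset (Finset.subset_univ _) fun i _ hi => ?_).trans h1
    rw [hvw i hi, sub_self, zero_mul]
  rw [Finset.sum_image he.injOn, Fintype.sum_prod_type] at h2
  set δ : Fin t → ℤ := fun i =>
    (Finset.univ.filter fun q : Fin m => v (e (i, q)) = true).card -
      (Finset.univ.filter fun q : Fin m => w (e (i, q)) = true).card with hδ
  have h3 : ζ * ∑ i : Fin t, (δ i : ℂ) * ζ ^ (i : ℕ) = 0 := by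
    rw [← h2, Finset.mul_sum]
    refine Finset.sum_congr rfl fun i _ => ?_
    have h4 : ∀ q : Fin m, ζ ^ (((e (i, q) : Fin (d - 1)) : ℕ) + 1) = ζ * ζ ^ (i : ℕ) := by
      intro q
      simp only [e]
      rw [pow_succ', pow_add, pow_mul, hζr, one_pow, mul_one]
    simp_rw [h4, ← Finset.sum_mul]
    rw [Finset.sum_sub_distrib, Finset.sum_boole, Finset.sum_boole, hδ]
    push_cast
    ring
  set D : ℤ[X] := ∑ i : Fin t, C (δ i) * X ^ (i : ℕ) with hD
  have hDζ : aeval ζ D = 0 := by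
    have := (mul_eq_zero.1 h3).resolve_left hζ0
    rw [← this, hD, map_sum]
    simp
  have hdvd : cyclotomic r ℤ ∣ D := by
    rw [cyclotomic_eq_minpoly hζ (by omega)]
    exact minpoly.isIntegrallyClosed_dvd (hζ.isIntegral (by omega)) hDζ
  have hD0 : D = 0 := by
    by_contra hne
    have h5 := natDegree_le_of_dvd hdvd hne
    rw [natDegree_cyclotomic] at h5
    have ht0 : 0 < t := by
      rcases Nat.eq_zero_or_pos t with rfl | h
      · simp [hD] at hne
      · exact h
    have h6 : D.natDegree ≤ t - 1 := natDegree_sum_le_of_forall_le _ _ fun i _ =>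
      (natDegree_C_mul_X_pow_le _ _).trans (by omega)
    omega
  intro i
  have h7 : D.coeff i = δ i := by
    rw [hD, finsetSum_coeff, Finset.sum_eq_single i]
    · simp
    · intro j _ hj
      rw [coeff_C_mul, coeff_X_pow, if_neg fun h => hj (Fin.ext h.symm), mul_zero]
    · simp
  rw [hD0, coeff_zero, hδ] at h7
  simp only at h7
  omega

theorem four_le_totient {r : ℕ} (hr : 5 ≤ r) (h6 : r ≠ 6) : 4 ≤ r.totient := by
  have key : ∀ a b : ℕ, 1 < a → a < b → b < r - 1 → r.Coprime a → r.Coprime b → 4 ≤ r.totient := by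
    intro a b h1 h2 h3 ha hb
    rw [Nat.totient_eq_card_coprime]
    have hc : ({1, a, b, r - 1} : Finset ℕ).card = 4 := by
      rw [Finset.card_insert_of_notMem, Finset.card_insert_of_notMem, Finset.card_pair] <;>
        simp <;> omega
    rw [← hc]
    refine Finset.card_le_card fun x hx => ?_
    simp only [Finset.mem_insert, Finset.mem_singleton] at hx
    refine Finset.mem_filter.2 ⟨Finset.mem_range.2 (by omega), ?_⟩
    rcases hx with rfl | rfl | rfl | rfl
    · simp
    · exact ha
    · exact hb
    · exact (Nat.coprime_self_sub_right (by omega)).2 (by simp)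
  rcases (by omega : r % 2 = 1 ∨ r % 4 = 0 ∨ r % 4 = 2) with h | h | h
  · have h2 : r.Coprime 2 := (Nat.coprime_two_right).2 (Nat.odd_iff.2 h)
    exact key 2 (r - 2) (by omega) (by omega) (by omega) h2
      ((Nat.coprime_self_sub_right (by omega)).2 h2)
  · obtain ⟨k, rfl⟩ : ∃ k, r = 4 * k := ⟨r / 4, by omega⟩
    have h2 : (4 * k).Coprime (2 * k + 1) := by
      have : Nat.Coprime (2 * (2 * k)) (2 * k + 1) := Nat.Coprime.mul_left
        ((Nat.coprime_two_left).2 (odd_two_mul_add_one k)) (by simp)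
      rwa [← mul_assoc] at this
    refine key (2 * k - 1) (2 * k + 1) (by omega) (by omega) (by omega) ?_ h2
    rw [show 2 * k - 1 = 4 * k - (2 * k + 1) by omega]
    exact (Nat.coprime_self_sub_right (by omega)).2 h2
  · obtain ⟨k, rfl⟩ : ∃ k, r = 4 * k + 2 := ⟨r / 4, by omega⟩
    have h2 : (4 * k + 2).Coprime (2 * k + 3) := by
      have h4 : Nat.Coprime (2 * k + 1) (2 * k + 1 + 2) := by
        rw [Nat.coprime_self_add_right]
        exact (Nat.coprime_two_right).2 (odd_two_mul_add_one k)
      have : Nat.Coprime (2 * (2 * k + 1)) (2 * k + 3) := Nat.Coprime.mul_left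
        ((Nat.coprime_two_left).2 ⟨k + 1, by ring⟩) h4
      rwa [show 2 * (2 * k + 1) = 4 * k + 2 by ring] at this
    refine key (2 * k - 1) (2 * k + 3) (by omega) (by omega) (by omega) ?_ h2
    rw [show 2 * k - 1 = 4 * k + 2 - (2 * k + 3) by omega]
    exact (Nat.coprime_self_sub_right (by omega)).2 h2

end SmallFactors

theorem card_cyclotomic_dvd_mul_sq_le {d r : ℕ} (hr : 3 ≤ r) (hrd : r < d) :
    Nat.card {v : Fin (d - 1) → Bool // cyclotomic r ℤ ∣ zeroOnePoly d v} * d ^ 2 ≤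
      2 ^ (d - 1) * ((if r ≤ 6 then 12 * d else 0) + 4 * r ^ 2) := by
  set N := Nat.card {v : Fin (d - 1) → Bool // cyclotomic r ℤ ∣ zeroOnePoly d v} with hN
  set m := (d - 1) / r with hm
  have hrm : d ≤ 2 * r * m := by
    have h1 : 1 ≤ m := (Nat.one_le_div_iff (by omega)).2 (by omega)
    have h2 : d - 1 < r * (m + 1) := by
      have := Nat.lt_mul_div_succ (d - 1) (show 0 < r by omega)
      exact this
    have h3 : d ≤ r * m + r := by rw [mul_add, mul_one] at h2; omega
    have h4 : r ≤ r * m := Nat.le_mul_of_pos_right r h1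
    rw [mul_assoc, two_mul]
    omega
  have hmr : r * m ≤ d - 1 := Nat.mul_div_le _ _
  have hc := choose_half_sq_mul_le m
  by_cases h : 5 ≤ r ∧ r ≠ 6
  · have ht := card_cyclotomic_dvd_le (d := d) (by omega : 2 ≤ r) (four_le_totient h.1 h.2)
    rw [← hN, ← hm] at ht
    have h4 : 4 * m ≤ d - 1 := le_trans (Nat.mul_le_mul_right _ (by omega)) hmr
    have hNm : N * m ^ 2 ≤ 2 ^ (d - 1) := by
      calc N * m ^ 2 ≤ (m.choose (m / 2) ^ 4 * 2 ^ (d - 1 - 4 * m)) * m ^ 2 :=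
            Nat.mul_le_mul_right _ ht
        _ = (m.choose (m / 2) ^ 2 * m) ^ 2 * 2 ^ (d - 1 - 4 * m) := by ring
        _ ≤ (4 ^ m) ^ 2 * 2 ^ (d - 1 - 4 * m) := by gcongr
        _ = 2 ^ (4 * m) * 2 ^ (d - 1 - 4 * m) := by
            rw [← pow_mul, show (4 : ℕ) = 2 ^ 2 by norm_num, ← pow_mul]; congr 2; ring
        _ = 2 ^ (d - 1) := by rw [← pow_add]; congr 1; omega
    calc N * d ^ 2 ≤ N * (2 * r * m) ^ 2 := by gcongr
      _ = (N * m ^ 2) * (4 * r ^ 2) := by ring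
      _ ≤ 2 ^ (d - 1) * (4 * r ^ 2) := by gcongr
      _ ≤ _ := by gcongr; omega
  · have h6 : r ≤ 6 := by omega
    have ht2 : 2 ≤ r.totient := by
      have : r = 3 ∨ r = 4 ∨ r = 6 := by omega
      rcases this with rfl | rfl | rfl <;> decide
    have ht := card_cyclotomic_dvd_le (d := d) (by omega : 2 ≤ r) ht2
    rw [← hN, ← hm] at ht
    have h4 : 2 * m ≤ d - 1 := le_trans (Nat.mul_le_mul_right _ (by omega)) hmr
    have hNm : N * m ≤ 2 ^ (d - 1) := by
      calc N * m ≤ (m.choose (m / 2) ^ 2 * 2 ^ (d - 1 - 2 * m)) * m :=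
            Nat.mul_le_mul_right _ ht
        _ = (m.choose (m / 2) ^ 2 * m) * 2 ^ (d - 1 - 2 * m) := by ring
        _ ≤ 4 ^ m * 2 ^ (d - 1 - 2 * m) := by gcongr
        _ = 2 ^ (2 * m) * 2 ^ (d - 1 - 2 * m) := by
            rw [show (4 : ℕ) = 2 ^ 2 by norm_num, ← pow_mul]
        _ = 2 ^ (d - 1) := by rw [← pow_add]; congr 1; omega
    rw [if_pos h6]
    calc N * d ^ 2 = N * d * d := by ring
      _ ≤ N * (2 * r * m) * d := by gcongr
      _ = (N * m) * (2 * r * d) := by ring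
      _ ≤ 2 ^ (d - 1) * (12 * d) := by gcongr; omega
      _ ≤ _ := by gcongr; omega

theorem card_exists_cyclotomic_dvd_mul_le {d B : ℕ} (hB : B ^ 3 ≤ d) :
    Nat.card {v : Fin (d - 1) → Bool //
      ∃ r, 3 ≤ r ∧ r ≤ B ∧ cyclotomic r ℤ ∣ zeroOnePoly d v} * d ≤ 2 ^ (d - 1) * 52 := by
  classical
  rcases Nat.eq_zero_or_pos d with rfl | hd
  · simp
  set F : ℕ → Finset (Fin (d - 1) → Bool) := fun r =>
    Finset.univ.filter fun v => cyclotomic r ℤ ∣ zeroOnePoly d v with hF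
  have hcard : ∀ r, (F r).card =
      Nat.card {v : Fin (d - 1) → Bool // cyclotomic r ℤ ∣ zeroOnePoly d v} := fun r => by
    rw [Nat.card_eq_fintype_card, Fintype.card_subtype]
  have hU : Nat.card {v : Fin (d - 1) → Bool //
      ∃ r, 3 ≤ r ∧ r ≤ B ∧ cyclotomic r ℤ ∣ zeroOnePoly d v} ≤
      ∑ r ∈ Finset.Icc 3 B, (F r).card := by
    rw [Nat.card_eq_fintype_card, Fintype.card_subtype]
    refine le_trans (Finset.card_le_card ?_) Finset.card_biUnion_le
    intro v hv
    obtain ⟨r, h1, h2, h3⟩ := (Finset.mem_filter.1 hv).2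
    exact Finset.mem_biUnion.2 ⟨r, Finset.mem_Icc.2 ⟨h1, h2⟩, by simpa [hF] using h3⟩
  refine Nat.le_of_mul_le_mul_right ?_ hd
  calc _ = Nat.card {v : Fin (d - 1) → Bool //
      ∃ r, 3 ≤ r ∧ r ≤ B ∧ cyclotomic r ℤ ∣ zeroOnePoly d v} * d ^ 2 := by ring
    _ ≤ (∑ r ∈ Finset.Icc 3 B, (F r).card) * d ^ 2 := Nat.mul_le_mul_right _ hU
    _ = ∑ r ∈ Finset.Icc 3 B, (F r).card * d ^ 2 := Finset.sum_mul ..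
    _ ≤ ∑ r ∈ Finset.Icc 3 B, 2 ^ (d - 1) * ((if r ≤ 6 then 12 * d else 0) + 4 * B ^ 2) := by
        refine Finset.sum_le_sum fun r hr => ?_
        obtain ⟨h3, hrB⟩ := Finset.mem_Icc.1 hr
        rw [hcard]
        refine (card_cyclotomic_dvd_mul_sq_le h3 ?_).trans (by gcongr)
        have : r ^ 3 ≤ d := (Nat.pow_le_pow_left hrB 3).trans hB
        nlinarith [Nat.mul_le_mul h3 h3]
    _ ≤ 2 ^ (d - 1) * (4 * (12 * d) + B * (4 * B ^ 2)) := by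
        rw [← Finset.mul_sum, Finset.sum_add_distrib]
        refine Nat.mul_le_mul_left _ (Nat.add_le_add ?_ ?_)
        · rw [← Finset.sum_filter, Finset.sum_const, smul_eq_mul]
          refine Nat.mul_le_mul_right _ ?_
          refine (Finset.card_le_card (t := Finset.Icc 3 6) ?_).trans (by simp)
          intro r hr
          simp only [Finset.mem_filter, Finset.mem_Icc] at hr ⊢
          omega
        · rw [Finset.sum_const, smul_eq_mul]
          exact Nat.mul_le_mul_right _ (by simp)
    _ ≤ _ := by nlinarith [Nat.pos_of_ne_zero (pow_ne_zero (d - 1) (two_ne_zero (α := ℕ)))]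

theorem card_perfect_power_le {d : ℕ} (hd : 2 ≤ d) :
    Nat.card {v : Fin (d - 1) → Bool // ∃ (f : ℤ[X]) (j : ℕ), 2 ≤ j ∧ zeroOnePoly d v = f ^ j} ≤
      (d + 1) * 2 ^ (d / 2 + 1) := by
  have key : ∀ v : {v : Fin (d - 1) → Bool //
      ∃ (f : ℤ[X]) (j : ℕ), 2 ≤ j ∧ zeroOnePoly d v = f ^ j},
      ∃ x : Fin (d + 1) × (Fin (d / 2 + 1) → ZMod 2),
        (zeroOnePoly d v).map (Int.castRingHom (ZMod 2)) =
          (∑ i : Fin (d / 2 + 1), C (x.2 i) * X ^ (i : ℕ)) ^ (x.1 : ℕ) := by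
    rintro ⟨v, f, j, hj, hP⟩
    have hdeg : d = j * f.natDegree := by
      rw [← natDegree_pow, ← hP, zeroOnePoly_natDegree v hd]
    have hf : 1 ≤ f.natDegree := by
      by_contra h
      have : f.natDegree = 0 := by omega
      simp [this] at hdeg; omega
    have hjd : j ≤ d := by nlinarith
    have hfd : f.natDegree ≤ d / 2 := by
      rw [Nat.le_div_iff_mul_le two_pos]; nlinarith
    refine ⟨⟨⟨j, by omega⟩, fun i => (f.coeff i : ZMod 2)⟩, ?_⟩
    rw [hP, Polynomial.map_pow]
    congr 1
    rw [Fin.sum_univ_eq_sum_range (fun i => C ((f.coeff i : ℤ) : ZMod 2) * X ^ i)]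
    conv_lhs => rw [Polynomial.as_sum_range' f (d / 2 + 1) (by omega)]
    simp [Polynomial.map_sum, ← C_mul_X_pow_eq_monomial]
  choose g hg using key
  have hinj : Function.Injective g := by
    intro v w hvw
    have h : (zeroOnePoly d v).map (Int.castRingHom (ZMod 2)) =
        (zeroOnePoly d w).map (Int.castRingHom (ZMod 2)) := by rw [hg, hg, hvw]
    refine Subtype.ext (funext fun i => ?_)
    have hi := congrArg (fun p => p.coeff ((i : ℕ) + 1)) h
    simp only [coeff_map, zeroOnePoly_coeff_succ _ hd] at hi
    cases h1 : v.1 i <;> cases h2 : w.1 i <;> simp [h1, h2] at hi ⊢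
  refine (Nat.card_le_card_of_injective g hinj).trans (le_of_eq ?_)
  simp

theorem mul_card_perfect_power_le {d : ℕ} (hd : 2 ≤ d) :
    Nat.card {v : Fin (d - 1) → Bool //
      ∃ (f : ℤ[X]) (j : ℕ), 2 ≤ j ∧ zeroOnePoly d v = f ^ j} * d ≤ 2 ^ (d - 1) * 64 := by
  have aux : ∀ n : ℕ, 8 * (n + 1) * (2 * n + 1) ≤ 64 * 2 ^ n := by
    intro n
    induction n with
    | zero => norm_num
    | succ n ih =>
      rw [pow_succ]
      have : n < 2 ^ n := Nat.lt_two_pow_self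
      nlinarith
  refine (Nat.mul_le_mul_right _ (card_perfect_power_le hd)).trans ?_
  set n := d / 2
  have h1 : d ≤ 2 * n + 1 := by omega
  have h2 : 2 * n - 1 ≤ d - 1 := by omega
  have h3 : 1 ≤ n := by omega
  refine le_trans ?_ (Nat.mul_le_mul_right _ (Nat.pow_le_pow_right two_pos h2))
  obtain ⟨q, hq⟩ : ∃ q, n = q + 1 := ⟨n - 1, by omega⟩
  have ha := aux n
  calc (d + 1) * 2 ^ (n + 1) * d ≤ (2 * n + 1 + 1) * 2 ^ (n + 1) * (2 * n + 1) := by gcongr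
    _ = (8 * (n + 1) * (2 * n + 1)) * 2 ^ q := by rw [hq]; ring
    _ ≤ (64 * 2 ^ n) * 2 ^ q := by gcongr
    _ = 2 ^ (2 * n - 1) * 64 := by
      rw [show 2 * n - 1 = n + q by omega, pow_add]; ring

theorem card_isExceptional_mul_le {d B : ℕ} (hd : 2 ≤ d) (hB : B ^ 3 ≤ d) :
    Nat.card {v : Fin (d - 1) → Bool // IsExceptional (zeroOnePoly d v) B} * d ≤
      2 ^ (d - 1) * 116 := by
  classical
  have h1 := card_exists_cyclotomic_dvd_mul_le hB
  have h2 := mul_card_perfect_power_le hd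
  have h : Nat.card {v : Fin (d - 1) → Bool // IsExceptional (zeroOnePoly d v) B} ≤
      Nat.card {v : Fin (d - 1) → Bool //
        ∃ r, 3 ≤ r ∧ r ≤ B ∧ cyclotomic r ℤ ∣ zeroOnePoly d v} +
      Nat.card {v : Fin (d - 1) → Bool //
        ∃ (f : ℤ[X]) (j : ℕ), 2 ≤ j ∧ zeroOnePoly d v = f ^ j} := by
    simp only [Nat.card_eq_fintype_card, Fintype.card_subtype, IsExceptional]
    rw [Finset.filter_or]
    exact Finset.card_union_le _ _
  nlinarith

theorem le_card_primes_between {l : ℕ} (hl : 20 ≤ l) :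
    l ≤ ((Finset.range (l ^ 3 + 1)).filter fun q => q.Prime ∧ 2 * l ≤ q).card := by
  have hl' : (20 : ℝ) ≤ l := by exact_mod_cast hl
  have hl0 : (0 : ℝ) < l := by linarith
  have hpi : 3 * l ≤ Nat.primeCounting (l ^ 3) := by
    have h := Chebyshev.pi_ge (l ^ 3)
    have hlog : Real.log ((l ^ 3 : ℕ) : ℝ) = 3 * Real.log l := by
      push_cast; rw [Real.log_pow]; norm_num
    have h1 : Real.log l ≤ l := (Real.log_le_sub_one_of_pos hl0).trans (by linarith)
    have h1' : 0 < Real.log l := Real.log_pos (by linarith)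
    have h2 : Real.log (((l ^ 3 : ℕ) : ℝ) + 1) ≤ 3 * (l + 1) := by
      have : ((l ^ 3 : ℕ) : ℝ) + 1 ≤ (l + 1) ^ 3 := by push_cast; nlinarith
      refine (Real.log_le_log (by positivity) this).trans ?_
      rw [Real.log_pow]
      have := Real.log_le_sub_one_of_pos (show (0 : ℝ) < l + 1 by linarith)
      push_cast; linarith
    rw [hlog, div_le_iff₀ (by positivity)] at h
    have hl2 := Real.log_two_gt_d9
    have hn : (0 : ℝ) ≤ Nat.primeCounting (l ^ 3) := Nat.cast_nonneg _
    have h3 : ((l ^ 3 : ℕ) : ℝ) * Real.log 2 - 3 * (l + 1) ≤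
        Nat.primeCounting (l ^ 3) * (3 * l) :=
      (by linarith : _ ≤ _).trans (h.trans (by gcongr))
    by_contra hc
    have hc' : (Nat.primeCounting (l ^ 3) : ℝ) ≤ 3 * l := by exact_mod_cast (not_le.1 hc).le
    have h4 : ((l ^ 3 : ℕ) : ℝ) * (1 / 2) - 3 * (l + 1) ≤ 3 * l * (3 * l) := by
      refine le_trans (by gcongr; linarith) (h3.trans (by gcongr))
    push_cast at h4
    nlinarith [mul_nonneg (sq_nonneg (l : ℝ)) (sub_nonneg.2 hl')]
  rw [Nat.primeCounting, Nat.primeCounting', Nat.count_eq_card_filter_range] at hpi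
  have hsub : (Finset.range (l ^ 3 + 1)).filter Nat.Prime ⊆
      ((Finset.range (l ^ 3 + 1)).filter fun q => q.Prime ∧ 2 * l ≤ q) ∪ Finset.range (2 * l) := by
    intro q hq
    simp only [Finset.mem_union, Finset.mem_filter, Finset.mem_range] at hq ⊢
    by_cases h : q < 2 * l
    · exact Or.inr h
    · exact Or.inl ⟨hq.1, hq.2, by omega⟩
  have h := (Finset.card_le_card hsub).trans (Finset.card_union_le _ _)
  rw [Finset.card_range] at h
  have := hpi.trans ((le_of_eq (by congr)).trans h)
  omega

theorem exists_forall_mul_pow_le_two_pow (c : ℝ) (j : ℕ) :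
    ∃ N : ℕ, ∀ n, N ≤ n → c * (n : ℝ) ^ j ≤ 2 ^ n := by
  have h := (tendsto_pow_const_mul_const_pow_of_abs_lt_one j
    (show |(1 / 2 : ℝ)| < 1 by rw [abs_of_pos] <;> norm_num)).const_mul c
  rw [mul_zero] at h
  obtain ⟨N, hN⟩ := Filter.eventually_atTop.1 (h.eventually_le_const one_pos)
  refine ⟨N, fun n hn => ?_⟩
  have := hN n hn
  rw [one_div, inv_pow, ← mul_assoc, ← div_eq_mul_inv, div_le_one (by positivity)] at this
  exact this

theorem four_fifths_pow_le (n : ℕ) : ((4 / 5 : ℝ)) ^ (100 * n) ≤ 1 / (2 ^ n) ^ 4 := by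
  rw [← one_div_pow, ← one_div_pow, ← pow_mul, mul_comm n 4, pow_mul, pow_mul]
  gcongr
  norm_num

theorem reducible_error_le {A : ℝ} (hA : 0 ≤ A) {n d : ℕ} (hn : 1 ≤ n) (h1 : 2 ^ n ≤ d)
    (h2 : d ≤ 2 * 2 ^ n) (h3 : 1000 * (800 * n) ^ 9 ≤ 2 ^ n) (h4 : 2000 * A * (800 * n) ≤ 2 ^ n)
    {W : ℕ} (hW : (800 * n) ^ 3 ≤ W) :
    A * d ^ 2 * (100 * n : ℕ) * (4 / 5) ^ (100 * n) ≤ 1 / (2 * d) ∧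
    (1 + A * (100 * n : ℕ) * (4 / 5) ^ (100 * n)) *
      (1 + 2 ^ (8 * (100 * n)) * Real.exp (-2 * (1 / (8 * (100 * n) : ℕ)) ^ 2) ^ W) - 1 ≤ 2 / d ∧
    2 * d * (12 * d ^ 2 + 4 * d * ((800 * n) ^ 3 : ℕ) ^ 2) *
      ((100 * n : ℕ) * (1 / 2 : ℝ) ^ (100 * n)) ≤ 1 / d := by
  set x : ℝ := 2 ^ n with hx
  set y : ℝ := (d : ℝ) with hy
  have hnR : (1 : ℝ) ≤ n := by exact_mod_cast hn
  have hx1 : 1 ≤ x := one_le_pow₀ (by norm_num)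
  have hxy : x ≤ y := by rw [hx, hy]; exact_mod_cast h1
  have hyx : y ≤ 2 * x := by rw [hx, hy]; exact_mod_cast h2
  have hy0 : 0 < y := by linarith
  have h3' : 1000 * (800 * (n : ℝ)) ^ 9 ≤ x := by rw [hx]; exact_mod_cast h3
  have hfirst : A * y ^ 2 * (100 * n : ℕ) * (4 / 5) ^ (100 * n) ≤ 1 / (2 * y) := by
    have hp := four_fifths_pow_le n
    rw [← hx] at hp
    rw [le_div_iff₀ (by positivity)]
    calc A * y ^ 2 * (100 * n : ℕ) * (4 / 5) ^ (100 * n) * (2 * y)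
        = A * (100 * n : ℕ) * 2 * y ^ 3 * (4 / 5) ^ (100 * n) := by ring
      _ ≤ A * (100 * n : ℕ) * 2 * (2 * x) ^ 3 * (1 / x ^ 4) := by gcongr
      _ = (1600 * A * n) / x := by push_cast; field_simp; ring
      _ ≤ 1 := by
        rw [div_le_one (by linarith)]
        refine le_trans ?_ h4
        nlinarith [mul_nonneg hA (by linarith : (0 : ℝ) ≤ n)]
  refine ⟨hfirst, ?_, ?_⟩
  · have ha : A * (100 * n : ℕ) * (4 / 5) ^ (100 * n) ≤ 1 / (2 * y) := by
      refine le_trans ?_ hfirst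
      have : (1 : ℝ) ≤ y ^ 2 := one_le_pow₀ (by linarith)
      have h0 : 0 ≤ A * ((100 * n : ℕ) : ℝ) * (4 / 5) ^ (100 * n) := by positivity
      nlinarith
    have hb : 2 ^ (8 * (100 * n)) * Real.exp (-2 * (1 / (8 * (100 * n) : ℕ)) ^ 2) ^ W ≤ 1 / y := by
      have hl : ((8 * (100 * n) : ℕ) : ℝ) = 800 * n := by push_cast; ring
      have he : Real.exp (-2 * (1 / (8 * (100 * n) : ℕ)) ^ 2) ^ W ≤
          (1 / 2 : ℝ) ^ (1600 * n) := by
        have hhalf : Real.exp (-1) ≤ 1 / 2 := by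
          rw [Real.exp_neg, one_div]
          gcongr
          linarith [Real.add_one_le_exp (1 : ℝ)]
        refine le_trans ?_ (pow_le_pow_left₀ (Real.exp_pos _).le hhalf _)
        rw [← Real.exp_nat_mul, ← Real.exp_nat_mul, Real.exp_le_exp, hl]
        have hWR : (800 * (n : ℝ)) ^ 3 ≤ W := by exact_mod_cast hW
        have : (1600 * n : ℝ) ≤ W * (2 * (1 / (800 * (n : ℝ))) ^ 2) := by
          calc (1600 * n : ℝ) = (800 * (n : ℝ)) ^ 3 * (2 * (1 / (800 * (n : ℝ))) ^ 2) := by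
                field_simp; ring
            _ ≤ _ := by gcongr
        push_cast
        linarith
      rw [le_div_iff₀ hy0]
      calc 2 ^ (8 * (100 * n)) * Real.exp (-2 * (1 / (8 * (100 * n) : ℕ)) ^ 2) ^ W * y
          ≤ 2 ^ (8 * (100 * n)) * (1 / 2 : ℝ) ^ (1600 * n) * (2 * x) := by gcongr
        _ = (1 / 2 : ℝ) ^ (800 * n) * (2 * 2 ^ n) := by
            rw [show 1600 * n = 8 * (100 * n) + 800 * n by ring,
              pow_add, ← mul_assoc ((2 : ℝ) ^ (8 * (100 * n))), ← mul_pow,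
              hx, mul_one_div_cancel two_ne_zero, one_pow, one_mul]
        _ ≤ (1 / 2 : ℝ) ^ (2 * n) * (2 ^ n * 2 ^ n) := by
            gcongr ?_ * (?_ * _)
            · exact pow_le_pow_of_le_one (by norm_num) (by norm_num) (by omega)
            · exact le_self_pow₀ (by norm_num) (by omega)
        _ = 1 := by
            rw [← pow_add, ← two_mul, ← mul_pow]; norm_num
    have hy1 : 1 ≤ y := hx1.trans hxy
    calc _ ≤ (1 + 1 / (2 * y)) * (1 + 1 / y) - 1 := by gcongr
      _ ≤ 2 / y := by
        rw [← sub_nonneg]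
        have : 2 / y - ((1 + 1 / (2 * y)) * (1 + 1 / y) - 1) = (y - 1) / (2 * y ^ 2) := by
          field_simp; ring
        rw [this]
        exact div_nonneg (by linarith) (by positivity)
  · rw [le_div_iff₀ hy0]
    have hpow : (1 / 2 : ℝ) ^ (100 * n) ≤ 1 / x ^ 5 := by
      rw [hx, ← pow_mul, ← one_div_pow]
      exact pow_le_pow_of_le_one (by norm_num) (by norm_num) (by omega)
    have hB : (1 : ℝ) ≤ (((800 * n) ^ 3 : ℕ) : ℝ) := by
      exact_mod_cast Nat.one_le_pow _ _ (by omega)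
    have hy1 : 1 ≤ y := hx1.trans hxy
    set b : ℝ := (((800 * n) ^ 3 : ℕ) : ℝ) with hb
    have hbn : b = (800 * (n : ℝ)) ^ 3 := by rw [hb]; push_cast; ring
    have hin : 12 * y ^ 2 + 4 * y * b ^ 2 ≤ 16 * y ^ 2 * b ^ 2 := by
      have h1 : 1 ≤ b ^ 2 := one_le_pow₀ hB
      nlinarith [mul_nonneg (sq_nonneg y) (sub_nonneg.2 h1),
        mul_nonneg (mul_nonneg hy0.le (sub_nonneg.2 hy1)) (sq_nonneg b)]
    calc 2 * y * (12 * y ^ 2 + 4 * y * b ^ 2) * ((100 * n : ℕ) * (1 / 2 : ℝ) ^ (100 * n)) * y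
        ≤ 2 * y * (16 * y ^ 2 * b ^ 2) * ((100 * n : ℕ) * (1 / x ^ 5)) * y := by gcongr
      _ = 32 * y ^ 4 * (b ^ 2 * (100 * n)) / x ^ 5 := by push_cast; ring
      _ ≤ 32 * (2 * x) ^ 4 * (b ^ 2 * (100 * n)) / x ^ 5 := by gcongr
      _ = 512 * (b ^ 2 * (100 * n)) / x := by field_simp; ring
      _ ≤ 1 := by
        rw [div_le_one (by linarith)]
        refine le_trans ?_ h3'
        rw [hbn]
        have h1 : (1 : ℝ) ≤ 800 * n := by linarith
        have h2 : (800 * (n : ℝ)) ^ 7 ≤ (800 * (n : ℝ)) ^ 9 := pow_le_pow_right₀ h1 (by norm_num)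
        have h0 : 0 ≤ (800 * (n : ℝ)) ^ 7 := by positivity
        calc 512 * (((800 * (n : ℝ)) ^ 3) ^ 2 * (100 * n)) = 64 * (800 * (n : ℝ)) ^ 7 := by ring
          _ ≤ _ := by linarith

theorem exists_card_reducible_le_div : ∃ D : ℕ, ∀ d : ℕ, 2 ≤ d → D ≤ d →
    (∀ a : ℂ, (∃ Q : Polynomial ℤ, Q ≠ 0 ∧ (∀ i, Q.coeff i = 0 ∨ Q.coeff i = 1) ∧
      Polynomial.aeval a Q = 0) → RHFor (IntermediateField.adjoin ℚ ({a} : Set ℂ))) →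
    ∃ B : ℕ, B ^ 3 ≤ d ∧
    (Nat.card {v : Fin (d - 1) → Bool // ¬Irreducible (zeroOnePoly d v) ∧
      (zeroOnePoly d v).eval (-1) ≠ 0 ∧ ¬IsExceptional (zeroOnePoly d v) B} : ℝ) ≤
    2 * Nat.card {v : Fin (d - 1) → Bool // IsExceptional (zeroOnePoly d v) B} +
      2 ^ (d - 1) * (7 / d) := by
  obtain ⟨A, hA, hmain⟩ := exists_card_reducible_le
  obtain ⟨N₁, hN₁⟩ := exists_forall_mul_pow_le_two_pow (1000 * 800 ^ 9) 9
  obtain ⟨N₂, hN₂⟩ := exists_forall_mul_pow_le_two_pow (2000 * A * 800) 1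
  refine ⟨2 ^ (max (max N₁ N₂) 1), fun d hd hD hRH => ?_⟩
  set n := Nat.log 2 d with hn
  have hnN : max (max N₁ N₂) 1 ≤ n := (Nat.le_log_iff_pow_le (by norm_num) (by omega)).2 hD
  have hn1 : 1 ≤ n := (le_max_right _ _).trans hnN
  have hx1 : 2 ^ n ≤ d := Nat.pow_log_le_self 2 (by omega)
  have hx2 : d ≤ 2 * 2 ^ n := by
    have := Nat.lt_pow_succ_log_self (b := 2) (by norm_num) d
    rw [← hn, Nat.pow_succ] at this
    omega
  have h3 : 1000 * (800 * n) ^ 9 ≤ 2 ^ n := by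
    have := hN₁ n (by omega)
    rw [mul_pow]
    rw [← mul_assoc]
    exact_mod_cast this
  have h4 : 2000 * A * (800 * n) ≤ 2 ^ n := by
    have := hN₂ n (by omega)
    rwa [pow_one, mul_assoc (2000 * A)] at this
  set l := 800 * n with hl
  have hl1 : 800 ≤ l := by omega
  have hl9 : l ^ 8 ≤ l ^ 9 := Nat.pow_le_pow_right (by omega) (by norm_num)
  set L := 8 * (100 * n) * (8 * (100 * n) * l ^ 3) + 1 with hL
  have hLl : L = l ^ 5 + 1 := by rw [hL, hl]; ring
  have hWle : l ^ 3 ≤ (d - 1) / L := by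
    rw [Nat.le_div_iff_mul_le (by omega), hLl]
    have e : l ^ 3 * (l ^ 5 + 1) = l ^ 8 + l ^ 3 := by ring
    have h5 : l ^ 3 ≤ l ^ 9 := Nat.pow_le_pow_right (by omega) (by norm_num)
    have h6 : 1 ≤ l ^ 9 := Nat.one_le_pow _ _ (by omega)
    omega
  obtain ⟨e1, e2, e3⟩ := reducible_error_le hA hn1 hx1 hx2 h3 h4 hWle
  have hl8 : l = 8 * (100 * n) := by omega
  have hd0 : (2 : ℝ) ≤ d := by exact_mod_cast hd
  refine ⟨l ^ 3, ?_, ?_⟩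
  · rw [← pow_mul, show 3 * 3 = 9 from rfl]; omega
  have := hmain d hd hRH (100 * n) (l ^ 3) ((d - 1) / L) (by omega)
    (by rw [← hl8]; exact le_card_primes_between (by omega)) (Nat.div_mul_le_self _ _)
    (e1.trans (by rw [div_le_div_iff₀ (by positivity) two_pos]; linarith))
  refine this.trans ?_
  gcongr
  calc _ ≤ 2 * (1 / (2 * (d : ℝ)) + (2 / d + 1 / d)) := by gcongr
    _ = 7 / d := by field_simp; norm_num

theorem not_irreducible_zeroOnePoly_of_eval_neg_one {d : ℕ} (hd : 2 ≤ d) {v : Fin (d - 1) → Bool}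
    (h : (zeroOnePoly d v).eval (-1) = 0) : ¬ Irreducible (zeroOnePoly d v) := fun hi => by
  obtain ⟨q, hq⟩ := dvd_iff_isRoot.2 (show (zeroOnePoly d v).IsRoot (-1) from h)
  have hq0 := natDegree_eq_zero_of_isUnit
    ((hi.isUnit_or_isUnit hq).resolve_left (not_isUnit_X_sub_C _))
  have hdeg := zeroOnePoly_natDegree v hd
  have := natDegree_mul_le (p := X - C (-1 : ℤ)) (q := q)
  rw [← hq, hdeg, natDegree_X_sub_C, hq0] at this
  omega

theorem card_irreducible_add_card_not (d : ℕ) :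
    Nat.card {v : Fin (d - 1) → Bool // Irreducible (zeroOnePoly d v)} +
      Nat.card {v : Fin (d - 1) → Bool // ¬ Irreducible (zeroOnePoly d v)} = 2 ^ (d - 1) := by
  classical
  rw [← Nat.card_sum, Nat.card_congr (Equiv.sumCompl _)]
  simp

theorem card_eval_neg_one_le_card_not_irreducible {d : ℕ} (hd : 2 ≤ d) :
    Nat.card {v : Fin (d - 1) → Bool // (zeroOnePoly d v).eval (-1) = 0} ≤
      Nat.card {v : Fin (d - 1) → Bool // ¬ Irreducible (zeroOnePoly d v)} :=
  Nat.card_le_card_of_injective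
    (fun v => ⟨v.1, not_irreducible_zeroOnePoly_of_eval_neg_one hd v.2⟩)
    fun v w h => Subtype.ext (by simpa using h)

theorem card_not_irreducible_le (d B : ℕ) :
    Nat.card {v : Fin (d - 1) → Bool // ¬ Irreducible (zeroOnePoly d v)} ≤
      Nat.card {v : Fin (d - 1) → Bool // (zeroOnePoly d v).eval (-1) = 0} +
      Nat.card {v : Fin (d - 1) → Bool // ¬Irreducible (zeroOnePoly d v) ∧
        (zeroOnePoly d v).eval (-1) ≠ 0 ∧ ¬IsExceptional (zeroOnePoly d v) B} +
      Nat.card {v : Fin (d - 1) → Bool // IsExceptional (zeroOnePoly d v) B} := by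
  classical
  simp only [Nat.card_eq_fintype_card, Fintype.card_subtype]
  refine (Finset.card_le_card fun v hv => ?_).trans ((Finset.card_union_le _ _).trans
    (Nat.add_le_add_right (Finset.card_union_le _ _) _))
  simp only [Finset.mem_union, Finset.mem_filter, Finset.mem_univ, true_and] at hv ⊢
  by_cases h1 : eval (-1) (zeroOnePoly d v) = 0
  · exact Or.inl (Or.inl h1)
  by_cases h2 : IsExceptional (zeroOnePoly d v) B
  · exact Or.inr h2
  · exact Or.inl (Or.inr ⟨hv, h1, h2⟩)

theorem abs_irrProb_sub_le {d B : ℕ} (hd : 2 ≤ d) (hB : B ^ 3 ≤ d)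
    (h : (Nat.card {v : Fin (d - 1) → Bool // ¬Irreducible (zeroOnePoly d v) ∧
      (zeroOnePoly d v).eval (-1) ≠ 0 ∧ ¬IsExceptional (zeroOnePoly d v) B} : ℝ) ≤
      2 * Nat.card {v : Fin (d - 1) → Bool // IsExceptional (zeroOnePoly d v) B} +
        2 ^ (d - 1) * (7 / d)) :
    |irrProb d - (1 - √(2 / (Real.pi * d)))| ≤ 360 / d := by
  have h0 := abs_le.1 (abs_card_eval_neg_one_sub_le hd)
  have h1 : (_ : ℝ) = _ := congrArg (Nat.cast (R := ℝ)) (card_irreducible_add_card_not d)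
  have h2 := Nat.cast_le (α := ℝ).2 (card_eval_neg_one_le_card_not_irreducible hd)
  have h3 := Nat.cast_le (α := ℝ).2 (card_not_irreducible_le d B)
  have h4 := Nat.cast_le (α := ℝ).2 (card_isExceptional_mul_le hd hB)
  push_cast at h1 h2 h3 h4
  unfold irrProb
  set D : ℝ := 2 ^ (d - 1) with hD
  have hD0 : 0 < D := by positivity
  have hd0 : (0 : ℝ) < d := by positivity
  rw [← le_div_iff₀ hd0, mul_div_assoc] at h4
  set I : ℝ := (Nat.card {v : Fin (d - 1) → Bool // Irreducible (zeroOnePoly d v)} : ℝ)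
  set M : ℝ := (Nat.card {v : Fin (d - 1) → Bool // (zeroOnePoly d v).eval (-1) = 0} : ℝ)
  have h5 : I / D - (1 - M / D) ≤ 0 := by
    rw [show I / D - (1 - M / D) = (I + M - D) / D by field_simp; ring]
    exact div_nonpos_of_nonpos_of_nonneg (by linarith) hD0.le
  have h6 : -(355 / d) ≤ I / D - (1 - M / D) := by
    rw [show I / D - (1 - M / D) = (I + M - D) / D by field_simp; ring, le_div_iff₀ hD0]
    have e1 : D * (116 / d) * 3 = 348 / d * D := by ring
    have e2 : D * (7 / d) = 7 / d * D := by ring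
    have e3 : -(355 / d) * D = -(348 / d * D) - 7 / d * D := by ring
    linarith
  have e : (360 : ℝ) / d = 355 / d + 5 / d := by ring
  have hd5 : (0 : ℝ) ≤ 355 / d := by positivity
  rw [abs_le]
  constructor <;> linarith

theorem abs_irrProb_sub_le_two {d : ℕ} (hd : 2 ≤ d) :
    |irrProb d - (1 - √(2 / (Real.pi * d)))| ≤ 2 := by
  have h1 : (_ : ℝ) = _ := congrArg (Nat.cast (R := ℝ)) (card_irreducible_add_card_not d)
  push_cast at h1
  have h2 : 0 ≤ irrProb d := by unfold irrProb; positivity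
  have h3 : irrProb d ≤ 1 := by
    unfold irrProb
    rw [div_le_one (by positivity), ← h1]
    exact le_add_of_nonneg_right (Nat.cast_nonneg _)
  have h4 : √(2 / (Real.pi * d)) ≤ 1 := by
    rw [Real.sqrt_le_left zero_le_one, one_pow, div_le_one (by positivity)]
    have : (2 : ℝ) ≤ d := by exact_mod_cast hd
    nlinarith [Real.pi_gt_three]
  have h5 := Real.sqrt_nonneg (2 / (Real.pi * d))
  rw [abs_le]
  constructor <;> linarith

theorem stmt3 :
    ∃ C : ℝ, 0 < C ∧
      ∀ d : ℕ, 2 ≤ d →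
        (∀ a : ℂ,
          (∃ Q : Polynomial ℤ, Q ≠ 0 ∧ (∀ i, Q.coeff i = 0 ∨ Q.coeff i = 1) ∧ aeval a Q = 0) →
          RHFor ℚ⟮a⟯) →
        |irrProb d - (1 - Real.sqrt (2 / (Real.pi * d)))| ≤ C / d := by
  obtain ⟨D, hD⟩ := exists_card_reducible_le_div
  refine ⟨360 + 2 * D, by positivity, fun d hd hRH => ?_⟩
  have hd0 : (0 : ℝ) < d := by positivity
  rcases le_or_gt D d with h | h
  · obtain ⟨B, hB, hle⟩ := hD d hd h hRH
    refine (abs_irrProb_sub_le hd hB hle).trans ?_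
    gcongr
    linarith [Nat.cast_nonneg (α := ℝ) D]
  · refine (abs_irrProb_sub_le_two hd).trans ?_
    have : (d : ℝ) ≤ D := by exact_mod_cast h.le
    rw [le_div_iff₀ hd0]
    linarith
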